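/- arXiv:1203.4148 — 5 statements merged into one kernel-verified Lean document; each statement's English description precedes it below -/
import Mathlib

section
/- Let ℓ ≤ 0 ≤ r and let (n_i)_{ℓ ≤ i ≤ r} be positive integers with n = Σ n_i. The number of rooted Cayley trees on {1,...,n} equipped with an embedding a: V → Z such that a(root) = 0 and |a(v) - a(v')| = 1 for every edge {v,v'}, having exactly n_i vertices at abscissa i for each i, equals (n_0/(n_ℓ n_r)) · n!/∏_{i=ℓ}^r (n_i - 1)! · ∏_{i=ℓ}^r (n_{i-1} + n_{i+1})^{n_i - 1}, where n_{ℓ-1} = n_{r+1} = 0. -/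
/-- graph of a parent function -/
def cvpGraph {V : Type*} (ρ : V) (f : V → V) : SimpleGraph V :=
  SimpleGraph.fromRel (fun v w => v ≠ ρ ∧ f v = w)

lemma cvp_iter_fix {V : Type*} {ρ : V} {f : V → V} (h : f ρ = ρ) (k : ℕ) : f^[k] ρ = ρ :=
  Function.iterate_fixed h k

lemma cvp_ne_self {V : Type*} {ρ : V} {f : V → V}
    (h2 : ∀ v, ∃ k : ℕ, f^[k] v = ρ) (v : V) (hv : v ≠ ρ) : f v ≠ v := by
  intro h
  obtain ⟨k, hk⟩ := h2 v
  rw [Function.iterate_fixed h k] at hk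
  exact hv hk

lemma cvp_connected {V : Type*} {ρ : V} {f : V → V}
    (h2 : ∀ v, ∃ k : ℕ, f^[k] v = ρ) : (cvpGraph ρ f).Connected := by
  have key : ∀ k : ℕ, ∀ v, f^[k] v = ρ → (cvpGraph ρ f).Reachable v ρ := by
    intro k
    induction k with
    | zero => intro v hv; simp at hv; subst hv; exact SimpleGraph.Reachable.refl _
    | succ k ih =>
      intro v hv
      by_cases h : v = ρ
      · subst h; exact SimpleGraph.Reachable.refl _
      · have := ih (f v) (by simpa using hv)
        refine SimpleGraph.Reachable.trans (SimpleGraph.Adj.reachable ?_) this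
        simp only [cvpGraph, SimpleGraph.fromRel_adj]
        exact ⟨(cvp_ne_self h2 v h).symm, Or.inl ⟨h, by trivial⟩⟩
  have : Nonempty V := ⟨ρ⟩
  refine SimpleGraph.Connected.mk ?_
  intro u v
  obtain ⟨k, hk⟩ := h2 u
  obtain ⟨l, hl⟩ := h2 v
  exact (key k u hk).trans (key l v hl).symm

lemma cvp_tree {V : Type*} [Fintype V] [DecidableEq V] {ρ : V} {f : V → V}
    (h2 : ∀ v, ∃ k : ℕ, f^[k] v = ρ) : (cvpGraph ρ f).IsTree := by
  rw [SimpleGraph.isTree_iff_connected_and_card]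
  refine ⟨cvp_connected h2, le_antisymm ?_ (cvp_connected h2).card_vert_le_card_edgeSet_add_one⟩
  have hsub : (cvpGraph ρ f).edgeSet ⊆
      (((Finset.univ.erase ρ).image (fun v => s(v, f v)) : Finset (Sym2 V)) : Set (Sym2 V)) := by
    intro e
    induction e using Sym2.ind with
    | _ x y =>
      simp only [SimpleGraph.mem_edgeSet, cvpGraph, SimpleGraph.fromRel_adj, Finset.coe_image,
        Set.mem_image, Finset.mem_coe, Finset.mem_erase, Finset.mem_univ, and_true]
      rintro ⟨_, ⟨h, rfl⟩ | ⟨h, rfl⟩⟩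
      · exact ⟨x, h, rfl⟩
      · exact ⟨y, h, Sym2.eq_swap⟩
  have h1 := Set.ncard_le_ncard hsub (Finset.finite_toSet _)
  rw [Set.ncard_coe_finset] at h1
  have h3 : ((Finset.univ.erase ρ).image (fun v => s(v, f v))).card ≤ Fintype.card V - 1 := by
    refine Finset.card_image_le.trans ?_
    rw [Finset.card_erase_of_mem (Finset.mem_univ _), Finset.card_univ]
  have h4 : 0 < Fintype.card V := Fintype.card_pos_iff.mpr ⟨ρ⟩
  rw [Nat.card_eq_fintype_card (α := V), Nat.card_coe_set_eq]
  omega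

lemma cvp_inj {V : Type*} {ρ : V} {f g : V → V} (hf : f ρ = ρ) (hg : g ρ = ρ)
    (h2 : ∀ v, ∃ k : ℕ, f^[k] v = ρ) 
    (h : cvpGraph ρ f = cvpGraph ρ g) : f = g := by
  by_contra hne
  obtain ⟨v, hv⟩ := Function.ne_iff.mp hne
  have step : ∀ v, f v ≠ g v → f (f v) ≠ g (f v) := by
    intro v hv
    have hvρ : v ≠ ρ := by rintro rfl; exact hv (hf.trans hg.symm)
    have hadj : (cvpGraph ρ f).Adj v (f v) := by
      simp only [cvpGraph, SimpleGraph.fromRel_adj]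
      exact ⟨(cvp_ne_self h2 v hvρ).symm, Or.inl ⟨hvρ, by trivial⟩⟩
    rw [h] at hadj
    simp only [cvpGraph, SimpleGraph.fromRel_adj] at hadj
    rcases hadj.2 with h' | h'
    · exact absurd h'.2.symm hv
    · rw [h'.2]
      intro h3
      -- 2-cycle
      have : ∀ k : ℕ, f^[k] v = v ∨ f^[k] v = f v := by
        intro k
        induction k with
        | zero => simp
        | succ k ih =>
          rw [Function.iterate_succ_apply']
          rcases ih with h | h <;> rw [h]
          · exact Or.inr rfl
          · exact Or.inl h3
      obtain ⟨k, hk⟩ := h2 v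
      rcases this k with h | h
      · exact hvρ (h.symm.trans hk)
      · exact h'.1 (h.symm.trans hk)
  have all : ∀ k : ℕ, f (f^[k] v) ≠ g (f^[k] v) := by
    intro k
    induction k with
    | zero => simpa using hv
    | succ k ih => rw [Function.iterate_succ_apply']; exact step _ ih
  obtain ⟨k, hk⟩ := h2 v
  have := all k
  rw [hk] at this
  exact this (hf.trans hg.symm)

lemma cvp_surj {V : Type*} {ρ : V} {G : SimpleGraph V} (hG : G.IsTree) :
    ∃ f : V → V, f ρ = ρ ∧ (∀ v, ∃ k : ℕ, f^[k] v = ρ) ∧ (∀ v, v ≠ ρ → G.Adj v (f v)) ∧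
      cvpGraph ρ f = G := by
  classical
  have ex : ∀ v, ∃ w, (v = ρ → w = ρ) ∧ (v ≠ ρ → G.Adj v w ∧ G.dist w ρ < G.dist v ρ) := by
    intro v
    by_cases hv : v = ρ
    · exact ⟨ρ, fun _ => rfl, fun h => absurd hv h⟩
    · obtain ⟨p, hp⟩ := hG.connected.exists_walk_length_eq_dist v ρ
      cases p with
      | nil => exact absurd rfl hv
      | cons hadj q =>
        rename_i w
        refine ⟨w, fun h => absurd h hv, fun _ => ⟨hadj, ?_⟩⟩
        have := SimpleGraph.dist_le q
        simp only [SimpleGraph.Walk.length_cons] at hp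
        omega
  choose f hf1 hf2 using ex
  have hreach : ∀ v, ∃ k : ℕ, f^[k] v = ρ := by
    have : ∀ d : ℕ, ∀ v, G.dist v ρ ≤ d → ∃ k : ℕ, f^[k] v = ρ := by
      intro d
      induction d with
      | zero =>
        intro v hv
        exact ⟨0, hG.connected.dist_eq_zero_iff.mp (Nat.le_zero.mp hv)⟩
      | succ d ih =>
        intro v hv
        by_cases h : v = ρ
        · exact ⟨0, h⟩
        · obtain ⟨k, hk⟩ := ih (f v) (by have := (hf2 v h).2; omega)
          exact ⟨k + 1, by simpa using hk⟩
    exact fun v => this _ v le_rfl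
  refine ⟨f, hf1 ρ rfl, hreach, fun v hv => (hf2 v hv).1, ?_⟩
  have hle : cvpGraph ρ f ≤ G := by
    intro x y
    simp only [cvpGraph, SimpleGraph.fromRel_adj]
    rintro ⟨_, ⟨h, rfl⟩ | ⟨h, rfl⟩⟩
    · exact (hf2 _ h).1
    · exact (hf2 _ h).1.symm
  exact le_antisymm hle
    ((SimpleGraph.isTree_iff_minimal_connected.mp hG).2 (cvp_connected hreach) hle)

lemma cvp_trees_eq {V : Type*} [Fintype V] [DecidableEq V] (ρ : V) (R : V → V → Prop)
    (hR : ∀ v w, R v w → R w v) :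
    {G : SimpleGraph V | G.IsTree ∧ ∀ v w, G.Adj v w → R v w}.ncard =
    {f : V → V | f ρ = ρ ∧ (∀ v, v ≠ ρ → R v (f v)) ∧ (∀ v, ∃ k : ℕ, f^[k] v = ρ)}.ncard := by
  rw [← Set.InjOn.ncard_image (f := cvpGraph ρ)
    (s := {f : V → V | f ρ = ρ ∧ (∀ v, v ≠ ρ → R v (f v)) ∧ (∀ v, ∃ k : ℕ, f^[k] v = ρ)})]
  · congr 1
    ext G
    simp only [Set.mem_ofPred_eq, Set.mem_image]
    constructor
    · rintro ⟨hG, hA⟩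
      obtain ⟨f, h1, h2, h3, h4⟩ := cvp_surj (ρ := ρ) hG
      exact ⟨f, ⟨h1, fun v hv => hA _ _ (h3 v hv), h2⟩, h4⟩
    · rintro ⟨f, ⟨h1, h2, h3⟩, rfl⟩
      refine ⟨cvp_tree h3, ?_⟩
      intro v w
      simp only [cvpGraph, SimpleGraph.fromRel_adj]
      rintro ⟨_, ⟨h, rfl⟩ | ⟨h, rfl⟩⟩
      · exact h2 _ h
      · exact hR _ _ (h2 _ h)
  · intro f hf g hg h
    exact cvp_inj hf.1 hg.1 hf.2.2 h

lemma cvp_det_of_reach {V : Type*} [Fintype V] [DecidableEq V] {ρ : V} {f : V → V}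
    (h2 : ∀ v, ∃ k : ℕ, f^[k] v = ρ) :
    Matrix.det (Matrix.of fun v : V => (Pi.single v 1 - if v = ρ then 0 else Pi.single (f v) 1 :
      V → ℚ)) = 1 := by
  classical
  let b : V → ℕᵒᵈ := fun v => OrderDual.toDual (Nat.find (h2 v))
  have hb : ∀ v, v ≠ ρ → b v < b (f v) := by
    intro v hv
    change Nat.find (h2 (f v)) < Nat.find (h2 v)
    have h := Nat.find_spec (h2 v)
    have h0 : Nat.find (h2 v) ≠ 0 := by
      intro h0; rw [h0] at h; exact hv h
    obtain ⟨m, hm⟩ := Nat.exists_eq_succ_of_ne_zero h0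
    rw [hm] at h ⊢
    refine Nat.lt_succ_of_le (Nat.find_min' _ ?_)
    simpa using h
  have hbt : Matrix.BlockTriangular (Matrix.of fun v : V =>
      (Pi.single v 1 - if v = ρ then 0 else Pi.single (f v) 1 : V → ℚ)) b := by
    intro i j hij
    have hne : j ≠ i := by rintro rfl; exact lt_irrefl _ hij
    simp only [Matrix.of_apply, Pi.sub_apply, Pi.single_apply, if_neg hne, zero_sub, neg_eq_zero]
    split_ifs with h
    · rfl
    · rw [Pi.single_apply, if_neg]
      rintro rfl
      exact lt_asymm hij (hb i h)
  rw [hbt.det]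
  refine Finset.prod_eq_one fun a _ => ?_
  refine (congrArg Matrix.det ?_).trans Matrix.det_one
  ext i j
  simp only [Matrix.toSquareBlock_def, Matrix.of_apply, Pi.sub_apply, Matrix.one_apply]
  have : (if (i : V) = ρ then (0 : V → ℚ) else Pi.single (f i) 1) j = 0 := by
    split_ifs with h
    · rfl
    · rw [Pi.single_apply, if_neg]
      intro hj
      have := hb i h
      rw [← hj, i.2, j.2] at this
      exact lt_irrefl _ this
  rw [this, sub_zero, Pi.single_apply]
  simp only [Subtype.ext_iff, eq_comm]

lemma cvp_det_of_not_reach {V : Type*} [Fintype V] [DecidableEq V] {ρ : V} {f : V → V}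
    (h2 : ¬ ∀ v, ∃ k : ℕ, f^[k] v = ρ) :
    Matrix.det (Matrix.of fun v : V => (Pi.single v 1 - if v = ρ then 0 else Pi.single (f v) 1 :
      V → ℚ)) = 0 := by
  classical
  rw [← Matrix.exists_mulVec_eq_zero_iff]
  push Not at h2
  obtain ⟨v, hv⟩ := h2
  refine ⟨fun v => if ∃ k : ℕ, f^[k] v = ρ then 0 else 1, ?_, ?_⟩
  · intro h
    have := congrFun h v
    rw [if_neg (by push Not; exact hv)] at this
    simp at this
  · ext u
    simp only [Matrix.mulVec, Matrix.of_apply, sub_dotProduct, Pi.zero_apply,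
      single_dotProduct, one_mul]
    by_cases hu : u = ρ
    · rw [if_pos ⟨0, hu⟩, if_pos hu]; simp
    · rw [if_neg hu, single_dotProduct, one_mul]
      have : (∃ k : ℕ, f^[k] u = ρ) ↔ ∃ k : ℕ, f^[k] (f u) = ρ := by
        constructor
        · rintro ⟨k, hk⟩
          cases k with
          | zero => exact absurd hk hu
          | succ k => exact ⟨k, by simpa using hk⟩
        · rintro ⟨k, hk⟩
          exact ⟨k + 1, by simpa using hk⟩
      simp only [this, sub_self]

/-- Laplacian -/
def cvpL {V : Type*} [Fintype V] [DecidableEq V] (R : V → V → Prop) [DecidableRel R] :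
    Matrix V V ℚ :=
  Matrix.of fun v => ∑ u with R v u, (Pi.single v 1 - Pi.single u 1 : V → ℚ)

lemma cvp_matrix_tree {V : Type*} [Fintype V] [DecidableEq V] (ρ : V) (R : V → V → Prop)
    [DecidableRel R] (hR : ∀ v w, R v w → R w v) :
    ({G : SimpleGraph V | G.IsTree ∧ ∀ v w, G.Adj v w → R v w}.ncard : ℚ) =
      ((cvpL R).updateRow ρ (Pi.single ρ 1)).det := by
  classical
  rw [cvp_trees_eq ρ R hR]
  let S : V → Finset V := fun v => if v = ρ then {ρ} else Finset.univ.filter (R v)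
  let g : V → V → (V → ℚ) := fun v u => (Pi.single v 1 - if v = ρ then 0 else Pi.single u 1)
  have hM : (cvpL R).updateRow ρ (Pi.single ρ 1) = Matrix.of fun v => ∑ u ∈ S v, g v u := by
    ext v w
    by_cases hv : v = ρ
    · subst hv
      simp [S, g]
    · simp [S, g, hv, cvpL, Matrix.updateRow_ne]
  have hexp := (Matrix.detRowAlternating (n := V) (R := ℚ)).toMultilinearMap.map_sum_finset g S
  have h2 : ((cvpL R).updateRow ρ (Pi.single ρ 1)).det =
      ∑ f ∈ Fintype.piFinset S, Matrix.det (Matrix.of fun v => g v (f v)) := by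
    rw [hM]; exact hexp
  rw [h2]
  have h3 : ∀ f ∈ Fintype.piFinset S, Matrix.det (Matrix.of fun v => g v (f v)) =
      if (∀ v, ∃ k : ℕ, f^[k] v = ρ) then 1 else 0 := by
    intro f _
    split_ifs with h
    · exact cvp_det_of_reach h
    · exact cvp_det_of_not_reach h
  rw [Finset.sum_congr rfl h3, Finset.sum_boole, ← Set.ncard_coe_finset]
  congr 2
  ext f
  simp only [Set.mem_ofPred_eq, Finset.coe_filter, Fintype.mem_piFinset, S]
  constructor
  · rintro ⟨h1, h2, h3⟩
    refine ⟨fun v => ?_, h3⟩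
    split_ifs with h
    · subst h; simpa using h1
    · simpa using h2 v h
  · rintro ⟨h1, h3⟩
    refine ⟨by simpa using h1 ρ, fun v hv => ?_, h3⟩
    simpa [hv] using h1 v

lemma cvp_zero_of_rowsum {V : Type*} [Fintype V] [DecidableEq V] [Nonempty V] (M : Matrix V V ℚ)
    (h : ∀ v, ∑ w, M v w = 0) : M.det = 0 := by
  rw [← Matrix.exists_mulVec_eq_zero_iff]
  refine ⟨fun _ => 1, ?_, ?_⟩
  · intro h'
    have := congrFun h' (Classical.arbitrary V)
    simp at this
  · ext v
    simp [Matrix.mulVec, dotProduct, h]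

lemma cvpL_rowsum {V : Type*} [Fintype V] [DecidableEq V] (R : V → V → Prop) [DecidableRel R]
    (v : V) : ∑ w, cvpL R v w = 0 := by
  simp only [cvpL, Matrix.of_apply, Finset.sum_apply]
  rw [Finset.sum_comm]
  refine Finset.sum_eq_zero fun u _ => ?_
  simp [Finset.sum_sub_distrib]

lemma cvp_det_add {V : Type*} [Fintype V] [DecidableEq V] (ρ : V) (R : V → V → Prop)
    [DecidableRel R] (x : V → ℚ) :
    ((cvpL R).updateRow ρ (cvpL R ρ + x)).det =
      (∑ v, x v) * ((cvpL R).updateRow ρ (Pi.single ρ 1)).det := by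
  have : Nonempty V := ⟨ρ⟩
  have hx : x = (∑ v, x v) • (Pi.single ρ 1 : V → ℚ) + (x - (∑ v, x v) • (Pi.single ρ 1)) := by
    abel
  rw [Matrix.det_updateRow_add, Matrix.updateRow_eq_self, cvp_zero_of_rowsum _ (cvpL_rowsum R)]
  conv_lhs => rw [hx]
  rw [Matrix.det_updateRow_add, Matrix.det_updateRow_smul, zero_add,
    cvp_zero_of_rowsum ((cvpL R).updateRow ρ (x - _)), add_zero]
  intro v
  by_cases hv : v = ρ
  · subst hv
    simp [Finset.sum_sub_distrib, ← Finset.mul_sum]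
  · simp [Matrix.updateRow_ne hv, cvpL_rowsum]

lemma cvp_schur {V I : Type*} [Fintype V] [DecidableEq V] [Fintype I] [DecidableEq I]
    (c : V → I) (B : Matrix I I ℚ) (d : I → ℚ) (hd : ∀ i, d i ≠ 0) (ρ : V) (i0 : I)
    (m : I → ℕ) (hm : ∀ i, (Finset.univ.filter (fun v => c v = i)).card = m i)
    (hm0 : ∀ i, 0 < m i) :
    Matrix.det (Matrix.of fun v w : V => (if v = w then d (c v) else 0) - B (c v) (c w) +
      (if v = ρ ∧ c w = i0 then 1 else 0)) =
    (∏ i, d i ^ (m i - 1)) * Matrix.det (Matrix.of fun i j : I => (if i = j then d i else 0) -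
      m i * B i j + (if i = c ρ ∧ j = i0 then 1 else 0)) := by
  let X : Matrix V I ℚ := Matrix.of fun v j =>
    (d (c v))⁻¹ * (B (c v) j - if v = ρ ∧ j = i0 then 1 else 0)
  let Y : Matrix I V ℚ := Matrix.of fun j w => if c w = j then 1 else 0
  have h1 : (Matrix.of fun v w : V => (if v = w then d (c v) else 0) - B (c v) (c w) +
      (if v = ρ ∧ c w = i0 then 1 else 0)) = Matrix.diagonal (fun v => d (c v)) * (1 - X * Y) := by
    ext v w
    rw [Matrix.diagonal_mul, Matrix.sub_apply, Matrix.mul_apply]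
    simp only [X, Y, Matrix.of_apply, mul_ite, mul_one, mul_zero, Finset.sum_ite_eq,
      Finset.mem_univ, if_true, Matrix.one_apply, mul_sub]
    rw [mul_inv_cancel_left₀ (hd _)]
    have := hd (c v)
    split_ifs <;> field_simp <;> ring
  have h2 : (Matrix.of fun i j : I => (if i = j then d i else 0) -
      m i * B i j + (if i = c ρ ∧ j = i0 then 1 else 0)) = Matrix.diagonal d * (1 - Y * X) := by
    ext i j
    rw [Matrix.diagonal_mul, Matrix.sub_apply, Matrix.mul_apply]
    have : ∑ v, Y i v * X v j = (d i)⁻¹ * (m i * B i j - if i = c ρ ∧ j = i0 then 1 else 0) := by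
      have e : ∀ v, Y i v * X v j = (d i)⁻¹ * ((if c v = i then B i j else 0) -
          if v = ρ then (if i = c ρ ∧ j = i0 then 1 else 0) else 0) := by
        intro v
        simp only [X, Y, Matrix.of_apply]
        by_cases hv : c v = i
        · subst hv
          by_cases hr : v = ρ
          · subst hr; simp
          · simp [hr]
        · by_cases hr : v = ρ
          · subst hr; simp [hv, Ne.symm hv]
          · simp [hr, hv]
      rw [Finset.sum_congr rfl (fun v _ => e v), ← Finset.mul_sum, Finset.sum_sub_distrib,
        Finset.sum_ite_eq' Finset.univ ρ, ← Finset.sum_filter, Finset.sum_const, hm]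
      simp
    rw [this]
    simp only [Matrix.of_apply, Matrix.one_apply, mul_sub]
    rw [mul_inv_cancel_left₀ (hd _)]
    have := hd i
    split_ifs <;> field_simp <;> ring
  rw [h1, h2, Matrix.det_mul, Matrix.det_mul, Matrix.det_one_sub_mul_comm, Matrix.det_diagonal,
    Matrix.det_diagonal, ← mul_assoc, ← Finset.prod_mul_distrib]
  congr 1
  rw [← Finset.prod_fiberwise_of_maps_to (s := Finset.univ) (t := Finset.univ) (g := c)
    (fun _ _ => Finset.mem_univ _)]
  refine Finset.prod_congr rfl fun i _ => ?_
  rw [Finset.prod_congr rfl (g := fun _ => d i), Finset.prod_const, hm, ← pow_succ,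
    Nat.sub_add_cancel (hm0 i)]
  intro v hv
  rw [(Finset.mem_filter.mp hv).2]

lemma cvp_tele (n : ℤ → ℕ) (ℓ : ℤ) (h : n (ℓ - 1) = 0) (k : ℕ) :
    (∏ i ∈ Finset.Icc ℓ (ℓ + k), ((n (i - 1) : ℚ) + if i = ℓ then 1 else 0)) * n (ℓ + k) =
      ∏ i ∈ Finset.Icc ℓ (ℓ + k), (n i : ℚ) := by
  induction k with
  | zero => simp [h]
  | succ k ih =>
    have e : Finset.Icc ℓ (ℓ + (k + 1 : ℕ)) = insert (ℓ + (k + 1 : ℕ)) (Finset.Icc ℓ (ℓ + k)) := by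
      ext x; simp only [Finset.mem_Icc, Finset.mem_insert]; push_cast; omega
    have hn : ℓ + (k + 1 : ℕ) ∉ Finset.Icc ℓ (ℓ + k) := by
      simp only [Finset.mem_Icc]; push_cast; omega
    rw [e, Finset.prod_insert hn, Finset.prod_insert hn, ← ih, if_neg (by push_cast; omega)]
    have : ℓ + ((k + 1 : ℕ) : ℤ) - 1 = ℓ + k := by push_cast; ring
    rw [this]
    ring

lemma cvp_tridiag (ℓ r : ℤ) (hlr : ℓ ≤ r) (n : ℤ → ℕ)
    (hzero : ∀ i : ℤ, i < ℓ ∨ r < i → n i = 0) :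
    Matrix.det (Matrix.of fun i j : Finset.Icc ℓ r =>
      (if i = j then ((n ((i : ℤ) - 1) : ℚ) + n ((i : ℤ) + 1)) else 0) -
      n i * (if |(i : ℤ) - j| = 1 then 1 else 0) + (if (i : ℤ) = ℓ ∧ (j : ℤ) = ℓ then 1 else 0))
      * n r = ∏ i ∈ Finset.Icc ℓ r, (n i : ℚ) := by
  set Q : Matrix (Finset.Icc ℓ r) (Finset.Icc ℓ r) ℚ := Matrix.of fun i j : Finset.Icc ℓ r =>
      (if i = j then ((n ((i : ℤ) - 1) : ℚ) + n ((i : ℤ) + 1)) else 0) -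
      n i * (if |(i : ℤ) - j| = 1 then 1 else 0) + (if (i : ℤ) = ℓ ∧ (j : ℤ) = ℓ then 1 else 0)
    with hQ
  let U : Matrix (Finset.Icc ℓ r) (Finset.Icc ℓ r) ℚ := Matrix.of fun i j => if i ≤ j then 1 else 0
  have hU : U.det = 1 := by
    rw [Matrix.det_of_isUpperTriangular]
    · simp [U]
    · intro i j hij
      simp only [U, Matrix.of_apply]
      exact if_neg (not_le.mpr hij)
  have hent : ∀ i j : Finset.Icc ℓ r, (U * Q) i j =
      ((if (i : ℤ) ≤ j then ((n ((j : ℤ) - 1) : ℚ) + n ((j : ℤ) + 1)) else 0)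
      - (if (i : ℤ) ≤ j - 1 then (n ((j : ℤ) - 1) : ℚ) else 0)
      - (if (i : ℤ) ≤ j + 1 then (n ((j : ℤ) + 1) : ℚ) else 0))
      + (if (i : ℤ) = ℓ ∧ (j : ℤ) = ℓ then 1 else 0) := by
    rintro ⟨i, hi⟩ ⟨j, hj⟩
    rw [Finset.mem_Icc] at hi hj
    rw [Matrix.mul_apply]
    let F : ℤ → ℚ := fun s =>
      (if s = j then (if i ≤ j then ((n (j - 1) : ℚ) + n (j + 1)) else 0) else 0)
      - (if s = j - 1 then (if i ≤ j - 1 then (n (j - 1) : ℚ) else 0) else 0)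
      - (if s = j + 1 then (if i ≤ j + 1 then (n (j + 1) : ℚ) else 0) else 0)
      + (if s = ℓ then (if i = ℓ ∧ j = ℓ then 1 else 0) else 0)
    have e : ∀ s : Finset.Icc ℓ r, U ⟨i, Finset.mem_Icc.mpr hi⟩ s *
        Q s ⟨j, Finset.mem_Icc.mpr hj⟩ = F s := by
      rintro ⟨s, hs⟩
      rw [Finset.mem_Icc] at hs
      simp only [U, hQ, Matrix.of_apply, F, Subtype.mk_le_mk, Subtype.mk.injEq]
      have habs : |s - j| = 1 ↔ (s = j - 1 ∨ s = j + 1) := by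
        rw [abs_eq (by norm_num)]; omega
      simp only [habs]
      by_cases h1 : s = j
      · subst h1
        have q1 : ¬ (s = s - 1) := by omega
        by_cases h2 : s = ℓ
        · subst h2
          have : i ≤ s ↔ i = s := by omega
          by_cases h3 : i = s <;> simp [this, h3, q1]
        · by_cases h3 : i ≤ s <;> simp [h2, h3, q1]
      · have h1' : ¬ (s = ℓ ∧ j = ℓ) := by omega
        have h1'' : s = ℓ → ¬ (i = ℓ ∧ j = ℓ) := by omega
        have z : (if s = ℓ then (if i = ℓ ∧ j = ℓ then (1 : ℚ) else 0) else 0) = 0 := by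
          split_ifs with a b
          · exact absurd b (h1'' a)
          · rfl
          · rfl
        rw [z]
        by_cases h2 : s = j - 1
        · subst h2
          have : ¬ (j - 1 = j + 1) := by omega
          by_cases h3 : i ≤ j - 1 <;> simp [h3, h1', this]
        · by_cases h3 : s = j + 1
          · subst h3
            by_cases h3 : i ≤ j + 1 <;> simp [h3, h1', h2]
          · simp [h1, h1', h2, h3]
    rw [Finset.sum_congr rfl (fun s _ => e s), Finset.sum_coe_sort (Finset.Icc ℓ r) F]
    simp only [F, Finset.sum_add_distrib, Finset.sum_sub_distrib, Finset.sum_ite_eq',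
      Finset.mem_Icc]
    rw [if_pos hj, if_pos (⟨le_rfl, hlr⟩ : ℓ ≤ ℓ ∧ ℓ ≤ r)]
    congr 1
    congr 1
    · congr 1
      by_cases h : ℓ ≤ j - 1 ∧ j - 1 ≤ r
      · rw [if_pos h]
      · rw [if_neg h, hzero (j - 1) (by omega)]; simp
    · by_cases h : ℓ ≤ j + 1 ∧ j + 1 ≤ r
      · rw [if_pos h]
      · rw [if_neg h, hzero (j + 1) (by omega)]; simp
  have hdet : Q.det = ∏ i : Finset.Icc ℓ r, ((n ((i : ℤ) - 1) : ℚ) + if (i : ℤ) = ℓ then 1 else 0) := by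
    have : (U * Q).det = Q.det := by rw [Matrix.det_mul, hU, one_mul]
    rw [← this, Matrix.det_of_isLowerTriangular]
    · refine Finset.prod_congr rfl fun i _ => ?_
      rw [hent]
      simp
    · intro i j hij
      have hij' : (i : ℤ) < j := hij
      have hi := Finset.mem_Icc.mp i.2
      rw [hent, if_pos (by omega), if_pos (by omega), if_pos (by omega), if_neg (by omega)]
      ring
  rw [hdet, Finset.prod_coe_sort (Finset.Icc ℓ r)
    (fun i : ℤ => ((n (i - 1) : ℚ) + if i = ℓ then 1 else 0))]
  obtain ⟨k, rfl⟩ := Int.le.dest hlr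
  exact cvp_tele n ℓ (hzero _ (by omega)) k

lemma cvpL_apply {V : Type*} [Fintype V] [DecidableEq V] (R : V → V → Prop) [DecidableRel R]
    (v w : V) : cvpL R v w = (if v = w then ((Finset.univ.filter (R v)).card : ℚ) else 0) -
      if R v w then 1 else 0 := by
  simp only [cvpL, Matrix.of_apply, Finset.sum_apply, Pi.sub_apply, Finset.sum_sub_distrib,
    Pi.single_apply, Finset.sum_const]
  congr 1
  · by_cases h : v = w
    · simp [h]
    · simp [h, Ne.symm h]
  · rw [Finset.sum_ite_eq]
    simp

lemma cvp_deg {V : Type*} [Fintype V] [DecidableEq V] (a : V → ℤ) (n : ℤ → ℕ)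
    (ha : ∀ i : ℤ, (Finset.univ.filter (fun v => a v = i)).card = n i) (v : V) :
    (Finset.univ.filter (fun w => |a v - a w| = 1)).card = n (a v - 1) + n (a v + 1) := by
  rw [← ha, ← ha, ← Finset.card_union_of_disjoint]
  · congr 1
    ext w
    simp only [Finset.mem_filter, Finset.mem_univ, true_and, Finset.mem_union]
    rw [abs_eq (by norm_num)]
    omega
  · rw [Finset.disjoint_filter]
    intro w _ h
    omega

lemma cvp_tau_lt {V : Type*} [Fintype V] [DecidableEq V] (ℓ r : ℤ) (hlr : ℓ < r) (n : ℤ → ℕ)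
    (hpos : ∀ i ∈ Finset.Icc ℓ r, 0 < n i)
    (hzero : ∀ i : ℤ, i < ℓ ∨ r < i → n i = 0) (a : V → ℤ)
    (ha : ∀ i : ℤ, (Finset.univ.filter (fun v => a v = i)).card = n i) :
    {G : SimpleGraph V | G.IsTree ∧ ∀ v w, G.Adj v w → |a v - a w| = 1}.ncard * (n ℓ * n r) =
      (∏ i ∈ Finset.Icc ℓ r, n i) *
        ∏ i ∈ Finset.Icc ℓ r, (n (i - 1) + n (i + 1)) ^ (n i - 1) := by
  have hmem : ∀ v, a v ∈ Finset.Icc ℓ r := by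
    intro v
    have : 0 < n (a v) := by
      rw [← ha]; exact Finset.card_pos.mpr ⟨v, by simp⟩
    rw [Finset.mem_Icc]
    by_contra h
    have := hzero (a v) (by omega)
    omega
  have hl : ℓ ∈ Finset.Icc ℓ r := Finset.mem_Icc.mpr ⟨le_rfl, hlr.le⟩
  obtain ⟨ρ, hρ⟩ : ∃ ρ, a ρ = ℓ := by
    have := hpos ℓ hl
    rw [← ha] at this
    obtain ⟨ρ, h⟩ := Finset.card_pos.mp this
    exact ⟨ρ, by simpa using h⟩
  let R : V → V → Prop := fun v w => |a v - a w| = 1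
  have hR : ∀ v w, R v w → R w v := fun v w h => by
    simp only [R] at h ⊢; rwa [abs_sub_comm]
  have : DecidableRel R := fun v w => inferInstanceAs (Decidable (|a v - a w| = 1))
  have hmt := cvp_matrix_tree ρ R hR
  have hadd := cvp_det_add ρ R (fun w => if a w = ℓ then 1 else 0)
  have hsum : ∑ w, (if a w = ℓ then (1 : ℚ) else 0) = n ℓ := by
    rw [Finset.sum_boole, ha]
  rw [← hmt, hsum] at hadd
  let c : V → Finset.Icc ℓ r := fun v => ⟨a v, hmem v⟩
  have hschur := cvp_schur c (Matrix.of fun i j => if |(i : ℤ) - j| = 1 then (1 : ℚ) else 0)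
    (fun i => (n ((i : ℤ) - 1) : ℚ) + n ((i : ℤ) + 1))
    (by
      rintro ⟨i, hi⟩
      rw [Finset.mem_Icc] at hi
      have : 0 < n (i - 1) + n (i + 1) := by
        by_cases h : i = ℓ
        · have := hpos (i + 1) (by rw [Finset.mem_Icc]; omega)
          omega
        · have := hpos (i - 1) (by rw [Finset.mem_Icc]; omega)
          omega
      have h2 : (0 : ℚ) < (n (i - 1) : ℚ) + n (i + 1) := by exact_mod_cast this
      exact h2.ne')
    ρ ⟨ℓ, hl⟩ (fun i => n i)
    (by
      rintro ⟨i, hi⟩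
      rw [← ha i]
      congr 1
      ext v
      simp [c])
    (fun i => hpos i i.2)
  have hK : (cvpL R).updateRow ρ (cvpL R ρ + fun w => if a w = ℓ then 1 else 0) =
      (Matrix.of fun v w : V => (if v = w then (n ((c v : ℤ) - 1) : ℚ) + n ((c v : ℤ) + 1) else 0) -
        (Matrix.of fun i j : Finset.Icc ℓ r => if |(i : ℤ) - j| = 1 then (1 : ℚ) else 0)
          (c v) (c w) + (if v = ρ ∧ c w = ⟨ℓ, hl⟩ then 1 else 0)) := by
    ext v w
    have e : cvpL R v w = (if v = w then (n (a v - 1) : ℚ) + n (a v + 1) else 0) -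
        if |a v - a w| = 1 then 1 else 0 := by
      rw [cvpL_apply]
      congr 2
      have := cvp_deg a n ha v
      rw [← Nat.cast_add, ← this]
      congr 2
      ext u
      simp [R]
    by_cases hv : v = ρ
    · subst hv
      simp [e, c]
    · simp [e, c, hv]
  rw [hK, hschur] at hadd
  have htri := cvp_tridiag ℓ r hlr.le n hzero
  have hQ : (Matrix.of fun i j : Finset.Icc ℓ r =>
      (if i = j then ((n ((i : ℤ) - 1) : ℚ) + n ((i : ℤ) + 1)) else 0) -
      n i * (Matrix.of fun i j : Finset.Icc ℓ r => if |(i : ℤ) - j| = 1 then (1 : ℚ) else 0) i j +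
      (if i = c ρ ∧ j = ⟨ℓ, hl⟩ then 1 else 0)) = (Matrix.of fun i j : Finset.Icc ℓ r =>
      (if i = j then ((n ((i : ℤ) - 1) : ℚ) + n ((i : ℤ) + 1)) else 0) -
      n i * (if |(i : ℤ) - j| = 1 then 1 else 0) +
        (if (i : ℤ) = ℓ ∧ (j : ℤ) = ℓ then 1 else 0)) := by
    ext i j
    have e : (i = c ρ ∧ j = ⟨ℓ, hl⟩) ↔ ((i : ℤ) = ℓ ∧ (j : ℤ) = ℓ) := by
      have hc : ((c ρ : Finset.Icc ℓ r) : ℤ) = ℓ := hρ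
      rw [Subtype.ext_iff, Subtype.ext_iff, hc]
    simp only [Matrix.of_apply, e]
  rw [hQ] at hadd
  have hprod := Finset.prod_coe_sort (Finset.Icc ℓ r)
    (fun i : ℤ => ((n (i - 1) : ℚ) + n (i + 1)) ^ (n i - 1))
  rw [hprod] at hadd
  have : (({G : SimpleGraph V | G.IsTree ∧ ∀ v w, G.Adj v w → |a v - a w| = 1}.ncard : ℚ)
      * (n ℓ * n r)) = (∏ i ∈ Finset.Icc ℓ r, (n i : ℚ)) *
        ∏ i ∈ Finset.Icc ℓ r, ((n (i - 1) : ℚ) + n (i + 1)) ^ (n i - 1) := by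
    rw [← htri]
    linear_combination (-(n r : ℚ)) * hadd
  exact_mod_cast this

lemma cvp_tau_eq {V : Type*} [Fintype V] [DecidableEq V] (ℓ : ℤ) (n : ℤ → ℕ)
    (hpos : 0 < n ℓ)
    (hzero : ∀ i : ℤ, i < ℓ ∨ ℓ < i → n i = 0) (a : V → ℤ)
    (ha : ∀ i : ℤ, (Finset.univ.filter (fun v => a v = i)).card = n i) :
    {G : SimpleGraph V | G.IsTree ∧ ∀ v w, G.Adj v w → |a v - a w| = 1}.ncard * (n ℓ * n ℓ) =
      n ℓ * (n (ℓ - 1) + n (ℓ + 1)) ^ (n ℓ - 1) := by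
  have hmem : ∀ v, a v = ℓ := by
    intro v
    have : 0 < n (a v) := by
      rw [← ha]; exact Finset.card_pos.mpr ⟨v, by simp⟩
    by_contra h
    have := hzero (a v) (by omega)
    omega
  have hcard : Fintype.card V = n ℓ := by
    rw [← ha ℓ, ← Finset.card_univ]
    congr 1
    ext v; simp [hmem]
  have : Nonempty V := Fintype.card_pos_iff.mp (by omega)
  rw [hzero (ℓ - 1) (by omega), hzero (ℓ + 1) (by omega)]
  by_cases h1 : n ℓ = 1
  · have : Subsingleton V := Fintype.card_le_one_iff_subsingleton.mp (by omega)
    rw [h1]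
    have : {G : SimpleGraph V | G.IsTree ∧ ∀ v w, G.Adj v w → |a v - a w| = 1} = {⊥} := by
      ext G
      simp only [Set.mem_ofPred_eq, Set.mem_singleton_iff]
      constructor
      · intro _; exact Subsingleton.elim _ _
      · rintro rfl
        exact ⟨SimpleGraph.IsTree.of_subsingleton, fun v w h => absurd h (by simp)⟩
    rw [this]
    simp
  · have hnt : Nontrivial V := Fintype.one_lt_card_iff_nontrivial.mp (by omega)
    have : {G : SimpleGraph V | G.IsTree ∧ ∀ v w, G.Adj v w → |a v - a w| = 1} = ∅ := by
      rw [Set.eq_empty_iff_forall_notMem]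
      rintro G ⟨hG, hA⟩
      obtain ⟨v, w, hvw⟩ := exists_pair_ne V
      obtain ⟨p⟩ := hG.connected v w
      cases p with
      | nil => exact hvw rfl
      | cons h _ =>
        have := hA _ _ h
        rw [hmem, hmem] at this
        simp at this
    rw [this, zero_add, zero_pow (by omega)]
    simp

lemma cvp_tau {V : Type*} [Fintype V] [DecidableEq V] (ℓ r : ℤ) (hlr : ℓ ≤ r) (n : ℤ → ℕ)
    (hpos : ∀ i ∈ Finset.Icc ℓ r, 0 < n i)
    (hzero : ∀ i : ℤ, i < ℓ ∨ r < i → n i = 0) (a : V → ℤ)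
    (ha : ∀ i : ℤ, (Finset.univ.filter (fun v => a v = i)).card = n i) :
    {G : SimpleGraph V | G.IsTree ∧ ∀ v w, G.Adj v w → |a v - a w| = 1}.ncard * (n ℓ * n r) =
      (∏ i ∈ Finset.Icc ℓ r, n i) *
        ∏ i ∈ Finset.Icc ℓ r, (n (i - 1) + n (i + 1)) ^ (n i - 1) := by
  rcases hlr.lt_or_eq with h | rfl
  · exact cvp_tau_lt ℓ r h n hpos hzero a ha
  · rw [cvp_tau_eq ℓ n (hpos ℓ (by simp)) hzero a ha]
    simp

lemma cvp_count {V : Type*} [Fintype V] [DecidableEq V] (ℓ r : ℤ) (n : ℤ → ℕ)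
    (hzero : ∀ i : ℤ, i < ℓ ∨ r < i → n i = 0)
    (hN : Fintype.card V = ∑ i ∈ Finset.Icc ℓ r, n i) :
    {a : V → ℤ | ∀ i : ℤ, (Finset.univ.filter (fun v => a v = i)).card = n i}.Finite ∧
    {a : V → ℤ | ∀ i : ℤ, (Finset.univ.filter (fun v => a v = i)).card = n i}.ncard *
      ∏ i ∈ Finset.Icc ℓ r, (n i).factorial = (Fintype.card V).factorial := by
  classical
  have hcard : Fintype.card V = Fintype.card (Σ i : Finset.Icc ℓ r, Fin (n i)) := by
    rw [hN, Fintype.card_sigma]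
    simp only [Fintype.card_fin]
    exact (Finset.sum_coe_sort (Finset.Icc ℓ r) n).symm
  let E : V ≃ (Σ i : Finset.Icc ℓ r, Fin (n i)) := Fintype.equivOfCardEq hcard
  let a0 : V → ℤ := fun v => ((E v).1 : ℤ)
  have ha0 : ∀ i : ℤ, (Finset.univ.filter (fun v => a0 v = i)).card = n i := by
    intro i
    by_cases hi : i ∈ Finset.Icc ℓ r
    · have : (Finset.univ.filter (fun v => a0 v = i)) =
          Finset.univ.image (fun x : Fin (n i) => E.symm ⟨⟨i, hi⟩, x⟩) := by
        ext v
        simp only [Finset.mem_filter, Finset.mem_univ, true_and, Finset.mem_image]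
        constructor
        · intro h
          obtain ⟨⟨⟨j, hj⟩, x⟩, hx⟩ : ∃ y, E v = y := ⟨_, rfl⟩
          have hji : j = i := by simpa [a0, hx] using h
          subst hji
          exact ⟨x, by rw [Equiv.symm_apply_eq, hx]⟩
        · rintro ⟨x, rfl⟩
          simp [a0]
      rw [this, Finset.card_image_of_injective]
      · simp
      · intro x y h
        simpa using h
    · have : (Finset.univ.filter (fun v => a0 v = i)) = ∅ := by
        rw [Finset.filter_eq_empty_iff]
        rintro v _ rfl
        exact hi (E v).1.2
      rw [this, hzero i (by rw [Finset.mem_Icc] at hi; omega)]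
      rfl
  have hA : {a : V → ℤ | ∀ i : ℤ, (Finset.univ.filter (fun v => a v = i)).card = n i} =
      ((Finset.univ.image (fun σ : Equiv.Perm V => a0 ∘ σ) : Finset (V → ℤ)) : Set (V → ℤ)) := by
    ext a
    simp only [Set.mem_ofPred_eq, Finset.coe_image, Finset.coe_univ, Set.image_univ, Set.mem_range]
    constructor
    · intro h
      have hc : ∀ i, Nonempty ({v // a v = i} ≃ {v // a0 v = i}) := by
        intro i
        refine ⟨Fintype.equivOfCardEq ?_⟩
        rw [Fintype.card_subtype, Fintype.card_subtype, h, ha0]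
      refine ⟨Equiv.ofFiberEquiv (fun i => (hc i).some), ?_⟩
      ext v
      exact Equiv.ofFiberEquiv_map _ v
    · rintro ⟨σ, rfl⟩ i
      rw [← ha0 i]
      refine Finset.card_bij (fun v _ => σ v) ?_ ?_ ?_
      · intro v hv; simpa using hv
      · intro v _ w _ h; exact σ.injective h
      · intro w hw
        exact ⟨σ.symm w, by simpa using hw, by simp⟩
  have hstab : (Finset.univ.filter (fun g : Equiv.Perm V => a0 ∘ g = a0)).card =
      ∏ i ∈ Finset.Icc ℓ r, (n i).factorial := by
    have h := DomMulAct.stabilizer_card' a0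
    rw [Fintype.card_subtype] at h
    rw [h]
    have h2 : ∀ i, Fintype.card {v // a0 v = i} = n i := fun i => by
      rw [Fintype.card_subtype, ha0]
    simp only [h2]
    refine Finset.prod_subset ?_ ?_
    · intro i hi
      obtain ⟨v, _, rfl⟩ := Finset.mem_image.mp hi
      exact (E v).1.2
    · intro i _ hi
      have : n i = 0 := by
        rw [← ha0 i, Finset.card_eq_zero, Finset.filter_eq_empty_iff]
        intro v _ hv
        exact hi (Finset.mem_image.mpr ⟨v, Finset.mem_univ _, hv⟩)
      rw [this, Nat.factorial_zero]
  rw [hA]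
  refine ⟨Finset.finite_toSet _, ?_⟩
  rw [Set.ncard_coe_finset, ← Fintype.card_perm, ← Finset.card_univ (α := Equiv.Perm V),
    Finset.card_eq_sum_card_image (fun σ : Equiv.Perm V => a0 ∘ σ) Finset.univ,
    Finset.sum_congr rfl (g := fun _ => ∏ i ∈ Finset.Icc ℓ r, (n i).factorial),
    Finset.sum_const, smul_eq_mul]
  intro a ha
  obtain ⟨τ, _, rfl⟩ := Finset.mem_image.mp ha
  rw [← hstab]
  refine Finset.card_bij (fun σ _ => σ * τ⁻¹) ?_ ?_ ?_
  · intro σ hσ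
    simp only [Finset.mem_filter, Finset.mem_univ, true_and] at hσ ⊢
    ext v
    have := congrFun hσ (τ⁻¹ v)
    simpa using this
  · intro σ _ σ' _ h
    exact mul_right_cancel h
  · intro g hg
    simp only [Finset.mem_filter, Finset.mem_univ, true_and] at hg
    refine ⟨g * τ, ?_, by simp⟩
    simp only [Finset.mem_filter, Finset.mem_univ, true_and]
    ext v
    exact congrFun hg (τ v)

theorem cayley_vertical_profile
    (ℓ r : ℤ) (hl : ℓ ≤ 0) (hr : 0 ≤ r) (n : ℤ → ℕ)
    (hpos : ∀ i ∈ Finset.Icc ℓ r, 0 < n i)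
    (hzero : ∀ i : ℤ, i < ℓ ∨ r < i → n i = 0)
    (N : ℕ) (hN : N = ∑ i ∈ Finset.Icc ℓ r, n i) :
    {p : SimpleGraph (Fin N) × Fin N × (Fin N → ℤ) |
        p.1.IsTree ∧ p.2.2 p.2.1 = 0 ∧
        (∀ v w, p.1.Adj v w → |p.2.2 v - p.2.2 w| = 1) ∧
        (∀ i : ℤ, {v : Fin N | p.2.2 v = i}.ncard = n i)}.ncard
      * (n ℓ * n r) * ∏ i ∈ Finset.Icc ℓ r, (n i - 1).factorial =
    n 0 * N.factorial *
      ∏ i ∈ Finset.Icc ℓ r, (n (i - 1) + n (i + 1)) ^ (n i - 1) := by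
  classical
  obtain ⟨hfin, hcount⟩ := cvp_count (V := Fin N) ℓ r n hzero (by rw [Fintype.card_fin, hN])
  rw [Fintype.card_fin] at hcount
  have hfib : ∀ (a : Fin N → ℤ) (i : ℤ), {v : Fin N | a v = i}.ncard =
      (Finset.univ.filter (fun v => a v = i)).card := by
    intro a i
    rw [← Set.ncard_coe_finset]
    simp
  simp only [hfib]
  set A := {a : Fin N → ℤ | ∀ i : ℤ, (Finset.univ.filter (fun v => a v = i)).card = n i} with hAdef
  let e : {p : SimpleGraph (Fin N) × Fin N × (Fin N → ℤ) |
        p.1.IsTree ∧ p.2.2 p.2.1 = 0 ∧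
        (∀ v w, p.1.Adj v w → |p.2.2 v - p.2.2 w| = 1) ∧
        (∀ i : ℤ, (Finset.univ.filter (fun v => p.2.2 v = i)).card = n i)} ≃
      Σ a : A, {v : Fin N // a.1 v = 0} ×
        {G : SimpleGraph (Fin N) | G.IsTree ∧ ∀ v w, G.Adj v w → |a.1 v - a.1 w| = 1} :=
    { toFun := fun p => ⟨⟨p.1.2.2, p.2.2.2.2⟩, ⟨p.1.2.1, p.2.2.1⟩, ⟨p.1.1, p.2.1, p.2.2.2.1⟩⟩
      invFun := fun q => ⟨(q.2.2.1, q.2.1.1, q.1.1), q.2.2.2.1, q.2.1.2, q.2.2.2.2, q.1.2⟩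
      left_inv := fun p => rfl
      right_inv := fun q => rfl }
  have : Fintype A := hfin.fintype
  rw [← Nat.card_coe_set_eq, Nat.card_congr e, Nat.card_sigma]
  have hterm : ∀ a : A, Nat.card ({v : Fin N // a.1 v = 0} ×
        {G : SimpleGraph (Fin N) | G.IsTree ∧ ∀ v w, G.Adj v w → |a.1 v - a.1 w| = 1})
      * (n ℓ * n r) = n 0 * ((∏ i ∈ Finset.Icc ℓ r, n i) *
        ∏ i ∈ Finset.Icc ℓ r, (n (i - 1) + n (i + 1)) ^ (n i - 1)) := by
    intro a
    rw [Nat.card_prod, Nat.card_eq_fintype_card, Fintype.card_subtype, a.2 0, Nat.card_coe_set_eq,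
      mul_assoc, cvp_tau ℓ r (hl.trans hr) n hpos hzero a.1 a.2]
  rw [Finset.sum_mul, Finset.sum_congr rfl (fun a _ => hterm a), Finset.sum_const,
    Finset.card_univ, ← Nat.card_eq_fintype_card, Nat.card_coe_set_eq, smul_eq_mul, ← hcount]
  have hf : ∏ i ∈ Finset.Icc ℓ r, (n i).factorial =
      (∏ i ∈ Finset.Icc ℓ r, n i) * ∏ i ∈ Finset.Icc ℓ r, (n i - 1).factorial := by
    rw [← Finset.prod_mul_distrib]
    exact Finset.prod_congr rfl fun i hi => (Nat.mul_factorial_pred (hpos i hi).ne').symm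
  rw [hf]
  ring
end

section
/- For positive integers n_0, n_1, the number of spanning trees of the complete bipartite graph K_{n_0, n_1} equals n_1^{n_0 - 1} · n_0^{n_1 - 1}. -/
open Finset
namespace KT
variable {W : Type*} [Fintype W] [DecidableEq W]

def R (f : W → Option W) (u v : W) : Prop := f v = some u

def opt (u : Option W) : W → ℚ := fun j => if u = some j then 1 else 0

def M (f : W → Option W) : Matrix W W ℚ :=
  fun v j => (if v = j then 1 else 0) - opt (f v) j

lemma det_wf (f : W → Option W) (h : WellFounded (R f)) : (M f).det = 1 := by
  have hd : ∀ v, M f v v = 1 := by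
    intro v
    have : ¬ f v = some v := fun hv => h.irrefl.irrefl v hv
    simp [M, opt, this]
  rw [Matrix.det_apply, Finset.sum_eq_single 1]
  · simp [hd]
  · intro σ _ hσ
    by_contra hne
    have h1 : ∀ i, M f (σ i) i ≠ 0 := by
      intro i hi
      apply hne
      rw [Finset.prod_eq_zero (f := fun i => M f (σ i) i) (Finset.mem_univ i) hi, smul_zero]
    apply hσ
    have h2 : ∀ v, σ.symm v = v := by
      intro v
      induction v using h.induction with
      | _ v ih =>
      have := h1 (σ.symm v)
      rw [Equiv.apply_symm_apply] at this
      by_contra hv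
      have h3 : f v = some (σ.symm v) := by
        by_contra h3
        apply this
        simp [M, opt, h3, Ne.symm hv]
      have := ih (σ.symm v) h3
      exact hv (σ.symm.injective this)
    ext i
    have := h2 (σ i)
    simp at this
    simp [← this]
  · simp

lemma det_not_wf (f : W → Option W) (h : ¬ WellFounded (R f)) : (M f).det = 0 := by
  classical
  rw [← Matrix.exists_mulVec_eq_zero_iff]
  refine ⟨fun v => if Acc (R f) v then 0 else 1, ?_, ?_⟩
  · intro h0
    apply h
    constructor
    intro v
    by_contra hv
    have := congrFun h0 v
    simp [hv] at this
  · ext v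
    have key : Acc (R f) v ↔ ∀ u, f v = some u → Acc (R f) u :=
      ⟨fun ha u hu => ha.inv hu, fun hh => ⟨v, fun u hu => hh u hu⟩⟩
    simp only [Matrix.mulVec, dotProduct, M, opt, sub_mul, Finset.sum_sub_distrib, ite_mul,
      one_mul, zero_mul, Pi.zero_apply]
    rw [Finset.sum_ite_eq]
    rcases hfv : f v with _ | u
    · simp [key, hfv]
    · simp [key, hfv]

lemma det_M (f : W → Option W) [Decidable (WellFounded (R f))] :
    (M f).det = if WellFounded (R f) then 1 else 0 := by
  split_ifs with h
  · exact det_wf f h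
  · exact det_not_wf f h

open Classical in
lemma det_lap (w : W → Option W → ℚ) :
    Matrix.det (fun v j => (if v = j then ∑ u, w v u else 0) - w v (some j) : Matrix W W ℚ) =
      ∑ f : W → Option W, (∏ v, w v (f v)) * if WellFounded (R f) then 1 else 0 := by
  have : (fun v j => (if v = j then ∑ u, w v u else 0) - w v (some j) : Matrix W W ℚ) =
      fun v => ∑ u : Option W, w v u • (fun j => (if v = j then (1:ℚ) else 0) - opt u j) := by
    ext v j
    simp only [Finset.sum_apply, Pi.smul_apply, smul_eq_mul, mul_sub, Finset.sum_sub_distrib, opt]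
    simp
  rw [this]
  have h := (Matrix.detRowAlternating (n := W) (R := ℚ)).toMultilinearMap.map_sum
    (fun v (u : Option W) => w v u • (fun j => (if v = j then (1:ℚ) else 0) - opt u j))
  refine h.trans ?_
  refine Finset.sum_congr rfl fun f _ => ?_
  refine (MultilinearMap.map_smul_univ _ _ _).trans ?_
  rw [smul_eq_mul, ← det_M]
  rfl

def Gf (f : W → Option W) : SimpleGraph (Option W) :=
  SimpleGraph.fromRel (fun x y => ∃ v, x = some v ∧ y = f v)

lemma Gf_adj (f : W → Option W) (h : WellFounded (R f)) (v) : (Gf f).Adj (some v) (f v) := by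
  rw [Gf, SimpleGraph.fromRel_adj]
  exact ⟨fun hv => h.irrefl.irrefl v hv.symm, Or.inl ⟨v, rfl, rfl⟩⟩

lemma Gf_conn (f : W → Option W) (h : WellFounded (R f)) : (Gf f).Connected := by
  have : ∀ x, (Gf f).Reachable x none := by
    intro x
    rcases x with _ | v
    · rfl
    · induction v using h.induction with
      | _ v ih =>
      have h1 := (Gf_adj f h v).reachable
      rcases hf : f v with _ | u
      · rwa [hf] at h1
      · rw [hf] at h1
        exact h1.trans (ih u hf)
  exact ⟨fun x y => (this x).trans (this y).symm⟩

lemma Gf_tree (f : W → Option W) (h : WellFounded (R f)) : (Gf f).IsTree := by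
  have hc := Gf_conn f h
  rw [SimpleGraph.isTree_iff_connected_and_card]
  refine ⟨hc, le_antisymm ?_ hc.card_vert_le_card_edgeSet_add_one⟩
  have hs : (Gf f).edgeSet ⊆ Set.range (fun v => s(some v, f v)) := by
    intro e
    induction e with
    | _ a b =>
    rw [SimpleGraph.mem_edgeSet, Gf, SimpleGraph.fromRel_adj]
    rintro ⟨_, ⟨v, rfl, rfl⟩ | ⟨v, rfl, rfl⟩⟩
    · exact ⟨v, rfl⟩
    · exact ⟨v, Sym2.eq_swap⟩
  have h1 := Nat.card_mono (Set.finite_range _) hs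
  have h2 := Finite.card_range_le (fun v => s(some v, f v))
  have h3 : Nat.card (Option W) = Nat.card W + 1 := by simp
  omega

lemma Gf_inj (f g : W → Option W) (hf : WellFounded (R f)) (hg : WellFounded (R g))
    (h : Gf f = Gf g) : f = g := by
  ext1 v
  induction v using hf.induction with
  | _ v ih =>
  have h1 := Gf_adj f hf v
  rw [h, Gf, SimpleGraph.fromRel_adj] at h1
  obtain ⟨h0, ⟨u, h2, h3⟩ | ⟨u, h2, h3⟩⟩ := h1
  · cases h2; exact h3
  · have := ih u h2
    rw [← this] at h3
    exact absurd (show R f v u from h3.symm) (hf.asymmetric _ _ h2)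

lemma Gf_surj (H : SimpleGraph (Option W)) (hH : H.IsTree) :
    ∃ f, WellFounded (R f) ∧ (∀ v, H.Adj (some v) (f v)) ∧ Gf f = H := by
  have : ∀ v : W, ∃ u, H.Adj (some v) u ∧ H.dist u none < H.dist (some v) none := by
    intro v
    obtain ⟨p, hp⟩ := hH.1.exists_walk_length_eq_dist (some v) none
    cases p with
    | cons hadj q =>
      refine ⟨_, hadj, ?_⟩
      have := SimpleGraph.dist_le q
      simp at hp
      omega
  choose f hf hd using this
  have hw : WellFounded (R f) := by
    refine Subrelation.wf (r := InvImage (· < ·) fun v : W => H.dist (some v) none) ?_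
      (InvImage.wf _ wellFounded_lt)
    intro u v huv
    have := hd v
    rw [show f v = some u from huv] at this
    exact this
  refine ⟨f, hw, hf, ?_⟩
  have hle : Gf f ≤ H := by
    intro a b
    rw [Gf, SimpleGraph.fromRel_adj]
    rintro ⟨_, ⟨v, rfl, rfl⟩ | ⟨v, rfl, rfl⟩⟩
    · exact hf v
    · exact (hf v).symm
  exact le_antisymm hle ((SimpleGraph.isTree_iff_minimal_connected.1 hH).2 (Gf_conn f hw) hle)

open Classical in
lemma tree_count (G : SimpleGraph (Option W)) :
    (({H : SimpleGraph (Option W) | H ≤ G ∧ H.IsTree}.ncard : ℕ) : ℚ) =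
    Matrix.det (fun v j => (if v = j then ∑ u, (if G.Adj (some v) u then 1 else 0) else 0)
      - (if G.Adj (some v) (some j) then 1 else 0) : Matrix W W ℚ) := by
  rw [det_lap (fun v u => if G.Adj (some v) u then 1 else 0)]
  have h1 : {H : SimpleGraph (Option W) | H ≤ G ∧ H.IsTree} =
      Gf '' {f : W → Option W | (∀ v, G.Adj (some v) (f v)) ∧ WellFounded (R f)} := by
    ext H
    constructor
    · rintro ⟨hle, hT⟩
      obtain ⟨f, hw, ha, rfl⟩ := Gf_surj H hT
      exact ⟨f, ⟨fun v => hle (ha v), hw⟩, rfl⟩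
    · rintro ⟨f, ⟨ha, hw⟩, rfl⟩
      refine ⟨?_, Gf_tree f hw⟩
      intro a b
      rw [Gf, SimpleGraph.fromRel_adj]
      rintro ⟨_, ⟨v, rfl, rfl⟩ | ⟨v, rfl, rfl⟩⟩
      · exact ha v
      · exact (ha v).symm
  rw [h1, Set.InjOn.ncard_image (fun f hf g hg h => Gf_inj f g hf.2 hg.2 h),
    Set.ncard_eq_toFinset_card', Finset.card_eq_sum_ones, Nat.cast_sum, Set.toFinset_ofPred,
    Finset.sum_filter]
  refine Finset.sum_congr rfl fun f _ => ?_
  rw [Finset.prod_ite_zero]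
  by_cases a : ∀ v, G.Adj (some v) (f v) <;> by_cases b : WellFounded (R f) <;> simp [a, b]

def eqv (m n : ℕ) : Option (Fin m ⊕ Fin n) ≃ Fin (m+1) ⊕ Fin n where
  toFun x := match x with
    | none => Sum.inl 0
    | some (Sum.inl i) => Sum.inl i.succ
    | some (Sum.inr j) => Sum.inr j
  invFun := Sum.elim (Fin.cases none (fun i => some (Sum.inl i))) (fun j => some (Sum.inr j))
  left_inv x := by rcases x with _ | _ | _ <;> simp
  right_inv x := by
    rcases x with i | j
    · induction i using Fin.cases <;> simp
    · simp

lemma ncard_transport {V V' : Type*} (e : V ≃ V') (G : SimpleGraph V') :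
    {H : SimpleGraph V' | H ≤ G ∧ H.IsTree}.ncard =
    {H : SimpleGraph V | H ≤ G.comap e ∧ H.IsTree}.ncard := by
  have : {H : SimpleGraph V | H ≤ G.comap e ∧ H.IsTree} =
      (fun H : SimpleGraph V' => H.comap e) '' {H : SimpleGraph V' | H ≤ G ∧ H.IsTree} := by
    ext H
    constructor
    · rintro ⟨h1, h2⟩
      refine ⟨H.comap e.symm, ⟨?_, ?_⟩, ?_⟩
      · intro a b hab
        have := h1 hab
        simpa using this
      · exact (SimpleGraph.Iso.comap e.symm H).isTree_iff.2 h2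
      · ext a b; simp
    · rintro ⟨H, ⟨h1, h2⟩, rfl⟩
      exact ⟨fun a b hab => h1 hab, (SimpleGraph.Iso.comap e H).isTree_iff.2 h2⟩
  rw [this, Set.ncard_image_of_injective]
  intro H K h
  ext a b
  have := congrArg (fun L : SimpleGraph V => L.Adj (e.symm a) (e.symm b)) h
  simpa using this

lemma det_block (m n : ℕ) (hn : 0 < n) :
    (Matrix.fromBlocks ((n : ℚ) • (1 : Matrix (Fin m) (Fin m) ℚ)) (Matrix.of fun _ _ => -1)
      (Matrix.of fun _ _ => -1) (((m : ℚ) + 1) • (1 : Matrix (Fin n) (Fin n) ℚ))).det =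
    n ^ m * (m + 1) ^ (n - 1) := by
  have hn0 : (n : ℚ) ≠ 0 := by positivity
  have hm0 : (m : ℚ) + 1 ≠ 0 := by positivity
  let : Invertible ((n : ℚ) • (1 : Matrix (Fin m) (Fin m) ℚ)) :=
    ⟨(n : ℚ)⁻¹ • 1, by simp [hn0], by simp [hn0]⟩
  rw [Matrix.det_fromBlocks₁₁]
  have h1 : ⅟((n : ℚ) • (1 : Matrix (Fin m) (Fin m) ℚ)) = (n : ℚ)⁻¹ • 1 := rfl
  rw [h1]
  have h2 : ((m : ℚ) + 1) • (1 : Matrix (Fin n) (Fin n) ℚ) -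
      (Matrix.of fun _ _ => -1 : Matrix (Fin n) (Fin m) ℚ) * ((n : ℚ)⁻¹ • (1 : Matrix (Fin m) (Fin m) ℚ)) *
      (Matrix.of fun _ _ => -1 : Matrix (Fin m) (Fin n) ℚ) =
      ((m : ℚ) + 1) • ((1 : Matrix (Fin n) (Fin n) ℚ) + Matrix.replicateCol Unit (fun _ : Fin n => -(m : ℚ) / (n * (m + 1))) *
        Matrix.replicateRow Unit (fun _ : Fin n => (1 : ℚ))) := by
    ext i j
    simp only [Matrix.mul_smul, Matrix.mul_one, Matrix.smul_mul, Matrix.sub_apply,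
      Matrix.smul_apply, Matrix.add_apply, Matrix.mul_apply, Matrix.replicateCol_apply,
      Matrix.replicateRow_apply]
    simp
    field_simp
    ring
  rw [h2, Matrix.det_smul, Matrix.det_smul, Matrix.det_one_add_replicateCol_mul_replicateRow]
  obtain ⟨k, rfl⟩ : ∃ k, n = k + 1 := ⟨n - 1, by omega⟩
  simp [dotProduct]
  push_cast at hn0
  left
  field_simp
  ring

end KT

theorem spanning_trees_complete_bipartite (n₀ n₁ : ℕ) (h0 : 0 < n₀) (h1 : 0 < n₁) :
    {H : SimpleGraph (Fin n₀ ⊕ Fin n₁) |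
        H ≤ completeBipartiteGraph (Fin n₀) (Fin n₁) ∧ H.IsTree}.ncard =
      n₁ ^ (n₀ - 1) * n₀ ^ (n₁ - 1) := by
  classical
  obtain ⟨m, rfl⟩ : ∃ m, n₀ = m + 1 := ⟨n₀ - 1, by omega⟩
  rw [KT.ncard_transport (KT.eqv m n₁)]
  have h := KT.tree_count ((completeBipartiteGraph (Fin (m+1)) (Fin n₁)).comap (KT.eqv m n₁))
  have h2 := KT.det_block m n₁ h1
  have h3 := h.trans (Eq.trans ?_ h2)
  · rw [Nat.add_sub_cancel]
    exact_mod_cast h3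
  · congr 1
    ext v j
    rcases v with v | v <;> rcases j with j | j <;>
      simp only [Fintype.sum_option, Fintype.sum_sum_type] <;>
      simp [KT.eqv, Matrix.one_apply, add_comm]
end

section
/- The number of rooted trees on {1,...,n} having exactly k_i vertices with i children, for each i ≥ 0 (so Σ_i k_i = n and Σ_i i·k_i = n - 1), equals n!·(n-1)! / (∏_i k_i! · ∏_i (i!)^{k_i}). -/
open Finset in
def IsPar {V : Type*} (S : Finset V) (r : V) (f : V → V) : Prop :=
  r ∈ S ∧ f r = r ∧ (∀ v ∈ S, f v ∈ S) ∧ (∀ v, v ∉ S → f v = v) ∧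
    ∃ h : V → ℕ, h r = 0 ∧ ∀ v ∈ S, v ≠ r → h v = h (f v) + 1

open Classical in
noncomputable def PT {V : Type*} [Fintype V] (S : Finset V) (d : V → ℕ) :
    Finset (V × (V → V)) :=
  Finset.univ.filter fun p => IsPar S p.1 p.2 ∧
    ∀ v ∈ S, (S.filter fun w => w ≠ p.1 ∧ p.2 w = v).card = d v

theorem IsPar.exists_child {V : Type*} {S : Finset V} {r : V} {f : V → V} (H : IsPar S r f)
    {w : V} (hw : w ∈ S) (hwr : w ≠ r) : ∃ v ∈ S, v ≠ r ∧ f v = r := by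
  obtain ⟨-, -, hS, -, h, -, hh⟩ := H
  induction hN : h w using Nat.strong_induction_on generalizing w with
  | _ N ih =>
    by_cases e : f w = r
    · exact ⟨w, hw, hwr, e⟩
    · have := hh w hw hwr
      exact ih (h (f w)) (by omega) (hS w hw) e rfl

theorem IsPar.ne {V : Type*} {S : Finset V} {r : V} {f : V → V} (H : IsPar S r f)
    {w : V} (hw : w ∈ S) (hwr : w ≠ r) : f w ≠ w := by
  obtain ⟨-, -, hS, -, h, -, hh⟩ := H
  intro e
  have := hh w hw hwr
  rw [e] at this
  omega

open Classical in
theorem PT_fiber {V : Type*} [Fintype V] (S : Finset V) (d : V → ℕ) (v0 u : V)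
    (hv0 : v0 ∈ S) (hd0 : d v0 = 0) (hu : u ∈ S.erase v0) (hdu : d u ≠ 0)
    (hPT : ∀ p ∈ PT S d, p.1 ≠ v0) :
    ((PT S d).filter fun p => p.2 v0 = u).card =
      (PT (S.erase v0) (Function.update d u (d u - 1))).card := by
  have huS := Finset.mem_of_mem_erase hu
  have huv := Finset.ne_of_mem_erase hu
  refine Finset.card_nbij' (fun p => (p.1, Function.update p.2 v0 v0))
    (fun p => (p.1, Function.update p.2 v0 u)) ?_ ?_ ?_ ?_
  · rintro ⟨r, f⟩ hp
    simp only [Finset.coe_filter, Set.mem_ofPred_eq] at hp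
    obtain ⟨hp, hfu⟩ := hp
    have hr := hPT _ hp
    simp only [PT, Finset.mem_filter, Finset.mem_univ, true_and] at hp
    obtain ⟨⟨h1, h2, h3, h4, h, h5, h6⟩, hd⟩ := hp
    simp only at hr hfu h1
    have nov : ∀ w ∈ S, w ≠ r → f w ≠ v0 := by
      intro w hw hwr e
      have := hd v0 hv0
      rw [hd0, Finset.card_eq_zero] at this
      have : w ∈ (∅ : Finset V) := by rw [← this]; simp [hw, hwr, e]
      simp at this
    simp only [PT, Finset.coe_filter, Finset.mem_univ, true_and, Set.mem_ofPred_eq]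
    refine ⟨⟨?_, ?_, ?_, ?_, h, h5, ?_⟩, ?_⟩
    · simp [hr, h1]
    · simp [Function.update_of_ne hr, h2]
    · intro v hv
      have hvS := Finset.mem_of_mem_erase hv
      have hvv := Finset.ne_of_mem_erase hv
      rw [Function.update_of_ne hvv]
      refine Finset.mem_erase.2 ⟨?_, h3 v hvS⟩
      by_cases e : v = r
      · rw [e, h2]; exact hr
      · exact nov v hvS e
    · intro v hv
      by_cases e : v = v0
      · simp [e]
      · rw [Function.update_of_ne e]
        exact h4 v (fun h => hv (Finset.mem_erase.2 ⟨e, h⟩))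
    · intro v hv hvr
      rw [Function.update_of_ne (Finset.ne_of_mem_erase hv)]
      exact h6 v (Finset.mem_of_mem_erase hv) hvr
    · intro v hv
      have key : ((S.erase v0).filter fun w => w ≠ r ∧ Function.update f v0 v0 w = v) =
          (S.filter fun w => w ≠ r ∧ f w = v).erase v0 := by
        ext w
        simp only [Finset.mem_filter, Finset.mem_erase]
        by_cases e : w = v0
        · simp [e]
        · simp [e]
      rw [key]
      by_cases e : v = u
      · subst e
        rw [Finset.card_erase_of_mem (by simp [hv0, hr.symm, hfu]), hd v huS]; simp
      · rw [Finset.erase_eq_of_notMem (by simp [hfu, Ne.symm e]),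
          hd v (Finset.mem_of_mem_erase hv), Function.update_of_ne e]
  · rintro ⟨r, f⟩ hp
    simp only [PT, Finset.coe_filter, Finset.mem_univ, true_and, Set.mem_ofPred_eq] at hp
    obtain ⟨⟨h1, h2, h3, h4, h, h5, h6⟩, hd⟩ := hp
    have hr := Finset.ne_of_mem_erase h1
    have hrS := Finset.mem_of_mem_erase h1
    simp only [PT, Finset.coe_filter, Finset.mem_filter, Finset.mem_univ, true_and,
      Set.mem_ofPred_eq, Function.update_self, and_true]
    refine ⟨⟨hrS, ?_, ?_, ?_, Function.update h v0 (h u + 1), ?_, ?_⟩, ?_⟩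
    · rw [Function.update_of_ne hr, h2]
    · intro v hv
      by_cases e : v = v0
      · simp [e, huS]
      · rw [Function.update_of_ne e]
        exact Finset.mem_of_mem_erase (h3 v (Finset.mem_erase.2 ⟨e, hv⟩))
    · intro v hv
      have e : v ≠ v0 := by rintro rfl; exact hv hv0
      rw [Function.update_of_ne e]
      exact h4 v (fun h => hv (Finset.mem_of_mem_erase h))
    · rw [Function.update_of_ne hr, h5]
    · intro v hv hvr
      by_cases e : v = v0
      · subst e
        simp [Function.update_of_ne huv]
      · have hv' := Finset.mem_erase.2 ⟨e, hv⟩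
        rw [Function.update_of_ne e, Function.update_of_ne e,
          Function.update_of_ne (Finset.ne_of_mem_erase (h3 v hv'))]
        exact h6 v hv' hvr
    · intro v hv
      have key : ((S.erase v0).filter fun w => w ≠ r ∧ f w = v) =
          (S.filter fun w => w ≠ r ∧ Function.update f v0 u w = v).erase v0 := by
        ext w
        simp only [Finset.mem_filter, Finset.mem_erase]
        by_cases e : w = v0
        · simp [e]
        · simp [e]
      by_cases e : v = u
      · subst e
        have := hd v hu
        rw [key, Finset.card_erase_of_mem (by simp [hv0, hr.symm])] at this
        have h0 : 0 < (S.filter fun w => w ≠ r ∧ Function.update f v0 v w = v).card :=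
          Finset.card_pos.2 ⟨v0, by simp [hv0, hr.symm]⟩
        simp only [Function.update_self] at this
        omega
      · by_cases e' : v = v0
        · subst e'
          rw [hd0, Finset.card_eq_zero, Finset.filter_eq_empty_iff]
          rintro w hw ⟨hwr, hf⟩
          by_cases e2 : w = v
          · subst e2
            simp at hf; exact huv hf
          · rw [Function.update_of_ne e2] at hf
            exact Finset.ne_of_mem_erase (h3 w (Finset.mem_erase.2 ⟨e2, hw⟩)) hf
        · have := hd v (Finset.mem_erase.2 ⟨e', hv⟩)
          rw [key, Function.update_of_ne e, Finset.erase_eq_of_notMem] at this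
          · exact this
          · simp [Ne.symm e]
  · rintro ⟨r, f⟩ hp
    simp only [Finset.coe_filter, Set.mem_ofPred_eq] at hp
    obtain ⟨hp, hfu⟩ := hp
    simp [← hfu]
  · rintro ⟨r, f⟩ hp
    simp only [PT, Finset.coe_filter, Finset.mem_univ, true_and, Set.mem_ofPred_eq] at hp
    have := hp.1.2.2.2.1 v0 (by simp)
    have h : Function.update f v0 v0 = f := by
      conv_lhs => rw [← this]
      rw [this]
      funext x
      by_cases e : x = v0
      · simp [e, this]
      · simp [e]
    simp [h]

open Classical in
theorem PT_card {V : Type*} [Fintype V] (m : ℕ) : ∀ (S : Finset V) (d : V → ℕ),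
    S.card = m + 1 → ∑ v ∈ S, d v = m →
    (PT S d).card * ∏ v ∈ S, (d v).factorial = m.factorial := by
  induction m with
  | zero =>
    intro S d hS hd
    obtain ⟨a, rfl⟩ := Finset.card_eq_one.1 hS
    simp only [Finset.sum_singleton] at hd
    have : PT {a} d = {(a, id)} := by
      ext ⟨r, f⟩
      simp only [PT, Finset.mem_filter, Finset.mem_univ, true_and, Finset.mem_singleton,
        Prod.mk.injEq]
      constructor
      · rintro ⟨⟨h1, h2, h3, h4, -⟩, -⟩
        have h1 := Finset.mem_singleton.1 h1
        refine ⟨h1, ?_⟩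
        funext x
        by_cases e : x = a
        · rw [e, ← h1, h2]; rfl
        · exact h4 x (by simpa using e)
      · rintro ⟨rfl, rfl⟩
        refine ⟨⟨by simp, rfl, by simp, by simp, fun _ => 0, rfl, ?_⟩, ?_⟩
        · intro v hv hvr; exact absurd (Finset.mem_singleton.1 hv) hvr
        · intro v hv; subst hv
          rw [hd]; simp
    simp [this, hd]
  | succ m ih =>
    intro S d hS hd
    obtain ⟨v0, hv0, hd0⟩ : ∃ v0 ∈ S, d v0 = 0 := by
      by_contra! hc
      have : ∑ v ∈ S, 1 ≤ ∑ v ∈ S, d v :=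
        Finset.sum_le_sum fun v hv => Nat.one_le_iff_ne_zero.2 (hc v hv)
      simp at this
      omega
    have hcard : (S.erase v0).card = m + 1 := by rw [Finset.card_erase_of_mem hv0]; omega
    have hsum : ∑ v ∈ S.erase v0, d v = m + 1 := by
      rw [← hd, ← Finset.add_sum_erase S d hv0, hd0, zero_add]
    have nov : ∀ p ∈ PT S d, ∀ w ∈ S, w ≠ p.1 → p.2 w ≠ v0 := by
      rintro ⟨r, f⟩ hp w hw hwr e
      simp only [PT, Finset.mem_filter, Finset.mem_univ, true_and] at hp
      have := hp.2 v0 hv0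
      rw [hd0, Finset.card_eq_zero] at this
      have : w ∈ (∅ : Finset V) := by rw [← this]; simp at hwr e ⊢; simp [hw, hwr, e]
      simp at this
    have hPT : ∀ p ∈ PT S d, p.1 ≠ v0 := by
      rintro ⟨r, f⟩ hp hr
      simp only at hr
      subst hr
      obtain ⟨w, hw⟩ : (S.erase r).Nonempty := Finset.card_pos.1 (by omega)
      have hp' := hp
      simp only [PT, Finset.mem_filter, Finset.mem_univ, true_and] at hp
      obtain ⟨v, hv, hvr, hf⟩ := hp.1.exists_child (Finset.mem_of_mem_erase hw)
        (Finset.ne_of_mem_erase hw)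
      exact nov _ hp' v hv hvr hf
    have hmaps : ∀ p ∈ PT S d, p.2 v0 ∈ S.erase v0 := by
      rintro ⟨r, f⟩ hp
      have hr := hPT _ hp
      have := nov _ hp v0 hv0 hr.symm
      simp only [PT, Finset.mem_filter, Finset.mem_univ, true_and] at hp
      exact Finset.mem_erase.2 ⟨this, hp.1.2.2.1 v0 hv0⟩
    rw [Finset.card_eq_sum_card_fiberwise hmaps, Finset.sum_mul, Nat.factorial_succ, ← hsum,
      Finset.sum_mul]
    refine Finset.sum_congr rfl fun u hu => ?_
    have huS := Finset.mem_of_mem_erase hu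
    by_cases hdu : d u = 0
    · rw [hdu, Finset.card_eq_zero.2, zero_mul, zero_mul]
      rw [Finset.filter_eq_empty_iff]
      rintro ⟨r, f⟩ hp e
      have hr := hPT _ hp
      simp only [PT, Finset.mem_filter, Finset.mem_univ, true_and] at hp
      have := hp.2 u huS
      rw [hdu, Finset.card_eq_zero] at this
      have : v0 ∈ (∅ : Finset V) := by rw [← this]; simp at hr e ⊢; simp [hv0, Ne.symm hr, e]
      simp at this
    · rw [PT_fiber S d v0 u hv0 hd0 hu hdu hPT]
      have h1 : ∑ v ∈ S.erase v0, Function.update d u (d u - 1) v = m := by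
        rw [Finset.sum_update_of_mem hu]
        rw [← Finset.add_sum_erase _ d hu] at hsum
        rw [Finset.sdiff_singleton_eq_erase]
        omega
      have h2 := ih _ _ hcard h1
      rw [← h2, ← Finset.mul_prod_erase S _ hv0, hd0, Nat.factorial_zero, one_mul,
        ← Finset.mul_prod_erase (S.erase v0) _ hu, ← Finset.mul_prod_erase (S.erase v0) _ hu]
      have h3 : ∏ x ∈ (S.erase v0).erase u, (Function.update d u (d u - 1) x).factorial =
          ∏ x ∈ (S.erase v0).erase u, (d x).factorial :=
        Finset.prod_congr rfl fun x hx => by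
          rw [Function.update_of_ne (Finset.ne_of_mem_erase hx)]
      rw [h3, Function.update_self, ← Nat.mul_factorial_pred hdu]
      ring

def PG {V : Type*} (f : V → V) : SimpleGraph V := SimpleGraph.fromRel fun a b => f a = b

theorem PG_adj {V : Type*} (f : V → V) (a b : V) :
    (PG f).Adj a b ↔ a ≠ b ∧ (f a = b ∨ f b = a) := by
  simp [PG]

theorem PG_spec {V : Type*} [Fintype V] {r : V} {f : V → V} (H : IsPar Finset.univ r f) :
    (PG f).IsTree ∧ ∀ v w, ((PG f).Adj v w ∧ (PG f).dist r w = (PG f).dist r v + 1) ↔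
      (w ≠ r ∧ f w = v) := by
  classical
  have hne : ∀ v, v ≠ r → f v ≠ v := fun v hv => H.ne (Finset.mem_univ v) hv
  obtain ⟨-, hr, -, -, h, h0, hh⟩ := H
  have hh : ∀ v, v ≠ r → h v = h (f v) + 1 := fun v hv => hh v (Finset.mem_univ v) hv
  have hadj : ∀ v, v ≠ r → (PG f).Adj (f v) v := fun v hv =>
    (PG_adj f _ _).2 ⟨hne v hv, Or.inr rfl⟩
  have hwalk : ∀ N v, h v = N → ∃ p : (PG f).Walk r v, p.length = N := by
    intro N
    induction N with
    | zero =>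
      intro v hv
      have : v = r := by
        by_contra e
        have := hh v e; omega
      subst this
      exact ⟨.nil, rfl⟩
    | succ N ih =>
      intro v hv
      have hvr : v ≠ r := by rintro rfl; omega
      have := hh v hvr
      obtain ⟨p, hp⟩ := ih (f v) (by omega)
      exact ⟨p.concat (hadj v hvr), by simp [hp]⟩
  have hconn : (PG f).Connected := by
    rw [SimpleGraph.connected_iff_exists_forall_reachable]
    refine ⟨r, fun w => ?_⟩
    obtain ⟨p, -⟩ := hwalk _ w rfl
    exact ⟨p⟩
  have hstep : ∀ a b, (PG f).Adj a b → h b ≤ h a + 1 := by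
    intro a b hab
    rw [PG_adj] at hab
    obtain ⟨hab, e | e⟩ := hab
    · by_cases ha : a = r
      · subst ha; exact absurd (hr.symm.trans e) hab
      · have := hh a ha; rw [e] at this; omega
    · by_cases hb : b = r
      · subst hb; omega
      · have := hh b hb; rw [e] at this; omega
  have hlen : ∀ a b (p : (PG f).Walk a b), h b ≤ h a + p.length := by
    intro a b p
    induction p with
    | nil => simp
    | cons hab p ih =>
      have := hstep _ _ hab
      simp only [SimpleGraph.Walk.length_cons]; omega
  have hdist : ∀ v, (PG f).dist r v = h v := by
    intro v
    obtain ⟨p, hp⟩ := hwalk _ v rfl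
    obtain ⟨q, hq⟩ := hconn.exists_walk_length_eq_dist r v
    have h1 := SimpleGraph.dist_le p
    have h2 := hlen _ _ q
    omega
  refine ⟨?_, ?_⟩
  · rw [SimpleGraph.isTree_iff_connected_and_card]
    refine ⟨hconn, le_antisymm ?_ hconn.card_vert_le_card_edgeSet_add_one⟩
    have hsub : (PG f).edgeSet ⊆ ((Finset.univ.erase r).image fun v => s(v, f v) : Finset (Sym2 V)) := by
      intro e
      induction e using Sym2.ind with
      | _ a b =>
        intro hab
        rw [SimpleGraph.mem_edgeSet, PG_adj] at hab
        obtain ⟨hab, e | e⟩ := hab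
        · have ha : a ≠ r := by rintro rfl; exact hab (hr.symm.trans e)
          simp only [Finset.coe_image, Set.mem_image]
          exact ⟨a, by simp [ha], by rw [e]⟩
        · have hb : b ≠ r := by rintro rfl; exact hab (e.symm.trans hr)
          simp only [Finset.coe_image, Set.mem_image]
          exact ⟨b, by simp [hb], by rw [e, Sym2.eq_swap]⟩
    have h1 := Set.ncard_le_ncard hsub (Finset.finite_toSet _)
    rw [Set.ncard_coe_finset] at h1
    have h2 := h1.trans Finset.card_image_le
    rw [Finset.card_erase_of_mem (Finset.mem_univ r), Finset.card_univ] at h2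
    rw [Nat.card_coe_set_eq, Nat.card_eq_fintype_card]
    have : 0 < Fintype.card V := Fintype.card_pos_iff.2 ⟨r⟩
    omega
  · intro v w
    rw [hdist, hdist]
    constructor
    · rintro ⟨hab, hd⟩
      have hw : w ≠ r := by rintro rfl; omega
      refine ⟨hw, ?_⟩
      rw [PG_adj] at hab
      obtain ⟨hab, e | e⟩ := hab
      · have hv : v ≠ r := by rintro rfl; exact hab (hr.symm.trans e)
        have := hh v hv; rw [e] at this; omega
      · exact e
    · rintro ⟨hw, rfl⟩
      exact ⟨hadj w hw, hh w hw⟩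

theorem PG_inj {V : Type*} [Fintype V] {r : V} {f g : V → V} (H : IsPar Finset.univ r f)
    (H' : IsPar Finset.univ r g) (e : PG f = PG g) : f = g := by
  funext w
  by_cases hw : w = r
  · rw [hw, H.2.1, H'.2.1]
  · have h1 := ((PG_spec H).2 (f w) w).2 ⟨hw, rfl⟩
    rw [e] at h1
    exact (((PG_spec H').2 _ _).1 h1).2.symm

theorem PG_surj {V : Type*} [Fintype V] (G : SimpleGraph V) (r : V) (hG : G.IsTree) :
    ∃ f, IsPar Finset.univ r f ∧ PG f = G := by
  classical
  have hconn := hG.connected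
  have hex : ∀ v, ∃ w, (v = r → w = r) ∧ (v ≠ r → G.Adj w v ∧ G.dist r v = G.dist r w + 1) := by
    intro v
    by_cases hv : v = r
    · exact ⟨r, fun _ => rfl, fun h => absurd hv h⟩
    · obtain ⟨p, hp⟩ := hconn.exists_walk_length_eq_dist v r
      cases p with
      | nil => exact absurd rfl hv
      | @cons _ w _ hvw q =>
        refine ⟨w, fun h => absurd h hv, fun _ => ⟨hvw.symm, ?_⟩⟩
        have h1 := SimpleGraph.dist_le q
        have h2 := hvw.symm.diff_dist_adj (u := r)
        have h3 := hconn.dist_triangle (u := r) (v := w) (w := v)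
        rw [SimpleGraph.dist_eq_one_iff_adj.2 hvw.symm] at h3
        rw [SimpleGraph.Walk.length_cons, SimpleGraph.dist_comm] at hp
        rw [SimpleGraph.dist_comm] at h1
        omega
  choose f hf1 hf2 using hex
  have hpar : IsPar Finset.univ r f :=
    ⟨by simp, hf1 r rfl, by simp, by simp, G.dist r, by simp, fun v _ hv => (hf2 v hv).2⟩
  refine ⟨f, hpar, ?_⟩
  have hle : PG f ≤ G := by
    intro a b hab
    rw [PG_adj] at hab
    obtain ⟨hab, e | e⟩ := hab
    · have ha : a ≠ r := by rintro rfl; exact hab ((hf1 _ rfl).symm.trans e)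
      have := (hf2 a ha).1
      rw [e] at this; exact this.symm
    · have hb : b ≠ r := by rintro rfl; exact hab (e.symm.trans (hf1 _ rfl))
      have := (hf2 b hb).1
      rw [e] at this; exact this
  have hmin := SimpleGraph.isTree_iff_minimal_connected.1 hG
  exact le_antisymm hle (hmin.2 (PG_spec hpar).1.connected hle)

theorem D_card (n : ℕ) (k : Fin n → ℕ) (hk : ∑ c, k c = n) :
    (Finset.univ.filter fun d : Fin n → Fin n =>
      ∀ c, (Finset.univ.filter fun v => d v = c).card = k c).card * ∏ c, (k c).factorial =
    n.factorial := by
  classical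
  have e : Fin n ≃ Σ c : Fin n, Fin (k c) :=
    Fintype.equivOfCardEq (by simp [hk])
  set d0 : Fin n → Fin n := fun v => (e v).1 with hd0
  set D := (Finset.univ.filter fun d : Fin n → Fin n =>
      ∀ c, (Finset.univ.filter fun v => d v = c).card = k c) with hD
  have hd0D : ∀ c, (Finset.univ.filter fun v => d0 v = c).card = k c := by
    intro c
    rw [← Fintype.card_subtype,
      Fintype.card_congr ((e.subtypeEquiv (q := fun x => x.1 = c) (fun a => Iff.rfl)).trans
        (Equiv.sigmaSubtype c)), Fintype.card_fin]
  have hmaps : ∀ σ ∈ (Finset.univ : Finset (Equiv.Perm (Fin n))), d0 ∘ σ ∈ D := by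
    intro σ _
    rw [hD, Finset.mem_filter]
    refine ⟨Finset.mem_univ _, fun c => ?_⟩
    rw [← hd0D c, ← Fintype.card_subtype, ← Fintype.card_subtype]
    exact Fintype.card_congr (σ.subtypeEquiv (fun a => Iff.rfl))
  have h1 := Finset.card_eq_sum_card_fiberwise hmaps
  have h2 : ∀ d ∈ D, (Finset.univ.filter fun σ : Equiv.Perm (Fin n) => d0 ∘ σ = d).card =
      ∏ c, (k c).factorial := by
    intro d hd
    rw [hD, Finset.mem_filter] at hd
    have hτ : ∃ τ : Equiv.Perm (Fin n), d0 ∘ τ = d := by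
      have hc : ∀ c, Nonempty ({a // d a = c} ≃ {b // d0 b = c}) := fun c => by
        refine ⟨Fintype.equivOfCardEq ?_⟩
        rw [Fintype.card_subtype, Fintype.card_subtype, hd.2 c, hd0D c]
      refine ⟨Equiv.ofFiberEquiv fun c => (hc c).some, ?_⟩
      funext a
      exact Equiv.ofFiberEquiv_map _ a
    obtain ⟨τ, rfl⟩ := hτ
    have h3 := DomMulAct.stabilizer_card d0
    simp only [Fintype.card_subtype, hd0D] at h3
    rw [← h3]
    refine Finset.card_nbij' (fun σ => σ * τ⁻¹) (fun σ => σ * τ) ?_ ?_ ?_ ?_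
    · intro σ hσ
      simp only [Finset.coe_filter, Finset.mem_univ, true_and, Set.mem_ofPred_eq] at hσ ⊢
      funext x
      have := congrFun hσ (τ⁻¹ x)
      simpa using this
    · intro σ hσ
      simp only [Finset.coe_filter, Finset.mem_univ, true_and, Set.mem_ofPred_eq] at hσ ⊢
      funext x
      have := congrFun hσ (τ x)
      simpa using this
    · intro σ _; simp
    · intro σ _; simp
  rw [Finset.sum_congr rfl h2, Finset.sum_const, smul_eq_mul, Finset.card_univ,
    Fintype.card_perm, Fintype.card_fin] at h1
  exact h1.symm

theorem cayley_indegree_distribution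
    (n : ℕ) (hn : 0 < n) (k : ℕ → ℕ)
    (hz : ∀ i, n ≤ i → k i = 0)
    (hsum : ∑ i ∈ Finset.range n, k i = n)
    (hsum' : ∑ i ∈ Finset.range n, i * k i = n - 1) :
    {p : SimpleGraph (Fin n) × Fin n | p.1.IsTree ∧
        ∀ c : ℕ,
          {v : Fin n | {w : Fin n | p.1.Adj v w ∧
              p.1.dist p.2 w = p.1.dist p.2 v + 1}.ncard = c}.ncard = k c}.ncard
      * ((∏ i ∈ Finset.range n, (k i).factorial) *
          ∏ i ∈ Finset.range n, (i.factorial) ^ k i) =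
    n.factorial * (n - 1).factorial := by
  classical
  let cc : Fin n × (Fin n → Fin n) → Fin n → ℕ := fun q v =>
    (Finset.univ.filter fun w => w ≠ q.1 ∧ q.2 w = v).card
  have hcc : ∀ q v, cc q v < n := by
    intro q v
    have : (Finset.univ.filter fun w => w ≠ q.1 ∧ q.2 w = v).card <
        (Finset.univ : Finset (Fin n)).card :=
      Finset.card_lt_card ((Finset.filter_ssubset).2 ⟨q.1, Finset.mem_univ _, by simp⟩)
    simpa using this
  let Y : Finset (Fin n × (Fin n → Fin n)) := Finset.univ.filter fun q =>
    IsPar Finset.univ q.1 q.2 ∧ ∀ c : ℕ, (Finset.univ.filter fun v => cc q v = c).card = k c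
  have hccG : ∀ r f, IsPar Finset.univ r f → ∀ v,
      {w : Fin n | (PG f).Adj v w ∧ (PG f).dist r w = (PG f).dist r v + 1}.ncard =
        cc (r, f) v := by
    intro r f H v
    simp only [(PG_spec H).2 v]
    simp only [cc]
    rw [← Set.ncard_coe_finset]
    simp
  have hX : {p : SimpleGraph (Fin n) × Fin n | p.1.IsTree ∧
        ∀ c : ℕ,
          {v : Fin n | {w : Fin n | p.1.Adj v w ∧
              p.1.dist p.2 w = p.1.dist p.2 v + 1}.ncard = c}.ncard = k c} =
      (fun q : Fin n × (Fin n → Fin n) => (PG q.2, q.1)) '' (Y : Set _) := by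
    have hn2 : ∀ q c, {v : Fin n | cc q v = c}.ncard =
        (Finset.univ.filter fun v => cc q v = c).card := by
      intro q c
      rw [← Set.ncard_coe_finset]; simp
    ext ⟨G, r⟩
    simp only [Set.mem_ofPred_eq, Set.mem_image, Prod.mk.injEq, Y, Finset.coe_filter,
      Finset.mem_univ, true_and, Prod.exists]
    constructor
    · rintro ⟨hG, hd⟩
      obtain ⟨f, H, rfl⟩ := PG_surj G r hG
      refine ⟨r, f, ⟨H, fun c => ?_⟩, rfl, rfl⟩
      have := hd c
      simp only [hccG r f H] at this
      rw [← this, hn2]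
    · rintro ⟨r, f, ⟨H, hd⟩, rfl, rfl⟩
      refine ⟨(PG_spec H).1, fun c => ?_⟩
      simp only [hccG r f H]
      rw [← hd c, hn2]
  have hinj : Set.InjOn (fun q : Fin n × (Fin n → Fin n) => (PG q.2, q.1)) (Y : Set _) := by
    rintro ⟨r, f⟩ h1 ⟨r', f'⟩ h2 e
    simp only [Y, Finset.coe_filter, Finset.mem_univ, true_and, Set.mem_ofPred_eq] at h1 h2
    simp only [Prod.mk.injEq] at e
    obtain ⟨e, rfl⟩ := e
    rw [PG_inj h1.1 h2.1 e]
  rw [hX, hinj.ncard_image, Set.ncard_coe_finset]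
  set D := (Finset.univ.filter fun d : Fin n → Fin n =>
      ∀ c, (Finset.univ.filter fun v => d v = c).card = k c) with hD
  have hDc := D_card n (fun c => k c) (by rw [← Finset.sum_range (fun i => k i)]; exact hsum)
  rw [← hD, ← Finset.prod_range (fun i => (k i).factorial)] at hDc
  have hmaps : ∀ q ∈ Y, (fun v => (⟨cc q v, hcc q v⟩ : Fin n)) ∈ D := by
    intro q hq
    simp only [Y, Finset.mem_filter, Finset.mem_univ, true_and] at hq
    simp only [D, Finset.mem_filter, Finset.mem_univ, true_and]
    intro c
    rw [← hq.2 c]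
    simp only [Fin.ext_iff]
  have hfib : ∀ d ∈ D, (Y.filter fun q => (fun v => (⟨cc q v, hcc q v⟩ : Fin n)) = d).card *
      ∏ i ∈ Finset.range n, (i.factorial) ^ k i = (n - 1).factorial := by
    intro d hd
    simp only [D, Finset.mem_filter, Finset.mem_univ, true_and] at hd
    have hs : ∑ v, (d v : ℕ) = n - 1 := by
      rw [← hsum', Finset.sum_range, ← Finset.sum_fiberwise Finset.univ d]
      refine Finset.sum_congr rfl fun c _ => ?_
      rw [Finset.sum_congr rfl (g := fun _ => (c : ℕ)), Finset.sum_const, hd c, smul_eq_mul,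
        mul_comm]
      intro v hv
      rw [(Finset.mem_filter.1 hv).2]
    have hp : ∏ v, (d v : ℕ).factorial = ∏ i ∈ Finset.range n, (i.factorial) ^ k i := by
      rw [Finset.prod_range, ← Finset.prod_fiberwise Finset.univ d]
      refine Finset.prod_congr rfl fun c _ => ?_
      rw [Finset.prod_congr rfl (g := fun _ => (c : ℕ).factorial), Finset.prod_const, hd c]
      intro v hv
      rw [(Finset.mem_filter.1 hv).2]
    rw [← hp, ← PT_card (n - 1) Finset.univ (fun v => (d v : ℕ)) (by simp; omega) hs]
    congr 2
    ext ⟨r, f⟩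
    simp only [Y, PT, Finset.mem_filter, Finset.mem_univ, true_and, true_implies, funext_iff]
    constructor
    · rintro ⟨⟨H, -⟩, h⟩
      refine ⟨H, fun v => ?_⟩
      have h1 : cc (r, f) v = d v := congrArg Fin.val (h v)
      rw [← h1]
    · rintro ⟨H, h⟩
      have h' : ∀ v, cc (r, f) v = d v := by
        intro v
        rw [← h v]
      refine ⟨⟨H, fun c => ?_⟩, fun v => Fin.ext (h' v)⟩
      simp only [h']
      by_cases hc : c < n
      · rw [← hd ⟨c, hc⟩]
        simp only [Fin.ext_iff]
      · rw [hz c (by omega), Finset.card_eq_zero, Finset.filter_eq_empty_iff]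
        intro v _ e
        exact hc (e ▸ (d v).2)
  have hY : Y.card * ∏ i ∈ Finset.range n, (i.factorial) ^ k i =
      D.card * (n - 1).factorial := by
    rw [Finset.card_eq_sum_card_fiberwise hmaps, Finset.sum_mul, Finset.sum_congr rfl hfib,
      Finset.sum_const, smul_eq_mul]
  calc _ = (Y.card * ∏ i ∈ Finset.range n, (i.factorial) ^ k i) *
        ∏ i ∈ Finset.range n, (k i).factorial := by ring
    _ = (D.card * ∏ i ∈ Finset.range n, (k i).factorial) * (n - 1).factorial := by rw [hY]; ring
    _ = _ := by rw [hDc]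
end

section
/- Let S ⊆ Z with max S = 1 and either min S = -1 or ℓ = 0. Let ℓ ≤ 0 ≤ r and (n_i)_{ℓ ≤ i ≤ r} be positive integers, n = Σ n_i. The number of S-embedded rooted Cayley trees of size n with vertical profile (n_ℓ,...,n_r) equals (n_0/(n_ℓ n_r)) · n!/∏_{i=ℓ}^r (n_i - 1)! · ∏_{i=ℓ}^r (Σ_{s∈S} n_{i-s})^{n_i - 1}, with n_j = 0 for j < ℓ or j > r. -/
lemma det_rank {ι R : Type*} [Fintype ι] [DecidableEq ι] [CommRing R] (A : Matrix ι ι R)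
    (h : ι → ℕ) (hA : ∀ i j, i ≠ j → h j ≤ h i → A i j = 0) : A.det = ∏ i, A i i := by
  rw [Matrix.det_apply, Finset.sum_eq_single (1 : Equiv.Perm ι)]
  · simp
  · intro σ _ hσ
    have : ∃ i, σ i ≠ i ∧ h i ≤ h (σ i) := by
      by_contra! hc
      obtain ⟨i, hi⟩ : ∃ i, σ i ≠ i := by
        by_contra! h2
        exact hσ (Equiv.ext h2)
      have h3 : ∑ i, h (σ i) < ∑ i, h i := by
        apply Finset.sum_lt_sum
        · intro j _
          by_cases hj : σ j = j
          · rw [hj]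
          · exact (hc j hj).le
        · exact ⟨i, Finset.mem_univ _, hc i hi⟩
      rw [Equiv.sum_comp σ h] at h3
      exact lt_irrefl _ h3
    obtain ⟨i, hi, hle⟩ := this
    have h0 : ∏ i, A (σ i) i = 0 := Finset.prod_eq_zero (Finset.mem_univ i) (hA _ _ hi hle)
    rw [h0, smul_zero]
  · simp

/-- `f` is a rooted forest with height function `h`. -/
def IsHt {V : Type*} (f : V → Option V) (h : V → ℕ) : Prop :=
  (∀ v, f v = none → h v = 0) ∧ ∀ v w, f v = some w → h v = h w + 1

def Acyc {V : Type*} (f : V → Option V) : Prop := ∃ h, IsHt f h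

lemma acyc_of_acc {V : Type*} (f : V → Option V)
    (hf : ∀ v, Acc (fun w v => f v = some w) v) : Acyc f := by
  have wf : WellFounded (fun w v => f v = some w) := ⟨hf⟩
  have key : ∀ v, ∃ g : ℕ → Option V, g 0 = some v ∧ (∀ k, g (k+1) = (g k).bind f) ∧
      ∃ k, g k = none := by
    intro v
    induction v using wf.induction with
    | _ v ih =>
      rcases hv : f v with _ | w
      · refine ⟨fun k => (fun o => Option.bind o f)^[k] (some v), rfl, ?_, 1, ?_⟩
        · intro k; simp only [Function.iterate_succ_apply']
        · simp [hv]
      · obtain ⟨g, g0, gs, k, hk⟩ := ih w hv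
        refine ⟨fun k => Nat.casesOn k (some v) g, rfl, ?_, k+1, hk⟩
        rintro (_ | k)
        · simp [g0, hv]
        · exact gs k
  choose g g0 gs hk using key
  classical
  have uniq : ∀ v w, f v = some w → ∀ k, g v (k+1) = g w k := by
    intro v w hvw k
    induction k with
    | zero => rw [gs, g0, g0]; simpa using hvw
    | succ k ih => rw [gs, ih, ← gs]
  have hpos : ∀ v, Nat.find (hk v) ≠ 0 := by
    intro v h0
    have := Nat.find_spec (hk v)
    rw [h0, g0] at this
    simp at this
  refine ⟨fun v => Nat.find (hk v) - 1, ?_, ?_⟩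
  · intro v hv
    have : Nat.find (hk v) ≤ 1 := Nat.find_min' _ (by rw [gs, g0]; simpa using hv)
    simp only; omega
  · intro v w hvw
    have h1 : Nat.find (hk v) ≤ Nat.find (hk w) + 1 :=
      Nat.find_min' _ (by rw [uniq v w hvw]; exact Nat.find_spec (hk w))
    have h2 : Nat.find (hk w) ≤ Nat.find (hk v) - 1 :=
      Nat.find_min' _ (by
        rw [← uniq v w hvw, Nat.sub_add_cancel (Nat.pos_of_ne_zero (hpos v))]
        exact Nat.find_spec (hk v))
    have := hpos v
    have := hpos w
    simp only; omega

open Classical in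
lemma det_one_sub {V : Type*} [Fintype V] [DecidableEq V] (f : V → Option V) :
    (Matrix.of fun v u => ((if v = u then 1 else 0) - if f v = some u then 1 else 0 : ℚ)).det
      = if Acyc f then 1 else 0 := by
  split_ifs with hf
  · obtain ⟨h, h0, h1⟩ := hf
    rw [← Matrix.det_transpose, det_rank _ h]
    · apply Finset.prod_eq_one
      intro v _
      have : f v ≠ some v := fun hv => by have := h1 _ _ hv; omega
      simp [this]
    · intro i j hij hle
      have : f j ≠ some i := fun hv => by have := h1 _ _ hv; omega
      simp [this, hij.symm]
  · have hna : ∃ v, ¬ Acc (fun w v => f v = some w) v := by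
      by_contra! hc
      exact hf (acyc_of_acc f hc)
    obtain ⟨v0, hv0⟩ := hna
    apply Matrix.exists_mulVec_eq_zero_iff.mp
    refine ⟨fun v => if Acc (fun w v => f v = some w) v then 0 else 1, ?_, ?_⟩
    · intro h
      have := congrFun h v0
      simp [hv0] at this
    · ext v
      simp only [Matrix.mulVec, dotProduct, Matrix.of_apply, sub_mul, Finset.sum_sub_distrib,
        ite_mul, one_mul, zero_mul, Finset.sum_ite_eq, Finset.mem_univ, if_true, Pi.zero_apply]
      rcases hv : f v with _ | w
      · have : Acc (fun w v => f v = some w) v := ⟨_, fun y hy => by simp [hv] at hy⟩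
        simp [this]
      · have : Acc (fun w v => f v = some w) v ↔ Acc (fun w v => f v = some w) w :=
          ⟨fun h => h.inv hv, fun h => ⟨_, fun y hy => by
            rw [hv] at hy; cases hy; exact h⟩⟩
        simp [this]

open Classical in
lemma mtt {V : Type*} [Fintype V] [DecidableEq V] (w : V → Option V → ℚ) :
    (Matrix.of fun v u => (if v = u then ∑ o, w v o else 0) - w v (some u)).det
      = ∑ f : V → Option V, if Acyc f then ∏ v, w v (f v) else 0 := by
  have : (Matrix.of fun v u => (if v = u then ∑ o, w v o else 0) - w v (some u))
      = fun v => ∑ o, w v o • (fun u => ((if v = u then 1 else 0) - if o = some u then 1 else 0 : ℚ)) := by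
    ext v u
    simp only [Matrix.of_apply, Finset.sum_apply, Pi.smul_apply, smul_eq_mul, mul_sub,
      Finset.sum_sub_distrib]
    simp
  rw [this]
  change Matrix.detRowAlternating.toMultilinearMap _ = _
  rw [MultilinearMap.map_sum]
  apply Finset.sum_congr rfl
  intro f _
  rw [MultilinearMap.map_smul_univ]
  have h := det_one_sub f
  change Matrix.detRowAlternating.toMultilinearMap _ = _ at h
  have h' : (Matrix.detRowAlternating (n := V) (R := ℚ)).toMultilinearMap (fun i u => ((if i = u then 1 else 0) - if f i = some u then 1 else 0 : ℚ)) = if Acyc f then 1 else 0 := h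
  rw [h']
  split_ifs <;> simp

lemma compress {V ι : Type*} [Fintype V] [DecidableEq V] [Fintype ι] [DecidableEq ι]
    (c : V → ι) (D : ι → ℚ) (hD : ∀ i, D i ≠ 0) (B : ι → ι → ℚ) (m : ι → ℕ)
    (hm : ∀ i, (Finset.univ.filter fun v => c v = i).card = m i) :
    (Matrix.of fun v u => (if v = u then D (c v) else 0) - B (c v) (c u)).det * ∏ i, D i
    = (∏ v, D (c v)) *
      (Matrix.of fun i j => (if i = j then D i else 0) - B i j * (m j : ℚ)).det := by
  let X : Matrix V ι ℚ := Matrix.of fun v j => if c v = j then 1 else 0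
  let Y : Matrix ι V ℚ := Matrix.of fun j u => B j (c u) / D (c u)
  have h1 : (Matrix.of fun v u => (if v = u then D (c v) else 0) - B (c v) (c u))
      = (1 - X * Y) * Matrix.diagonal (fun v => D (c v)) := by
    ext v u
    rw [Matrix.mul_diagonal]
    simp only [Matrix.sub_apply, Matrix.mul_apply, X, Y, Matrix.of_apply, ite_mul, one_mul,
      zero_mul, Finset.sum_ite_eq, Finset.mem_univ, if_true, Matrix.one_apply, sub_mul]
    rw [div_mul_cancel₀ _ (hD _)]
    congr 1
    split_ifs with h
    · rw [h]
    · rfl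
  have h2 : (Matrix.of fun i j => (if i = j then D i else 0) - B i j * (m j : ℚ))
      = (1 - Y * X) * Matrix.diagonal D := by
    ext i j
    rw [Matrix.mul_diagonal]
    simp only [Matrix.sub_apply, Matrix.mul_apply, X, Y, Matrix.of_apply, Matrix.one_apply, sub_mul]
    congr 1
    · split_ifs with h
      · rw [h, one_mul]
      · simp
    · have : ∀ u, B i (c u) / D (c u) * (if c u = j then 1 else 0) =
          if c u = j then B i j / D j else 0 := by
        intro u
        split_ifs with h
        · rw [h, mul_one]
        · simp
      simp only [this]
      rw [← Finset.sum_filter, Finset.sum_const, hm, nsmul_eq_mul]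
      have := hD j
      field_simp
  rw [h1, h2, Matrix.det_mul, Matrix.det_mul, Matrix.det_diagonal, Matrix.det_diagonal,
    Matrix.det_one_sub_mul_comm]
  ring

lemma colour_det (S : Finset ℤ) (h1S : 1 ∈ S) (hSle : ∀ s ∈ S, s ≤ 1)
    (ℓ r : ℤ) (hl : ℓ ≤ 0) (hr : 0 ≤ r)
    (hmin : ((-1 : ℤ) ∈ S ∧ ∀ s ∈ S, -1 ≤ s) ∨ ℓ = 0)
    (n : ℤ → ℕ) (t : ℚ) :
    (Matrix.of fun i j : ↥(Finset.Icc ℓ r) => (if i = j then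
        (∑ k : ↥(Finset.Icc ℓ r), (if (i:ℤ) - k ∈ S then (n k : ℚ) else 0)) +
          (if (i:ℤ) = 0 then t else 0) else 0)
        - (if (i:ℤ) - j ∈ S then 1 else 0) * (n j : ℚ)).det
    = ∏ i : ↥(Finset.Icc ℓ r), (if (i:ℤ) = 0 then t else
        if 0 < (i:ℤ) then (n (i - 1) : ℚ) else (n (i + 1) : ℚ)) := by
  set M := (Matrix.of fun i j : ↥(Finset.Icc ℓ r) => (if i = j then
        (∑ k : ↥(Finset.Icc ℓ r), (if (i:ℤ) - k ∈ S then (n k : ℚ) else 0)) +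
          (if (i:ℤ) = 0 then t else 0) else 0)
        - (if (i:ℤ) - j ∈ S then 1 else 0) * (n j : ℚ)) with hM
  let P : ↥(Finset.Icc ℓ r) → ↥(Finset.Icc ℓ r) → Prop := fun j k =>
    (j:ℤ) = 0 ∨ (0 < (j:ℤ) ∧ (j:ℤ) ≤ k) ∨ ((j:ℤ) < 0 ∧ (k:ℤ) ≤ j)
  classical
  let U : Matrix ↥(Finset.Icc ℓ r) ↥(Finset.Icc ℓ r) ℚ := Matrix.of fun k j => if P j k then 1 else 0
  have hU : U.det = 1 := by
    rw [← Matrix.det_transpose, det_rank _ (fun i : ↥(Finset.Icc ℓ r) => (i:ℤ).natAbs)]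
    · apply Finset.prod_eq_one
      intro i _
      have : P i i := by simp only [P]; omega
      simp [U, this]
    · intro i j hij hle
      have hij' : (i:ℤ) ≠ j := fun h => hij (Subtype.ext h)
      have : ¬ P i j := by simp only [P]; omega
      simp [U, this]
  have hrow : ∀ i, ∑ k, M i k = if (i:ℤ) = 0 then t else 0 := by
    intro i
    simp only [hM, Matrix.of_apply, Finset.sum_sub_distrib, Finset.sum_ite_eq, Finset.mem_univ,
      if_true, ite_mul, one_mul, zero_mul]
    ring
  have hlow : ∀ i k : ↥(Finset.Icc ℓ r), (k:ℤ) < i - 1 → M i k = 0 := by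
    intro i k hk
    have h1 : i ≠ k := fun h => by rw [h] at hk; omega
    have h2 : (i:ℤ) - k ∉ S := fun h => by have := hSle _ h; omega
    simp [hM, h1, h2]
  have hhigh : ∀ i k : ↥(Finset.Icc ℓ r), (i:ℤ) < 0 → (i:ℤ) + 1 < k → M i k = 0 := by
    intro i k hi hk
    have hil := (Finset.mem_Icc.mp i.2).1
    have h1 : i ≠ k := fun h => by rw [h] at hk; omega
    have h2 : (i:ℤ) - k ∉ S := fun h => by
      rcases hmin with hmin | hmin
      · have := hmin.2 _ h; omega
      · omega
    simp [hM, h1, h2]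
  have hMU : ∀ i j, (M * U) i j = ∑ k, M i k - ∑ k, if P j k then 0 else M i k := by
    intro i j
    rw [Matrix.mul_apply, ← Finset.sum_sub_distrib]
    apply Finset.sum_congr rfl
    intro k _
    simp only [U, Matrix.of_apply]
    split_ifs <;> simp
  have hprod : (M * U).det = M.det := by rw [Matrix.det_mul, hU, mul_one]
  rw [← hprod, det_rank _ (fun i : ↥(Finset.Icc ℓ r) => (i:ℤ).natAbs)]
  · apply Finset.prod_congr rfl
    intro i _
    rw [hMU, hrow]
    have hi2 := Finset.mem_Icc.mp i.2
    split_ifs with h0 h1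
    · rw [Finset.sum_eq_zero, sub_zero]
      intro k _
      have : P i k := Or.inl h0
      simp [this]
    · have hmem : (i:ℤ) - 1 ∈ Finset.Icc ℓ r := Finset.mem_Icc.mpr (by omega)
      rw [Finset.sum_eq_single (⟨(i:ℤ) - 1, hmem⟩ : ↥(Finset.Icc ℓ r))]
      · have hP : ¬ P i ⟨(i:ℤ) - 1, hmem⟩ := by simp only [P]; omega
        have hne : i ≠ ⟨(i:ℤ) - 1, hmem⟩ := fun h => by
          have := congrArg Subtype.val h; simp only at this; omega
        rw [if_neg hP]
        simp [hM, hne, h1S]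
      · intro k _ hk
        have hk' : (k:ℤ) ≠ i - 1 := fun h => hk (Subtype.ext h)
        split_ifs with hP
        · rfl
        · apply hlow
          simp only [P] at hP; omega
      · simp
    · have hmem : (i:ℤ) + 1 ∈ Finset.Icc ℓ r := Finset.mem_Icc.mpr (by omega)
      have hm1 : (-1:ℤ) ∈ S := by
        rcases hmin with hmin | hmin
        · exact hmin.1
        · omega
      rw [Finset.sum_eq_single (⟨(i:ℤ) + 1, hmem⟩ : ↥(Finset.Icc ℓ r))]
      · have hP : ¬ P i ⟨(i:ℤ) + 1, hmem⟩ := by simp only [P]; omega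
        have hne : i ≠ ⟨(i:ℤ) + 1, hmem⟩ := fun h => by
          have := congrArg Subtype.val h; simp only at this; omega
        rw [if_neg hP]
        simp [hM, hne, hm1]
      · intro k _ hk
        have hk' : (k:ℤ) ≠ i + 1 := fun h => hk (Subtype.ext h)
        split_ifs with hP
        · rfl
        · apply hhigh
          · omega
          · simp only [P] at hP; omega
      · simp
  · intro i j hij hle
    have hij' : (i:ℤ) ≠ j := fun h => hij (Subtype.ext h)
    have hle : (j:ℤ).natAbs ≤ (i:ℤ).natAbs := hle
    have hi0 : (i:ℤ) ≠ 0 := by omega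
    by_cases hsame : (j:ℤ) = 0 ∨ (0 < (j:ℤ) ∧ 0 < (i:ℤ)) ∨ ((j:ℤ) < 0 ∧ (i:ℤ) < 0)
    · rw [hMU, hrow, if_neg hi0, zero_sub, neg_eq_zero]
      apply Finset.sum_eq_zero
      intro k _
      split_ifs with hP
      · rfl
      · by_cases hi : 0 < (i:ℤ)
        · apply hlow
          simp only [P] at hP; omega
        · apply hhigh
          · omega
          · simp only [P] at hP; omega
    · rw [Matrix.mul_apply]
      apply Finset.sum_eq_zero
      intro k _
      simp only [U, Matrix.of_apply]
      split_ifs with hP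
      · rw [mul_one]
        by_cases hi : 0 < (i:ℤ)
        · apply hlow
          simp only [P] at hP; omega
        · apply hhigh
          · omega
          · simp only [P] at hP; omega
      · simp

/-- The parent function respects the abscissas. -/
def Allowed {V : Type*} (S : Finset ℤ) (a : V → ℤ) (f : V → Option V) : Prop :=
  (∀ v, f v = none → a v = 0) ∧ ∀ v u, f v = some u → a v - a u ∈ S

open Classical in
/-- weights -/
noncomputable def wt {V R : Type*} [CommRing R] (S : Finset ℤ) (a : V → ℤ) (t : R) (v : V) :
    Option V → R
  | none => if a v = 0 then t else 0
  | some u => if a v - a u ∈ S then 1 else 0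

open Classical in
lemma prod_wt {V R : Type*} [CommRing R] [Fintype V] (S : Finset ℤ) (a : V → ℤ) (t : R)
    (f : V → Option V) :
    ∏ v, wt S a t v (f v) =
      if Allowed S a f then t ^ (Finset.univ.filter fun v => f v = none).card else 0 := by
  split_ifs with h
  · rw [← Finset.prod_const, Finset.prod_filter]
    apply Finset.prod_congr rfl
    intro v _
    rcases hv : f v with _ | u
    · simp [wt, h.1 v hv]
    · simp [wt, h.2 v u hv]
  · have : ∃ v, wt S a t v (f v) = 0 := by
      by_contra! hc
      apply h
      constructor
      · intro v hv
        have := hc v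
        rw [hv] at this
        by_contra h0
        simp [wt, h0] at this
      · intro v u hv
        have := hc v
        rw [hv] at this
        by_contra h0
        simp [wt, h0] at this
    obtain ⟨v, hv⟩ := this
    exact Finset.prod_eq_zero (Finset.mem_univ v) hv

lemma sum_fib {V ι : Type*} [Fintype V] [Fintype ι] [DecidableEq ι]
    (c : V → ι) (m : ι → ℕ) (hm : ∀ i, (Finset.univ.filter fun v => c v = i).card = m i)
    (F : ι → ℚ) : ∑ v, F (c v) = ∑ i, m i * F i := by
  rw [← Finset.sum_fiberwise Finset.univ c]
  apply Finset.sum_congr rfl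
  intro i _
  rw [Finset.sum_congr rfl (g := fun _ => F i)]
  · rw [Finset.sum_const, hm, nsmul_eq_mul]
  · intro v hv
    rw [(Finset.mem_filter.mp hv).2]

lemma prod_fib {V ι : Type*} [Fintype V] [Fintype ι] [DecidableEq ι]
    (c : V → ι) (m : ι → ℕ) (hm : ∀ i, (Finset.univ.filter fun v => c v = i).card = m i)
    (F : ι → ℚ) : ∏ v, F (c v) = ∏ i, F i ^ m i := by
  rw [← Finset.prod_fiberwise Finset.univ c]
  apply Finset.prod_congr rfl
  intro i _
  rw [Finset.prod_congr rfl (g := fun _ => F i)]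
  · rw [Finset.prod_const, hm]
  · intro v hv
    rw [(Finset.mem_filter.mp hv).2]

open Classical in
lemma forest_gf {V : Type*} [Fintype V] [DecidableEq V] (S : Finset ℤ) (h1S : 1 ∈ S) (hSle : ∀ s ∈ S, s ≤ 1)
    (ℓ r : ℤ) (hl : ℓ ≤ 0) (hr : 0 ≤ r)
    (hmin : ((-1 : ℤ) ∈ S ∧ ∀ s ∈ S, -1 ≤ s) ∨ ℓ = 0)
    (n : ℤ → ℕ) (hpos : ∀ i ∈ Finset.Icc ℓ r, 0 < n i)
    (c : V → ↥(Finset.Icc ℓ r))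
    (hc : ∀ i, (Finset.univ.filter fun v => c v = i).card = n i)
    (t : ℚ) (ht : 0 < t) :
    ∑ f : V → Option V, (if Acyc f then ∏ v, wt S (fun v => (c v : ℤ)) t v (f v) else 0)
    = (∏ i : ↥(Finset.Icc ℓ r),
        ((∑ k : ↥(Finset.Icc ℓ r), (if (i:ℤ) - k ∈ S then (n k : ℚ) else 0)) +
          (if (i:ℤ) = 0 then t else 0)) ^ (n i - 1)) *
      ∏ i : ↥(Finset.Icc ℓ r), (if (i:ℤ) = 0 then t else
        if 0 < (i:ℤ) then (n (i - 1) : ℚ) else (n (i + 1) : ℚ)) := by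
  set D : ↥(Finset.Icc ℓ r) → ℚ := fun i =>
    (∑ k : ↥(Finset.Icc ℓ r), (if (i:ℤ) - k ∈ S then (n k : ℚ) else 0)) +
          (if (i:ℤ) = 0 then t else 0) with hD
  have hsum0 : ∀ i : ↥(Finset.Icc ℓ r),
      0 ≤ ∑ k : ↥(Finset.Icc ℓ r), (if (i:ℤ) - k ∈ S then (n k : ℚ) else 0) := by
    intro i
    apply Finset.sum_nonneg
    intro k _
    split_ifs <;> positivity
  have hsum : ∀ i k : ↥(Finset.Icc ℓ r), (i:ℤ) - k ∈ S → 
      0 < ∑ k : ↥(Finset.Icc ℓ r), (if (i:ℤ) - k ∈ S then (n k : ℚ) else 0) := by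
    intro i k hk
    apply Finset.sum_pos'
    · intro k _
      split_ifs <;> positivity
    · refine ⟨k, Finset.mem_univ _, ?_⟩
      rw [if_pos hk]
      exact_mod_cast hpos k k.2
  have hDpos : ∀ i, 0 < D i := by
    intro i
    have hi2 := Finset.mem_Icc.mp i.2
    by_cases h0 : (i:ℤ) = 0
    · simp only [hD, if_pos h0]
      have := hsum0 i
      linarith
    · simp only [hD, if_neg h0, add_zero]
      by_cases h1 : 0 < (i:ℤ)
      · apply hsum i ⟨(i:ℤ) - 1, Finset.mem_Icc.mpr (by omega)⟩
        simpa using h1S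
      · apply hsum i ⟨(i:ℤ) + 1, Finset.mem_Icc.mpr (by omega)⟩
        have hm1 : (-1:ℤ) ∈ S := by
          rcases hmin with hmin | hmin
          · exact hmin.1
          · omega
        simpa using hm1
  have hdet := colour_det S h1S hSle ℓ r hl hr hmin n t
  have hcomp := compress c D (fun i => (hDpos i).ne')
    (fun i j => if (i:ℤ) - j ∈ S then 1 else 0) (fun i => n i) hc
  rw [hdet, prod_fib c (fun i => n i) hc] at hcomp
  have hm := mtt (wt S (fun v => (c v : ℤ)) t)
  rw [← hm]
  have hmat : (Matrix.of fun v u => (if v = u then ∑ o, wt S (fun v => (c v : ℤ)) t v o else 0)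
      - wt S (fun v => (c v : ℤ)) t v (some u))
      = (Matrix.of fun v u => (if v = u then D (c v) else 0)
        - (if (c v:ℤ) - c u ∈ S then 1 else 0)) := by
    ext v u
    simp only [Matrix.of_apply, wt, Fintype.sum_option]
    have := sum_fib c (fun i => n i) hc (fun j => if (c v:ℤ) - j ∈ S then 1 else 0)
    rw [this]
    simp [hD, add_comm]
  rw [hmat]
  have hne : ∏ i, D i ≠ 0 := Finset.prod_ne_zero_iff.mpr fun i _ => (hDpos i).ne'
  apply mul_right_cancel₀ hne
  rw [hcomp, mul_right_comm]
  change _ = ((∏ i, D i ^ (n i - 1)) * ∏ i, D i) * _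
  congr 1
  rw [← Finset.prod_mul_distrib]
  apply Finset.prod_congr rfl
  intro i _
  rw [← pow_succ, Nat.sub_add_cancel (hpos i i.2)]

open Classical in
lemma tree_count {V : Type*} [Fintype V] [DecidableEq V] (S : Finset ℤ) (h1S : 1 ∈ S) (hSle : ∀ s ∈ S, s ≤ 1)
    (ℓ r : ℤ) (hl : ℓ ≤ 0) (hr : 0 ≤ r)
    (hmin : ((-1 : ℤ) ∈ S ∧ ∀ s ∈ S, -1 ≤ s) ∨ ℓ = 0)
    (n : ℤ → ℕ) (hpos : ∀ i ∈ Finset.Icc ℓ r, 0 < n i)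
    (hzero : ∀ i : ℤ, i < ℓ ∨ r < i → n i = 0)
    (a : V → ℤ)
    (ha : ∀ i, (Finset.univ.filter fun v => a v = i).card = n i) :
    (Finset.univ.filter fun f : V → Option V => Acyc f ∧ Allowed S a f ∧
      (Finset.univ.filter fun v => f v = none).card = 1).card
    = (∏ i ∈ Finset.Icc ℓ r, (∑ s ∈ S, n (i - s)) ^ (n i - 1)) *
      ∏ i ∈ Finset.Icc ℓ r, (if i = 0 then 1 else if 0 < i then n (i - 1) else n (i + 1)) := by
  have hmem : ∀ v, a v ∈ Finset.Icc ℓ r := by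
    intro v
    by_contra h
    have h1 : n (a v) = 0 := hzero _ (by rw [Finset.mem_Icc] at h; omega)
    have h2 := ha (a v)
    rw [h1, Finset.card_eq_zero] at h2
    have : v ∈ (Finset.univ.filter fun u => a u = a v) := by simp
    rw [h2] at this
    simp at this
  let c : V → ↥(Finset.Icc ℓ r) := fun v => ⟨a v, hmem v⟩
  have hc : ∀ i, (Finset.univ.filter fun v => c v = i).card = n i := by
    intro i
    rw [← ha i]
    congr 1
    ext v
    simp [c, Subtype.ext_iff]
  have hS : ∀ i : ↥(Finset.Icc ℓ r),
      ∑ k : ↥(Finset.Icc ℓ r), (if (i:ℤ) - k ∈ S then (n k : ℚ) else 0)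
      = ((∑ s ∈ S, n (i - s) : ℕ) : ℚ) := by
    intro i
    rw [Finset.sum_coe_sort (Finset.Icc ℓ r) (fun k => if (i:ℤ) - k ∈ S then (n k : ℚ) else 0),
      ← Finset.sum_filter]
    push_cast
    have h1 : ∑ s ∈ S, (n (i - s) : ℚ) = ∑ s ∈ S.filter (fun s => (i:ℤ) - s ∈ Finset.Icc ℓ r),
        (n (i - s) : ℚ) := by
      rw [Finset.sum_filter]
      apply Finset.sum_congr rfl
      intro s _
      split_ifs with h
      · rfl
      · rw [hzero _ (by rw [Finset.mem_Icc] at h; omega)]; simp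
    rw [h1]
    apply Finset.sum_nbij' (fun k => (i:ℤ) - k) (fun s => (i:ℤ) - s)
    · intro k hk
      rw [Finset.mem_filter] at hk ⊢
      exact ⟨hk.2, by simpa using hk.1⟩
    · intro k hk
      rw [Finset.mem_filter] at hk ⊢
      exact ⟨hk.2, by simpa using hk.1⟩
    · intro k _; ring
    · intro k _; ring
    · intro k _; simp
  let p : Polynomial ℚ := ∑ f : V → Option V,
    (if Acyc f then ∏ v, wt S a (Polynomial.X : Polynomial ℚ) v (f v) else 0)
  let Q : Polynomial ℚ := (∏ i : ↥(Finset.Icc ℓ r),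
        (Polynomial.C ((∑ s ∈ S, n (i - s) : ℕ) : ℚ) +
          (if (i:ℤ) = 0 then Polynomial.X else 0)) ^ (n i - 1)) *
      ∏ i : ↥(Finset.Icc ℓ r), (if (i:ℤ) = 0 then 1 else
        if 0 < (i:ℤ) then (n (i - 1) : Polynomial ℚ) else (n (i + 1) : Polynomial ℚ))
  have h0mem : (0:ℤ) ∈ Finset.Icc ℓ r := Finset.mem_Icc.mpr ⟨hl, hr⟩
  have hpQ : p = Q * Polynomial.X := by
    apply Polynomial.eq_of_infinite_eval_eq
    apply Set.Infinite.mono _ (Set.Ioi_infinite (0:ℚ))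
    intro t ht
    have hg := forest_gf S h1S hSle ℓ r hl hr hmin n hpos c hc t ht
    have hX : ∏ i : ↥(Finset.Icc ℓ r), (if (i:ℤ) = 0 then t else
        if 0 < (i:ℤ) then (n (i - 1) : ℚ) else (n (i + 1) : ℚ)) =
        (∏ i : ↥(Finset.Icc ℓ r), (if (i:ℤ) = 0 then 1 else
        if 0 < (i:ℤ) then (n (i - 1) : ℚ) else (n (i + 1) : ℚ))) * t := by
      rw [← Finset.mul_prod_erase _ _ (Finset.mem_univ (⟨0, h0mem⟩ : ↥(Finset.Icc ℓ r))),
        ← Finset.mul_prod_erase _ (fun i : ↥(Finset.Icc ℓ r) => (if (i:ℤ) = 0 then 1 else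
        if 0 < (i:ℤ) then (n (i - 1) : ℚ) else (n (i + 1) : ℚ)))
         (Finset.mem_univ (⟨0, h0mem⟩ : ↥(Finset.Icc ℓ r)))]
      simp only [if_true, one_mul]
      rw [mul_comm]
      congr 1
      apply Finset.prod_congr rfl
      intro i hi
      have : (i:ℤ) ≠ 0 := fun h => (Finset.mem_erase.mp hi).1 (Subtype.ext h)
      simp [this]
    rw [hX, ← mul_assoc] at hg
    simp only [hS] at hg
    change Polynomial.eval t p = Polynomial.eval t (Q * Polynomial.X)
    have e1 : Polynomial.eval t p = ∑ f : V → Option V,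
        (if Acyc f then ∏ v, wt S (fun v => (c v : ℤ)) t v (f v) else 0) := by
      simp only [p, Polynomial.eval_finsetSum]
      apply Finset.sum_congr rfl
      intro f _
      rw [prod_wt, prod_wt]
      change _ = if Acyc f then (if Allowed S a f then _ else _) else _
      split_ifs <;> simp
    rw [e1, hg, Polynomial.eval_mul, Polynomial.eval_X]
    congr 1
    simp only [Q, Polynomial.eval_mul, Polynomial.eval_prod]
    congr 1
    · apply Finset.prod_congr rfl
      intro i _
      split_ifs <;> simp [Polynomial.eval_finsetSum]
    · apply Finset.prod_congr rfl
      intro i _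
      split_ifs <;> simp
  have hcoeff := congrArg (fun q => Polynomial.coeff q 1) hpQ
  simp only [Polynomial.coeff_mul_X] at hcoeff
  have hc1 : p.coeff 1 = ((Finset.univ.filter fun f : V → Option V => Acyc f ∧ Allowed S a f ∧
      (Finset.univ.filter fun v => f v = none).card = 1).card : ℚ) := by
    rw [Finset.card_filter]
    push_cast
    simp only [p, Polynomial.finsetSum_coeff]
    apply Finset.sum_congr rfl
    intro f _
    rw [prod_wt]
    by_cases h1 : Acyc f <;> by_cases h2 : Allowed S a f <;>
      simp [h1, h2, Polynomial.coeff_X_pow, eq_comm]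
  have hc2 : Q.coeff 0 = (((∏ i ∈ Finset.Icc ℓ r, (∑ s ∈ S, n (i - s)) ^ (n i - 1)) *
      ∏ i ∈ Finset.Icc ℓ r, (if i = 0 then 1 else if 0 < i then n (i - 1) else n (i + 1)) : ℕ) : ℚ) := by
    rw [Polynomial.coeff_zero_eq_eval_zero, ← Finset.prod_coe_sort (Finset.Icc ℓ r),
       ← Finset.prod_coe_sort (Finset.Icc ℓ r)]
    simp only [Q, Polynomial.eval_mul, Polynomial.eval_prod]
    push_cast
    congr 1
    · apply Finset.prod_congr rfl
      intro i _
      split_ifs <;> simp [Polynomial.eval_finsetSum]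
    · apply Finset.prod_congr rfl
      intro i _
      split_ifs <;> simp
  rw [hc1, hc2] at hcoeff
  exact_mod_cast hcoeff

/-- graph of a parent function -/
def toG {V : Type*} (f : V → Option V) : SimpleGraph V :=
  SimpleGraph.fromRel (fun v w => f v = some w)

lemma toG_tree {V : Type*} [Fintype V] (f : V → Option V) (h : V → ℕ) (hf : IsHt f h) (ρ : V)
    (hρ : ∀ v, f v = none ↔ v = ρ) :
    (toG f).IsTree ∧ ∀ v, (toG f).dist ρ v = h v := by
  classical
  have hadj : ∀ v w, (toG f).Adj v w ↔ (f v = some w ∨ f w = some v) := by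
    intro v w
    rw [toG, SimpleGraph.fromRel_adj]
    refine ⟨fun h => h.2, fun h' => ⟨?_, h'⟩⟩
    rintro rfl
    have : f v = some v := by simpa using h'
    have := hf.2 _ _ this
    omega
  have hwalk : ∀ k v, h v = k → ∃ p : (toG f).Walk ρ v, p.length = k := by
    intro k
    induction k with
    | zero =>
      intro v hv
      have : v = ρ := by
        rw [← hρ]
        rcases hw : f v with _ | w
        · rfl
        · have := hf.2 _ _ hw; omega
      subst this
      exact ⟨SimpleGraph.Walk.nil, rfl⟩
    | succ k ih =>
      intro v hv
      rcases hw : f v with _ | w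
      · have := hf.1 _ hw; omega
      · have := hf.2 _ _ hw
        obtain ⟨p, hp⟩ := ih w (by omega)
        exact ⟨p.concat ((hadj w v).mpr (Or.inr hw)), by simp [hp]⟩
  have hle : ∀ u v (p : (toG f).Walk u v), h v ≤ h u + p.length := by
    intro u v p
    induction p with
    | nil => simp
    | cons hh p ih =>
      rw [SimpleGraph.Walk.length_cons]
      rcases (hadj _ _).mp hh with h1 | h1
      · have := hf.2 _ _ h1; omega
      · have := hf.2 _ _ h1; omega
  have hρ0 : h ρ = 0 := hf.1 _ ((hρ ρ).mpr rfl)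
  have hconn : (toG f).Connected := by
    have : Nonempty V := ⟨ρ⟩
    refine ⟨fun u v => ?_⟩
    obtain ⟨p, _⟩ := hwalk _ u rfl
    obtain ⟨q, _⟩ := hwalk _ v rfl
    exact ⟨p.reverse.append q⟩
  refine ⟨?_, ?_⟩
  · rw [SimpleGraph.isTree_iff_connected_and_card]
    refine ⟨hconn, le_antisymm ?_ hconn.card_vert_le_card_edgeSet_add_one⟩
    have hsub : (toG f).edgeSet ⊆ (fun v => s(v, (f v).getD v)) '' ({ρ}ᶜ : Set V) := by
      intro e
      induction e using Sym2.ind with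
      | _ v w =>
        intro he
        rw [SimpleGraph.mem_edgeSet, hadj] at he
        rcases he with he | he
        · refine ⟨v, ?_, by simp [he]⟩
          intro hv
          have := (hρ v).mpr hv
          rw [he] at this; cases this
        · refine ⟨w, ?_, by simp [he, Sym2.eq_swap]⟩
          intro hv
          have := (hρ w).mpr hv
          rw [he] at this; cases this
    have h1 : (toG f).edgeSet.ncard ≤ ({ρ}ᶜ : Set V).ncard :=
      (Set.ncard_le_ncard hsub (Set.toFinite _)).trans (Set.ncard_image_le (Set.toFinite _))
    have h2 := Set.ncard_add_ncard_compl ({ρ} : Set V)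
    rw [Set.ncard_singleton] at h2
    rw [Nat.card_coe_set_eq]
    omega
  · intro v
    apply le_antisymm
    · obtain ⟨p, hp⟩ := hwalk _ v rfl
      rw [← hp]
      exact SimpleGraph.dist_le p
    · obtain ⟨p, hp⟩ := hconn.exists_walk_length_eq_dist ρ v
      have := hle _ _ p
      omega

open Classical in
/-- parent function of a rooted tree -/
noncomputable def par {V : Type*} (G : SimpleGraph V) (ρ v : V) : Option V :=
  if h : ∃ w, G.Adj v w ∧ G.dist ρ v = G.dist ρ w + 1 then some h.choose else none

lemma par_some {V : Type*} (G : SimpleGraph V) (ρ v w : V) (h : par G ρ v = some w) :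
    G.Adj v w ∧ G.dist ρ v = G.dist ρ w + 1 := by
  unfold par at h
  split_ifs at h with h'
  · have := h'.choose_spec
    rw [Option.some_inj] at h
    rwa [h] at this

lemma par_none {V : Type*} (G : SimpleGraph V) (hG : G.Connected) (ρ v : V) :
    par G ρ v = none ↔ v = ρ := by
  unfold par
  constructor
  · intro h
    split_ifs at h with h'
    by_contra hne
    apply h'
    obtain ⟨p, hp⟩ := hG.exists_walk_length_eq_dist v ρ
    cases p with
    | nil => exact absurd rfl hne
    | @cons _ w _ hvw p =>
      refine ⟨w, hvw, ?_⟩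
      rw [SimpleGraph.Walk.length_cons] at hp
      rw [SimpleGraph.dist_comm, SimpleGraph.dist_comm (u := ρ)]
      have h1 := SimpleGraph.dist_le p
      obtain ⟨q, hq⟩ := hG.exists_walk_length_eq_dist w ρ
      have h2 := SimpleGraph.dist_le (SimpleGraph.Walk.cons hvw q)
      rw [SimpleGraph.Walk.length_cons] at h2
      omega
  · rintro rfl
    rw [dif_neg]
    rintro ⟨w, _, h⟩
    simp at h

lemma par_ht {V : Type*} (G : SimpleGraph V) (hG : G.Connected) (ρ : V) :
    IsHt (par G ρ) (G.dist ρ) := by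
  refine ⟨fun v hv => ?_, fun v w h => (par_some G ρ v w h).2⟩
  rw [par_none G hG] at hv
  rw [hv]; simp

lemma toG_par {V : Type*} [Fintype V] (G : SimpleGraph V) (hG : G.IsTree) (ρ : V) :
    toG (par G ρ) = G := by
  have h1 := (toG_tree (par G ρ) _ (par_ht G hG.1 ρ) ρ (par_none G hG.1 ρ)).1
  have hle : toG (par G ρ) ≤ G := by
    intro v w h
    rw [toG, SimpleGraph.fromRel_adj] at h
    rcases h.2 with h | h
    · exact (par_some _ _ _ _ h).1
    · exact (par_some _ _ _ _ h).1.symm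
  exact le_antisymm hle ((SimpleGraph.isTree_iff_minimal_connected.mp hG).2 h1.1 hle)

lemma par_toG {V : Type*} [Fintype V] (f : V → Option V) (h : V → ℕ) (hf : IsHt f h) (ρ : V)
    (hρ : ∀ v, f v = none ↔ v = ρ) : par (toG f) ρ = f := by
  obtain ⟨hT, hd⟩ := toG_tree f h hf ρ hρ
  funext v
  rcases hv : par (toG f) ρ v with _ | w
  · rw [par_none _ hT.1, ← hρ] at hv
    exact hv.symm
  · obtain ⟨h1, h2⟩ := par_some _ _ _ _ hv
    rw [hd, hd] at h2
    rw [toG, SimpleGraph.fromRel_adj] at h1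
    rcases h1.2 with h3 | h3
    · exact h3.symm
    · have := hf.2 _ _ h3; omega

open Classical in
lemma count_triples (S : Finset ℤ) (N : ℕ) (n : ℤ → ℕ) (T : ℕ)
    (PF : Finset (Fin N → ℤ))
    (hPF : ∀ a, a ∈ PF ↔ ∀ i : ℤ, {v : Fin N | a v = i}.ncard = n i)
    (hT : ∀ a ∈ PF, (Finset.univ.filter fun f : Fin N → Option (Fin N) => Acyc f ∧ Allowed S a f ∧
      (Finset.univ.filter fun v => f v = none).card = 1).card = T) :
    {p : SimpleGraph (Fin N) × Fin N × (Fin N → ℤ) |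
        p.1.IsTree ∧ p.2.2 p.2.1 = 0 ∧
        (∀ v w, p.1.Adj v w → p.1.dist p.2.1 w = p.1.dist p.2.1 v + 1 →
          p.2.2 w - p.2.2 v ∈ S) ∧
        (∀ i : ℤ, {v : Fin N | p.2.2 v = i}.ncard = n i)}.ncard = PF.card * T := by
  rw [← smul_eq_mul, ← Finset.sum_const, ← Finset.sum_congr rfl hT, ← Finset.card_sigma,
    ← Set.ncard_coe_finset]
  apply Set.ncard_congr (fun p _ => ⟨p.2.2, par p.1 p.2.1⟩)
  · rintro ⟨G, ρ, a⟩ ⟨hG, h0, hS, hn⟩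
    simp only at hG h0 hS hn
    simp only [Finset.mem_coe, Finset.mem_sigma, Finset.mem_filter, Finset.mem_univ, true_and]
    refine ⟨(hPF a).mpr hn, ⟨_, par_ht G hG.1 ρ⟩, ⟨?_, ?_⟩, ?_⟩
    · intro v hv
      rw [par_none G hG.1] at hv
      rw [hv, h0]
    · intro v w hv
      obtain ⟨h1, h2⟩ := par_some _ _ _ _ hv
      exact hS _ _ h1.symm h2
    · simp only [par_none G hG.1]
      rw [Finset.card_eq_one]
      exact ⟨ρ, by ext; simp⟩
  · rintro ⟨G, ρ, a⟩ ⟨G', ρ', a'⟩ ⟨hG, -⟩ ⟨hG', -⟩ heq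
    simp only at hG hG'
    simp only [Sigma.mk.injEq, heq_eq_eq] at heq
    obtain ⟨rfl, heq⟩ := heq
    have h1 : G = G' := by rw [← toG_par G hG ρ, ← toG_par G' hG' ρ', heq]
    have h2 : ρ = ρ' := by
      rw [← par_none G' hG'.1, ← heq, par_none G hG.1]
    rw [h1, h2]
  · rintro ⟨a, f⟩ hb
    simp only [Finset.mem_coe, Finset.mem_sigma, Finset.mem_filter, Finset.mem_univ, true_and] at hb
    obtain ⟨ha, ⟨h, hh⟩, hS, hc⟩ := hb
    obtain ⟨ρ, hρ⟩ := Finset.card_eq_one.mp hc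
    have hρ' : ∀ v, f v = none ↔ v = ρ := by
      intro v
      have := Finset.ext_iff.mp hρ v
      simpa using this
    obtain ⟨hT, hd⟩ := toG_tree f h hh ρ hρ'
    refine ⟨(toG f, ρ, a), ⟨hT, ?_, ?_, (hPF a).mp ha⟩, ?_⟩
    · exact hS.1 ρ ((hρ' ρ).mpr rfl)
    · intro v w hvw hdist
      simp only [hd] at hdist
      simp only [toG, SimpleGraph.fromRel_adj] at hvw
      rcases hvw.2 with h3 | h3
      · have := hh.2 _ _ h3; omega
      · exact hS.2 _ _ h3
    · simp only [par_toG f h hh ρ hρ']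

open Classical in
lemma count_profiles (ℓ r : ℤ) (n : ℤ → ℕ) 
    (hzero : ∀ i : ℤ, i < ℓ ∨ r < i → n i = 0)
    (N : ℕ) (hN : N = ∑ i ∈ Finset.Icc ℓ r, n i) :
    ∃ PF : Finset (Fin N → ℤ),
      (∀ a, a ∈ PF ↔ ∀ i : ℤ, {v : Fin N | a v = i}.ncard = n i) ∧
      PF.card * ∏ i ∈ Finset.Icc ℓ r, (n i).factorial = N.factorial := by
  have hcard : Fintype.card (Fin N) = Fintype.card (Σ i : ↥(Finset.Icc ℓ r), Fin (n i)) := by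
    rw [Fintype.card_sigma]
    simp only [Fintype.card_fin]
    rw [hN, ← Finset.sum_coe_sort]
  let e := Fintype.equivOfCardEq hcard
  let c : Fin N → ↥(Finset.Icc ℓ r) := fun v => (e v).1
  let a0 : Fin N → ℤ := fun v => (c v : ℤ)
  have hc : ∀ i, Fintype.card {v // c v = i} = n i := by
    intro i
    have e1 : {v // c v = i} ≃ {x : Σ i : ↥(Finset.Icc ℓ r), Fin (n i) // x.1 = i} :=
      e.subtypeEquiv (fun v => Iff.rfl)
    rw [Fintype.card_congr (e1.trans (Equiv.sigmaSubtype i)), Fintype.card_fin]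
  have ha0 : ∀ i : ℤ, {v : Fin N | a0 v = i}.ncard = n i := by
    intro i
    by_cases hi : i ∈ Finset.Icc ℓ r
    · rw [← hc ⟨i, hi⟩, ← Nat.card_coe_set_eq, ← Nat.card_eq_fintype_card]
      apply Nat.card_congr
      exact Equiv.subtypeEquivRight (fun v => by simp [a0, Subtype.ext_iff])
    · rw [hzero i (by rw [Finset.mem_Icc] at hi; omega)]
      rw [Set.ncard_eq_zero]
      ext v
      simp only [Set.mem_ofPred_eq, Set.mem_empty_iff_false, iff_false]
      intro h
      exact hi (h ▸ (c v).2)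
  have hex : ∀ a : Fin N → ℤ, (∀ i : ℤ, {v : Fin N | a v = i}.ncard = n i) →
      ∃ τ : Equiv.Perm (Fin N), a0 ∘ τ = a := by
    intro a ha
    have : ∀ i, Nonempty ({v // a v = i} ≃ {v // a0 v = i}) := by
      intro i
      have hh : Nat.card {v // a v = i} = Nat.card {v // a0 v = i} :=
        (ha i).trans (ha0 i).symm
      exact Finite.card_eq.mp hh
    refine ⟨Equiv.ofFiberEquiv (fun i => (this i).some), ?_⟩
    funext v
    exact Equiv.ofFiberEquiv_map _ v
  let PF : Finset (Fin N → ℤ) := Finset.univ.image (fun τ : Equiv.Perm (Fin N) => a0 ∘ τ)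
  refine ⟨PF, ?_, ?_⟩
  · intro a
    simp only [PF, Finset.mem_image, Finset.mem_univ, true_and]
    constructor
    · rintro ⟨τ, rfl⟩ i
      rw [← ha0 i, ← Nat.card_coe_set_eq, ← Nat.card_coe_set_eq]
      exact Nat.card_congr (τ.subtypeEquiv (fun v => Iff.rfl))
    · exact hex a
  · have hstab : (Finset.univ.filter fun g : Equiv.Perm (Fin N) => a0 ∘ g = a0).card
        = ∏ i ∈ Finset.Icc ℓ r, (n i).factorial := by
      rw [← Fintype.card_subtype, ← Finset.prod_coe_sort]
      have := DomMulAct.stabilizer_card c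
      simp only [hc] at this
      rw [← this]
      apply Fintype.card_congr
      apply Equiv.subtypeEquivRight
      intro g
      rw [funext_iff, funext_iff]
      exact forall_congr' fun v => Subtype.ext_iff.symm
    rw [← hstab, ← smul_eq_mul, ← Finset.sum_const]
    have htot : N.factorial = (Finset.univ : Finset (Equiv.Perm (Fin N))).card := by
      rw [Finset.card_univ, Fintype.card_perm, Fintype.card_fin]
    rw [htot, Finset.card_eq_sum_card_image (fun τ : Equiv.Perm (Fin N) => a0 ∘ τ) Finset.univ]
    apply Finset.sum_congr rfl
    intro a ha
    obtain ⟨τ, -, rfl⟩ := Finset.mem_image.mp ha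
    apply Finset.card_bij (fun g _ => g * τ)
    · intro g hg
      simp only [Finset.mem_filter, Finset.mem_univ, true_and] at hg ⊢
      rw [Equiv.Perm.coe_mul, ← Function.comp_assoc, hg]
    · intro g _ g' _ h
      exact mul_right_cancel h
    · intro σ hσ
      simp only [Finset.mem_filter, Finset.mem_univ, true_and] at hσ
      refine ⟨σ * τ⁻¹, ?_, by simp⟩
      simp only [Finset.mem_filter, Finset.mem_univ, true_and]
      rw [Equiv.Perm.coe_mul, ← Function.comp_assoc, hσ]
      funext v
      simp

lemma telescope (ℓ r : ℤ) (hl : ℓ ≤ 0) (hr : 0 ≤ r) (n : ℤ → ℕ) :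
    (∏ i ∈ Finset.Icc ℓ r, (if i = 0 then 1 else if 0 < i then n (i - 1) else n (i + 1)))
      * (n ℓ * n r) = n 0 * ∏ i ∈ Finset.Icc ℓ r, n i := by
  have hsplit : ∀ F : ℤ → ℕ, ∏ i ∈ Finset.Icc ℓ r, F i =
      (∏ i ∈ Finset.Ico ℓ 0, F i) * F 0 * ∏ i ∈ Finset.Ioc 0 r, F i := by
    intro F
    have h1 : Finset.Icc ℓ r = Finset.Ico ℓ 0 ∪ insert 0 (Finset.Ioc 0 r) := by
      ext i
      simp only [Finset.mem_Icc, Finset.mem_union, Finset.mem_insert, Finset.mem_Ico,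
        Finset.mem_Ioc]
      omega
    rw [h1, Finset.prod_union, Finset.prod_insert, mul_assoc]
    · simp
    · rw [Finset.disjoint_left]
      intro i
      simp only [Finset.mem_insert, Finset.mem_Ico, Finset.mem_Ioc]
      omega
  have hR : ∀ k : ℕ, (∏ i ∈ Finset.Ioc (0:ℤ) k, n (i - 1)) * n k
      = n 0 * ∏ i ∈ Finset.Ioc (0:ℤ) k, n i := by
    intro k
    induction k with
    | zero => simp
    | succ k ih =>
      have h1 : Finset.Ioc (0:ℤ) ((k + 1 : ℕ) : ℤ) = insert ((k:ℤ) + 1) (Finset.Ioc (0:ℤ) k) := by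
        ext i
        simp only [Finset.mem_insert, Finset.mem_Ioc]
        push_cast
        omega
      rw [h1, Finset.prod_insert (by simp), Finset.prod_insert (by simp)]
      push_cast
      rw [add_sub_cancel_right]
      linear_combination (n ((k:ℤ) + 1)) * ih
  have hL : ∀ k : ℕ, (∏ i ∈ Finset.Ico (-k:ℤ) 0, n (i + 1)) * n (-k)
      = n 0 * ∏ i ∈ Finset.Ico (-k:ℤ) 0, n i := by
    intro k
    induction k with
    | zero => simp
    | succ k ih =>
      have h1 : Finset.Ico (-((k + 1 : ℕ) : ℤ)) 0 = insert (-(k:ℤ) - 1) (Finset.Ico (-k:ℤ) 0) := by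
        ext i
        simp only [Finset.mem_insert, Finset.mem_Ico]
        push_cast
        omega
      rw [h1, Finset.prod_insert (by simp), Finset.prod_insert (by simp)]
      have h2 : (-((k + 1 : ℕ) : ℤ)) = -(k:ℤ) - 1 := by push_cast; ring
      rw [h2, sub_add_cancel]
      linear_combination (n (-(k:ℤ) - 1)) * ih
  rw [hsplit, hsplit]
  have e1 : ∏ i ∈ Finset.Ico ℓ 0, (if i = 0 then 1 else if 0 < i then n (i - 1) else n (i + 1))
      = ∏ i ∈ Finset.Ico ℓ 0, n (i + 1) := by
    apply Finset.prod_congr rfl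
    intro i hi
    rw [Finset.mem_Ico] at hi
    rw [if_neg (by omega), if_neg (by omega)]
  have e2 : ∏ i ∈ Finset.Ioc 0 r, (if i = 0 then 1 else if 0 < i then n (i - 1) else n (i + 1))
      = ∏ i ∈ Finset.Ioc 0 r, n (i - 1) := by
    apply Finset.prod_congr rfl
    intro i hi
    rw [Finset.mem_Ioc] at hi
    rw [if_neg (by omega), if_pos (by omega)]
  rw [e1, e2, if_pos rfl]
  have h1 := hR r.toNat
  have h2 := hL (-ℓ).toNat
  rw [Int.toNat_of_nonneg hr] at h1
  rw [Int.toNat_of_nonneg (by omega), neg_neg] at h2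
  calc _ = ((∏ i ∈ Finset.Ico ℓ 0, n (i + 1)) * n ℓ) * ((∏ i ∈ Finset.Ioc 0 r, n (i - 1)) * n r) := by ring
    _ = _ := by rw [h1, h2]; ring


/-- Let `S ⊆ ℤ` with `max S = 1` and either `min S = -1` or `ℓ = 0`.
The number of `S`-embedded rooted Cayley trees of size `N` with vertical profile
`(n ℓ, …, n r)` equals
`(n 0 / (n ℓ * n r)) * N! / ∏ (n i - 1)! * ∏_{i=ℓ}^r (∑_{s ∈ S} n (i - s))^(n i - 1)`,
stated here with denominators cleared.  An `S`-embedded rooted Cayley tree is a triple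
`(G, root, a)` with `G` a tree on `Fin N`, `a root = 0`, and `a w - a v ∈ S` whenever
`w` is a child of `v` (adjacent and farther from the root). -/
theorem S_embedded_cayley_vertical_profile
    (S : Finset ℤ) (h1S : 1 ∈ S) (hSle : ∀ s ∈ S, s ≤ 1)
    (ℓ r : ℤ) (hl : ℓ ≤ 0) (hr : 0 ≤ r)
    (hmin : ((-1 : ℤ) ∈ S ∧ ∀ s ∈ S, -1 ≤ s) ∨ ℓ = 0)
    (n : ℤ → ℕ) (hpos : ∀ i ∈ Finset.Icc ℓ r, 0 < n i)
    (hzero : ∀ i : ℤ, i < ℓ ∨ r < i → n i = 0)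
    (N : ℕ) (hN : N = ∑ i ∈ Finset.Icc ℓ r, n i) :
    {p : SimpleGraph (Fin N) × Fin N × (Fin N → ℤ) |
        p.1.IsTree ∧ p.2.2 p.2.1 = 0 ∧
        (∀ v w, p.1.Adj v w → p.1.dist p.2.1 w = p.1.dist p.2.1 v + 1 →
          p.2.2 w - p.2.2 v ∈ S) ∧
        (∀ i : ℤ, {v : Fin N | p.2.2 v = i}.ncard = n i)}.ncard
      * (n ℓ * n r) * ∏ i ∈ Finset.Icc ℓ r, (n i - 1).factorial =
    n 0 * N.factorial *
      ∏ i ∈ Finset.Icc ℓ r, (∑ s ∈ S, n (i - s)) ^ (n i - 1) := by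
  classical
  obtain ⟨PF, hPF, hcard⟩ := count_profiles ℓ r n hzero N hN
  have hT : ∀ a ∈ PF, _ := fun a ha => tree_count S h1S hSle ℓ r hl hr hmin n hpos hzero a
    (fun i => by
      rw [← (hPF a).mp ha i, ← Set.ncard_coe_finset]
      simp)
  rw [count_triples S N n _ PF hPF hT, ← hcard]
  have htel := telescope ℓ r hl hr n
  have hfac : ∏ i ∈ Finset.Icc ℓ r, (n i).factorial =
      (∏ i ∈ Finset.Icc ℓ r, n i) * ∏ i ∈ Finset.Icc ℓ r, (n i - 1).factorial := by
    rw [← Finset.prod_mul_distrib]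
    apply Finset.prod_congr rfl
    intro i hi
    exact (Nat.mul_factorial_pred (hpos i hi).ne').symm
  rw [hfac]
  linear_combination (PF.card * (∏ i ∈ Finset.Icc ℓ r, (n i - 1).factorial) *
    ∏ i ∈ Finset.Icc ℓ r, (∑ s ∈ S, n (i - s)) ^ (n i - 1)) * htel
end

section
/- Let S ⊆ Z with max S = 1, and either min S = -1 or ℓ = 0. Let ℓ ≤ 0 ≤ r and (n_i)_{ℓ ≤ i ≤ r} be positive integers. The number of S-ary trees with vertical profile (n_ℓ,...,n_r) equals (n_0/(n_ℓ n_r)) · C(Σ_{s∈S} n_{-s}, n_0 - 1) · ∏_{ℓ ≤ i ≤ r, i ≠ 0} C(Σ_{s∈S} n_{i-s} - 1, n_i - 1), with n_j = 0 for j < ℓ or j > r. -/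
set_option linter.unusedSectionVars false

def vch (N k : ℤ) : ℤ := if k < 0 then 0 else Ring.choose N k.toNat

lemma vch_neg {N k : ℤ} (h : k < 0) : vch N k = 0 := by simp [vch, h]
lemma vch_zero {N : ℤ} : vch N 0 = 1 := by simp [vch]
lemma vch_nat (N k : ℕ) : vch N k = (N.choose k : ℤ) := by
  simp [vch, Ring.choose_natCast]

lemma vch_pascal (N k : ℤ) : vch (N+1) k = vch N k + vch N (k-1) := by
  rcases lt_trichotomy k 0 with h | h | h
  · rw [vch_neg h, vch_neg h, vch_neg (by omega)]; simp
  · subst h; rw [vch_zero, vch_zero, vch_neg (by omega)]; simp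
  · obtain ⟨m, rfl⟩ : ∃ m : ℕ, k = m + 1 := ⟨(k-1).toNat, by omega⟩
    have e : ((m:ℤ)+1).toNat = m + 1 := by omega
    have h1 : ¬ ((m:ℤ)+1 < 0) := by omega
    have h2 : ¬ ((m:ℤ) < 0) := by omega
    simp only [vch, h1, h2, if_false, e, add_sub_cancel_right, Int.toNat_natCast]
    rw [Ring.choose_succ_succ]; ring

lemma vch_absorb (N : ℕ) (k : ℤ) : k * vch N k = N * vch (N-1) (k-1) := by
  rcases lt_trichotomy k 0 with h | h | h
  · rw [vch_neg h, vch_neg (by omega)]; simp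
  · subst h; rw [vch_neg (by omega : (0:ℤ)-1 < 0)]; simp
  · obtain ⟨m, rfl⟩ : ∃ m : ℕ, k = m + 1 := ⟨(k-1).toNat, by omega⟩
    rcases N with _ | N
    · have := vch_nat 0 (m+1)
      push_cast at this ⊢
      simp [this]
    · have h1 := vch_nat (N+1) (m+1)
      have h2 := vch_nat N m
      push_cast at h1 ⊢
      rw [add_sub_cancel_right, add_sub_cancel_right, h1, h2]
      have := Nat.add_one_mul_choose_eq N m
      zify at this
      linarith

section
variable {W : Type*} [Fintype W] [DecidableEq W]

def vcol (A : W → Finset W) (j : W) (N k : ℤ) : W → ℤ := fun i =>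
  (if i = j then vch N k else 0) - (if j ∈ A i then vch (N-1) (k-1) else 0)

lemma vcol_neg (A : W → Finset W) (j : W) {N k : ℤ} (h : k < 0) : vcol A j N k = 0 := by
  funext i; simp [vcol, vch_neg h, vch_neg (show k - 1 < 0 by omega)]

lemma vcol_pascal (A : W → Finset W) (j : W) (N k : ℤ) :
    vcol A j (N+1) k = vcol A j N (k-1) + vcol A j N k := by
  funext i
  have h1 := vch_pascal N k
  have h2 := vch_pascal (N-1) (k-1)
  rw [show N - 1 + 1 = N + 1 - 1 by ring] at h2
  simp only [vcol, Pi.add_apply]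
  split_ifs <;> linarith

def vD (A : W → Finset W) (N k : W → ℤ) : ℤ :=
  Matrix.detRowAlternating (R := ℤ) (fun j => vcol A j (N j) (k j))

lemma vD_neg (A : W → Finset W) (N k : W → ℤ) (j : W) (h : k j < 0) : vD A N k = 0 :=
  MultilinearMap.map_coord_zero _ j (vcol_neg A j h)

lemma vD_pascal (A : W → Finset W) (N k : W → ℤ) (C : Finset W) :
    vD A (fun j => N j + if j ∈ C then 1 else 0) k =
      ∑ B ∈ C.powerset, vD A N (fun j => k j - if j ∈ B then 1 else 0) := by
  have key := MultilinearMap.map_add_univ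
    (Matrix.detRowAlternating (n := W) (R := ℤ)).toMultilinearMap
    (fun j => if j ∈ C then vcol A j (N j) (k j - 1) else 0)
    (fun j => vcol A j (N j) (k j))
  have e : ((fun j => if j ∈ C then vcol A j (N j) (k j - 1) else 0) +
    (fun j => vcol A j (N j) (k j)) : W → W → ℤ) =
    fun j => vcol A j (N j + if j ∈ C then 1 else 0) (k j) := by
    funext j
    by_cases h : j ∈ C
    · simp only [Pi.add_apply, h, if_true, vcol_pascal]
    · simp [h]
  rw [e] at key
  refine Eq.trans key ?_
  symm
  rw [← Finset.sum_subset (Finset.subset_univ C.powerset)]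
  · refine Finset.sum_congr rfl fun B hB => ?_
    rw [Finset.mem_powerset] at hB
    unfold vD
    change _ = Matrix.detRowAlternating (R := ℤ) _
    congr 1
    funext j
    by_cases h : j ∈ B
    · simp [h, hB h]
    · simp [h]
  · intro B _ hB
    rw [Finset.mem_powerset, Finset.not_subset] at hB
    obtain ⟨j, hj, hjC⟩ := hB
    refine MultilinearMap.map_coord_zero _ j ?_
    simp [hj, hjC]

lemma vcol_dot (A : W → Finset W) (n : W → ℕ) (j : W) (k : ℤ) (N : ℕ)
    (hN : N = ∑ i, if j ∈ A i then n i else 0) :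
    ∑ i, (n i : ℤ) * vcol A j N k i = (n j - k) * vch N k := by
  have h := vch_absorb N k
  have hN' : (N : ℤ) = ∑ i, if j ∈ A i then (n i : ℤ) else 0 := by
    rw [hN]; push_cast; rfl
  simp only [vcol, mul_sub, Finset.sum_sub_distrib, mul_ite, mul_zero, Finset.sum_ite_eq', 
    Finset.mem_univ, if_true]
  rw [sub_mul, h]
  congr 1
  conv_rhs => rw [hN']
  rw [Finset.sum_mul]
  refine Finset.sum_congr rfl fun i _ => ?_
  split_ifs <;> simp [hN']

end

section
variable {W : Type*} [Fintype W] [DecidableEq W]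

def vN (A : W → Finset W) (n : W → ℕ) (j : W) : ℕ := ∑ i, if j ∈ A i then n i else 0

lemma vD_null (A : W → Finset W) (n : W → ℕ) (hn : n ≠ 0) :
    vD A (fun j => (vN A n j : ℤ)) (fun j => (n j : ℤ)) = 0 := by
  change Matrix.det (Matrix.of fun j => vcol A j (vN A n j : ℤ) (n j : ℤ)) = 0
  rw [← Matrix.exists_mulVec_eq_zero_iff]
  refine ⟨fun i => (n i : ℤ), ?_, ?_⟩
  · intro h; apply hn; funext i; simpa using congrFun h i
  · funext j
    have := vcol_dot A n j (n j) (vN A n j) rfl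
    simp only [Matrix.mulVec, dotProduct, Pi.zero_apply, Matrix.of_apply]
    rw [sub_self, zero_mul] at this
    rw [← this]
    exact Finset.sum_congr rfl fun i _ => mul_comm _ _

lemma vD_one (A : W → Finset W) (N : W → ℤ) :
    vD A N (fun _ => 0) = 1 := by
  change Matrix.det (Matrix.of fun j => vcol A j (N j) 0) = 1
  rw [show (Matrix.of fun j => vcol A j (N j) 0) = (1 : Matrix W W ℤ) from ?_, Matrix.det_one]
  ext j i
  simp [vcol, vch_zero, vch_neg, Matrix.one_apply, eq_comm]

open MvPolynomial in
lemma vD_main (A : W → Finset W) (f : ℕ → W → MvPolynomial W ℤ) (f0 : ∀ i, f 0 i = 0)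
    (hf : ∀ h i, f (h+1) i = X i * ∏ j ∈ A i, (1 + f h j)) :
    ∀ d : ℕ, ∀ n : W →₀ ℕ, ∑ i, n i = d → ∀ L : Multiset (ℕ × W), (∀ p ∈ L, d ≤ p.1) →
    coeff n (L.map (fun p => f p.1 p.2)).prod =
      vD A (fun j => (vN A n j : ℤ)) (fun j => (n j : ℤ) - ((L.map Prod.snd).count j : ℕ)) := by
  intro d
  induction d with
  | zero => 
    intro n hn L _
    have hn0 : n = 0 := by
      ext i
      simpa using (Finset.sum_eq_zero_iff.mp hn) i (Finset.mem_univ i)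
    subst hn0
    induction L using Multiset.induction_on with
    | empty => simp [vD_one]
    | cons p L' _ =>
      obtain ⟨h, i⟩ := p
      rw [vD_neg _ _ _ i (by simp; omega)]
      rw [Multiset.map_cons, Multiset.prod_cons]
      rcases h with _ | h
      · simp [f0]
      · simp only [hf, mul_assoc]; rw [coeff_X_mul']; simp
  | succ d ih =>
    intro n hn L hL
    induction L using Multiset.induction_on with
    | empty => 
      have hn0 : n ≠ 0 := by rintro rfl; simp at hn
      have : (⇑n) ≠ 0 := by intro h; exact hn0 (DFunLike.coe_injective h)
      have h2 := vD_null A n this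
      simp only [Multiset.map_zero, Multiset.prod_zero, Multiset.count_zero, Nat.cast_zero,
        sub_zero, h2]
      rw [coeff_one, if_neg (Ne.symm hn0)]
    | cons p L' _ =>
      obtain ⟨h, i⟩ := p
      obtain ⟨h, rfl⟩ : ∃ h', h = h' + 1 := by
        have := hL _ (Multiset.mem_cons_self _ _)
        exact ⟨h - 1, by simp at this; omega⟩
      rw [Multiset.map_cons, Multiset.prod_cons, hf, mul_assoc, coeff_X_mul']
      by_cases hi : n i = 0
      · rw [if_neg (by simpa using hi), vD_neg _ _ _ i (by simp; omega)]
      · rw [if_pos (by simpa using hi)]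
        set n' := n - Finsupp.single i 1 with hn'
        have hnn : ∀ j, n j = n' j + if j = i then 1 else 0 := by
          intro j
          rw [hn', Finsupp.tsub_apply, Finsupp.single_apply]
          by_cases hj : j = i
          · subst hj; simp; omega
          · simp [hj, Ne.symm hj]
        have hs : ∑ j, n' j = d := by
          have : ∑ j, n j = ∑ j, n' j + 1 := by
            rw [Finset.sum_congr rfl fun j _ => hnn j, Finset.sum_add_distrib]; simp
          omega
        have hNN : ∀ j, (vN A n j : ℤ) = vN A n' j + if j ∈ A i then 1 else 0 := by
          intro j
          unfold vN
          push_cast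
          have : ∀ x, (if j ∈ A x then (n x : ℤ) else 0) = (if j ∈ A x then (n' x : ℤ) else 0)
              + if x = i then (if j ∈ A i then 1 else 0) else 0 := by
            intro x
            rw [hnn x]
            by_cases hx : x = i
            · subst hx; split_ifs <;> simp
            · simp [hx]
          rw [Finset.sum_congr rfl fun x _ => this x, Finset.sum_add_distrib]; simp
        simp_rw [hNN]
        rw [vD_pascal, Finset.prod_one_add, Finset.sum_mul, coeff_sum]
        refine Finset.sum_congr rfl fun B hB => ?_
        have := ih n' hs (B.val.map (fun j => (h, j)) + L') (by
          intro p hp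
          rw [Multiset.mem_add] at hp
          rcases hp with hp | hp
          · rw [Multiset.mem_map] at hp
            obtain ⟨j, _, rfl⟩ := hp
            have := hL _ (Multiset.mem_cons_self _ _)
            simpa using this
          · have := hL _ (Multiset.mem_cons_of_mem hp)
            omega)
        rw [Multiset.map_add, Multiset.prod_add, Multiset.map_map] at this
        refine Eq.trans this ?_
        congr 1
        funext j
        rw [Multiset.map_add, Multiset.map_map, Multiset.count_add]
        simp only [Function.comp_def, Multiset.map_id', Multiset.map_cons, Multiset.count_cons]
        have hB : Multiset.count j B.val = if j ∈ B then 1 else 0 := by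
          by_cases h : j ∈ B
          · simp [h, Multiset.count_eq_one_of_mem B.nodup]
          · simp [h]
        rw [hB, hnn j]
        push_cast
        ring
end

lemma det_tri {W : Type*} [Fintype W] [DecidableEq W] (M : Matrix W W ℤ) (f : W → ℕ)
    (hf : Function.Injective f) (h : ∀ i j, f j < f i → M i j = 0) : M.det = ∏ i, M i i := by
  let _ : LinearOrder W := LinearOrder.lift' f hf
  convert Matrix.det_of_isUpperTriangular (M := M) ?_
  intro i j hij
  exact h i j hij

def vP (a i : ℤ) : ℤ := if (a = 0 ∨ (0 < a ∧ a ≤ i) ∨ (a < 0 ∧ i ≤ a)) then 1 else 0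
def vf (a : ℤ) : ℕ := if 0 ≤ a then (2 * a).toNat else (-2*a-1).toNat

lemma vf_inj : Function.Injective vf := by
  intro a b h
  unfold vf at h
  split_ifs at h <;> omega

lemma vD_eval
    (S : Finset ℤ) (h1S : 1 ∈ S) (hSle : ∀ s ∈ S, s ≤ 1)
    (ℓ r : ℤ) (hl : ℓ ≤ 0) (hr : 0 ≤ r)
    (hmin : ((-1 : ℤ) ∈ S ∧ ∀ s ∈ S, -1 ≤ s) ∨ ℓ = 0)
    (n : ℤ → ℕ) (A : Finset.Icc ℓ r → Finset (Finset.Icc ℓ r))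
    (hA : ∀ i j, j ∈ A i ↔ (j : ℤ) - i ∈ S) :
    vD A (fun j => (vN A (fun i => n i) j : ℤ)) (fun j => (n j : ℤ) - if (j : ℤ) = 0 then 1 else 0) 
      * ∏ i : Finset.Icc ℓ r, (n i : ℤ) =
    ∏ j : Finset.Icc ℓ r, (if (j : ℤ) = 0 then vch (vN A (fun i => n i) j) ((n j : ℤ) - 1) else
      vch ((vN A (fun i => n i) j : ℤ) - 1) ((n j : ℤ) - 1) * 
        (if 0 < (j : ℤ) then n (j - 1) else n (j + 1))) := by
  set N := vN A (fun i => n i) with hN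
  set M : Matrix (Finset.Icc ℓ r) (Finset.Icc ℓ r) ℤ :=
    Matrix.of fun j => vcol A j (N j) ((n j : ℤ) - if (j : ℤ) = 0 then 1 else 0) with hM
  change M.det * _ = _
  set V : Matrix (Finset.Icc ℓ r) (Finset.Icc ℓ r) ℤ := Matrix.of fun i a => n i * vP a i with hV
  have hVd : V.det = ∏ i : Finset.Icc ℓ r, (n i : ℤ) := by
    rw [← Matrix.det_transpose, det_tri V.transpose (fun i => vf i) (fun a b h => Subtype.ext (vf_inj h))]
    · refine Finset.prod_congr rfl fun i _ => ?_
      have : vP i i = 1 := by unfold vP; rw [if_pos]; omega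
      simp [hV, this]
    · intro i j h
      have : vP i j = 0 := by 
        unfold vP; rw [if_neg]; unfold vf at h; split_ifs at h <;> omega
      simp [hV, this]
  have hMV : ∀ j a : Finset.Icc ℓ r, (j : ℤ) ≠ 0 → (M * V) j a = 
      vch ((N j : ℤ) - 1) ((n j : ℤ) - 1) * 
        ∑ i : Finset.Icc ℓ r, (if (j : ℤ) - i ∈ S then (n i : ℤ) else 0) * (vP a j - vP a i) := by
    intro j a hj
    have h := vch_absorb (N j) (n j)
    have hN' : (N j : ℤ) = ∑ i : Finset.Icc ℓ r, if (j:ℤ) - i ∈ S then (n i : ℤ) else 0 := by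
      rw [hN]; unfold vN; push_cast; simp only [hA]
    simp only [Matrix.mul_apply, hM, hV, Matrix.of_apply, vcol, hj, if_false, sub_zero, hA]
    simp only [sub_mul, mul_sub, Finset.sum_sub_distrib, ite_mul, zero_mul, Finset.sum_ite_eq', 
      Finset.mem_univ, if_true]
    congr 1
    · simp only [← ite_zero_mul]
      rw [← Finset.sum_mul, ← hN']
      linear_combination vP a j * h
    · rw [Finset.mul_sum]
      refine Finset.sum_congr rfl fun i _ => ?_
      split_ifs <;> ring
  rw [← hVd, ← Matrix.det_mul, det_tri (M * V) (fun i => vf i) 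
    (fun a b h => Subtype.ext (vf_inj h))]
  · refine Finset.prod_congr rfl fun j _ => ?_
    by_cases hj : (j : ℤ) = 0
    · rw [if_pos hj]
      have := vcol_dot A (fun i => n i) j ((n j : ℤ) - 1) (N j) rfl
      rw [Matrix.mul_apply]
      simp only [hM, hV, Matrix.of_apply, hj, if_true]
      rw [show ((n j : ℤ) - (n j - 1)) = 1 by ring, one_mul] at this
      rw [hj] at this
      rw [← this]
      refine Finset.sum_congr rfl fun i _ => ?_
      simp [vP]; ring
    · rw [if_neg hj, hMV j j hj]
      congr 1
      have hjm := Finset.mem_Icc.mp j.2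
      have hPj : vP j j = 1 := by unfold vP; rw [if_pos]; omega
      rcases lt_or_gt_of_ne hj with hneg | hpos
      · obtain ⟨hm, hm'⟩ : ((-1 : ℤ) ∈ S ∧ ∀ s ∈ S, -1 ≤ s) := by
          rcases hmin with h | h
          · exact h
          · omega
        rw [if_neg (by omega)]
        rw [Finset.sum_eq_single ⟨(j : ℤ) + 1, Finset.mem_Icc.mpr (by omega)⟩]
        · have : vP j (j+1) = 0 := by unfold vP; rw [if_neg]; omega
          simp [this, hPj, hm]
        · intro i _ hi
          have hi' : (i : ℤ) ≠ j + 1 := fun h => hi (Subtype.ext h)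
          split_ifs with hs
          · have := hm' _ hs
            have : vP j i = 1 := by unfold vP; rw [if_pos]; omega
            simp [this, hPj]
          · simp
        · simp
      · rw [if_pos hpos]
        rw [Finset.sum_eq_single ⟨(j : ℤ) - 1, Finset.mem_Icc.mpr (by omega)⟩]
        · have : vP j (j-1) = 0 := by unfold vP; rw [if_neg]; omega
          simp [this, hPj, h1S]
        · intro i _ hi
          have hi' : (i : ℤ) ≠ j - 1 := fun h => hi (Subtype.ext h)
          split_ifs with hs
          · have := hSle _ hs
            have : vP j i = 1 := by unfold vP; rw [if_pos]; omega
            simp [this, hPj]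
          · simp
        · simp
  · intro j a h
    have hj : (j : ℤ) ≠ 0 := by
      intro hj; simp [vf, hj] at h
    rw [hMV j a hj, Finset.sum_eq_zero, mul_zero]
    intro i _
    split_ifs with hs
    · have h1 := hSle _ hs
      have hjm := Finset.mem_Icc.mp j.2
      have ham := Finset.mem_Icc.mp a.2
      have him := Finset.mem_Icc.mp i.2
      have h2 : -1 ≤ (j : ℤ) - i ∨ ℓ = 0 := hmin.imp (fun h => h.2 _ hs) id
      have : vP a j = vP a i := by
        unfold vf at h
        unfold vP
        congr 1
        apply propext
        split_ifs at h <;> omega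
      simp [this]
    · simp


def vglue (S : Finset ℤ) (p : ∀ s ∈ S, Finset (List ℤ)) : Finset (List ℤ) :=
  insert [] (S.attach.biUnion fun s => (p s s.2).image (fun u => s.1 :: u))

def vT (S : Finset ℤ) : ℕ → Finset (Finset (List ℤ))
  | 0 => ∅
  | h+1 => (S.pi (fun _ => insert ∅ (vT S h))).image (vglue S)

def vTree (S : Finset ℤ) (T : Finset (List ℤ)) : Prop :=
  ([] : List ℤ) ∈ T ∧ (∀ w ∈ T, ∀ x ∈ w, x ∈ S) ∧ (∀ w ∈ T, w ≠ [] → w.dropLast ∈ T)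

lemma nil_mem_vglue (S : Finset ℤ) (p : ∀ s ∈ S, Finset (List ℤ)) : [] ∈ vglue S p := by
  simp [vglue]

lemma cons_mem_vglue {S : Finset ℤ} {p : ∀ s ∈ S, Finset (List ℤ)} {s : ℤ} {u : List ℤ} :
    s :: u ∈ vglue S p ↔ ∃ hs : s ∈ S, u ∈ p s hs := by
  simp only [vglue, Finset.mem_insert, reduceCtorEq, false_or, Finset.mem_biUnion,
    Finset.mem_image, List.cons.injEq, Finset.mem_attach, true_and]
  constructor
  · rintro ⟨⟨a, ha⟩, u', h, rfl, rfl⟩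
    exact ⟨ha, h⟩
  · rintro ⟨hs, h⟩
    exact ⟨⟨s, hs⟩, u, h, rfl, rfl⟩

lemma vglue_inj (S : Finset ℤ) : Function.Injective (vglue S) := by
  intro p q h
  funext s hs
  ext u
  have h1 := cons_mem_vglue (p := p) (s := s) (u := u)
  have h2 := cons_mem_vglue (p := q) (s := s) (u := u)
  rw [h] at h1
  have := h1.symm.trans h2
  simpa [hs] using this

lemma mem_vT (S : Finset ℤ) (h : ℕ) (T : Finset (List ℤ)) :
    T ∈ vT S h ↔ vTree S T ∧ ∀ w ∈ T, w.length < h := by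
  induction h generalizing T with
  | zero => 
    simp only [vT, Finset.notMem_empty, false_iff, not_and]
    intro hT h
    simpa using h _ hT.1
  | succ h ih =>
    simp only [vT, Finset.mem_image, Finset.mem_pi, Finset.mem_insert, ih]
    constructor
    · rintro ⟨p, hp, rfl⟩
      refine ⟨⟨nil_mem_vglue S p, ?_, ?_⟩, ?_⟩
      · rintro (_ | ⟨s, u⟩) hw x hx
        · simp at hx
        · obtain ⟨hs, hu⟩ := cons_mem_vglue.mp hw
          rcases List.mem_cons.mp hx with rfl | hx
          · exact hs
          · rcases hp s hs with h | h
            · simp [h] at hu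
            · exact h.1.2.1 u hu x hx
      · rintro (_ | ⟨s, u⟩) hw hne
        · simp at hne
        · obtain ⟨hs, hu⟩ := cons_mem_vglue.mp hw
          rcases u with _ | ⟨t, u⟩
          · exact nil_mem_vglue S p
          · rw [List.dropLast_cons_cons]
            refine cons_mem_vglue.mpr ⟨hs, ?_⟩
            rcases hp s hs with h | h
            · simp [h] at hu
            · exact h.1.2.2 _ hu (by simp)
      · rintro (_ | ⟨s, u⟩) hw
        · simp
        · obtain ⟨hs, hu⟩ := cons_mem_vglue.mp hw
          rcases hp s hs with h | h
          · simp [h] at hu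
          · have := h.2 _ hu
            simp; omega
    · rintro ⟨hT, hlen⟩
      have hinj : ∀ s : ℤ, Set.InjOn (fun u : List ℤ => s :: u) ((fun u => s :: u) ⁻¹' (T : Set (List ℤ))) :=
        fun s a _ b _ hab => by simpa using hab
      refine ⟨fun s _ => T.preimage (fun u => s :: u) (hinj s), ?_, ?_⟩
      · intro s hs
        rcases Finset.eq_empty_or_nonempty (T.preimage (fun u => s :: u) (hinj s)) with he | ⟨u, hu⟩
        · exact Or.inl he
        · right
          have hstep : ∀ k : ℕ, ∀ u : List ℤ, u.length = k → s :: u ∈ T → [s] ∈ T := by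
            intro k
            induction k with
            | zero => intro u hk hu; rw [List.length_eq_zero_iff] at hk; rwa [hk] at hu
            | succ k ihk =>
              intro u hk hu
              rcases u with _ | ⟨t, u⟩
              · simp at hk
              · have := hT.2.2 _ hu (by simp)
                rw [List.dropLast_cons_cons] at this
                exact ihk _ (by simp at hk ⊢; omega) this
          refine ⟨⟨?_, ?_, ?_⟩, ?_⟩
          · rw [Finset.mem_preimage] at hu ⊢
            exact hstep _ u rfl hu
          · intro w hw x hx
            rw [Finset.mem_preimage] at hw
            exact hT.2.1 _ hw x (List.mem_cons_of_mem _ hx)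
          · intro w hw hne
            rw [Finset.mem_preimage] at hw ⊢
            rcases w with _ | ⟨t, w⟩
            · simp at hne
            · have := hT.2.2 _ hw (by simp)
              rwa [List.dropLast_cons_cons] at this
          · intro w hw
            rw [Finset.mem_preimage] at hw
            have := hlen _ hw
            simp at this; omega
      · ext w
        rcases w with _ | ⟨s, u⟩
        · simp [nil_mem_vglue, hT.1]
        · rw [cons_mem_vglue]
          simp only [Finset.mem_preimage, exists_prop, and_iff_right_iff_imp]
          intro hw
          exact hT.2.1 _ hw s (by simp)

section
variable {R : Type*} [CommRing R]

def vwt (Y : ℤ → R) (i : ℤ) (T : Finset (List ℤ)) : R := ∏ w ∈ T, Y (i + w.sum)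
def vg (S : Finset ℤ) (Y : ℤ → R) (h : ℕ) (i : ℤ) : R := ∑ T ∈ vT S h, vwt Y i T

lemma vwt_glue (S : Finset ℤ) (Y : ℤ → R) (i : ℤ) (p : ∀ s ∈ S, Finset (List ℤ)) :
    vwt Y i (vglue S p) = Y i * ∏ s ∈ S.attach, vwt Y (i + s) (p s s.2) := by
  unfold vwt vglue
  rw [Finset.prod_insert (by simp), Finset.prod_biUnion]
  · congr 1
    · simp
    · refine Finset.prod_congr rfl fun s _ => ?_
      rw [Finset.prod_image (by intro a _ b _ hab; simpa using hab)]
      simp [add_assoc]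
  · intro a _ b _ hab
    rw [Function.onFun, Finset.disjoint_left]
    intro w hw hw'
    rw [Finset.mem_image] at hw hw'
    obtain ⟨u, _, rfl⟩ := hw
    obtain ⟨u', _, h⟩ := hw'
    simp at h
    exact hab h.1.symm

lemma vg_succ (S : Finset ℤ) (Y : ℤ → R) (h : ℕ) (i : ℤ) :
    vg S Y (h+1) i = Y i * ∏ s ∈ S, (1 + vg S Y h (i + s)) := by
  have h0 : (∅ : Finset (List ℤ)) ∉ vT S h := by
    rw [mem_vT]; rintro ⟨h, _⟩; simpa using h.1
  have e : ∀ s, 1 + vg S Y h (i + s) = ∑ T ∈ insert ∅ (vT S h), vwt Y (i + s) T := by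
    intro s
    rw [Finset.sum_insert h0]; simp [vg, vwt]
  simp_rw [e]
  rw [Finset.prod_sum, Finset.mul_sum]
  unfold vg
  rw [vT, Finset.sum_image (fun a _ b _ hab => vglue_inj S hab)]
  exact Finset.sum_congr rfl fun p _ => vwt_glue S Y i p

end


lemma vprod_nb (ℓ r : ℤ) (hl : ℓ ≤ 0) (hr : 0 ≤ r) (n : ℤ → ℤ) :
    (n ℓ * n r) * ∏ j ∈ (Finset.Icc ℓ r).erase 0, (if 0 < j then n (j - 1) else n (j + 1)) =
      n 0 * ∏ j ∈ Finset.Icc ℓ r, n j := by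
  have e1 : (Finset.Icc ℓ r).erase 0 = Finset.Ico ℓ 0 ∪ Finset.Ioc 0 r := by
    ext x; simp; omega
  have d1 : Disjoint (Finset.Ico ℓ 0) (Finset.Ioc 0 r) := by
    rw [Finset.disjoint_left]; intro x; simp; omega
  have e2 : Finset.Icc ℓ r = Finset.Icc ℓ 0 ∪ Finset.Ioc 0 r := by
    ext x; simp; omega
  have d2 : Disjoint (Finset.Icc ℓ 0) (Finset.Ioc 0 r) := by
    rw [Finset.disjoint_left]; intro x; simp; omega
  have e3 : Finset.Icc 0 r = insert 0 (Finset.Ioc 0 r) := by ext x; simp; omega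
  have e4 : Finset.Icc 0 r = insert r (Finset.Ico 0 r) := by ext x; simp; omega
  have e5 : Finset.Icc ℓ 0 = insert ℓ (Finset.Ioc ℓ 0) := by ext x; simp; omega
  have p1 : ∏ j ∈ Finset.Ioc 0 r, (if 0 < j then n (j - 1) else n (j + 1)) =
      ∏ j ∈ Finset.Ico 0 r, n j := by
    refine Finset.prod_bij' (fun j _ => j - 1) (fun j _ => j + 1) ?_ ?_ ?_ ?_ ?_
    · intro a ha; simp at ha ⊢; omega
    · intro a ha; simp at ha ⊢; omega
    · intro a; simp
    · intro a; simp
    · intro a ha; rw [if_pos (Finset.mem_Ioc.mp ha).1]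
  have p2 : ∏ j ∈ Finset.Ico ℓ 0, (if 0 < j then n (j - 1) else n (j + 1)) =
      ∏ j ∈ Finset.Ioc ℓ 0, n j := by
    refine Finset.prod_bij' (fun j _ => j + 1) (fun j _ => j - 1) ?_ ?_ ?_ ?_ ?_
    · intro a ha; simp at ha ⊢; omega
    · intro a ha; simp at ha ⊢; omega
    · intro a; simp
    · intro a; simp
    · intro a ha; rw [if_neg (by have := (Finset.mem_Ico.mp ha).2; omega)]
  have q1 : ∏ j ∈ Finset.Icc 0 r, n j = n 0 * ∏ j ∈ Finset.Ioc 0 r, n j := by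
    rw [e3, Finset.prod_insert (by simp)]
  have q2 : ∏ j ∈ Finset.Icc 0 r, n j = n r * ∏ j ∈ Finset.Ico 0 r, n j := by
    rw [e4, Finset.prod_insert (by simp)]
  have q3 : ∏ j ∈ Finset.Icc ℓ 0, n j = n ℓ * ∏ j ∈ Finset.Ioc ℓ 0, n j := by
    rw [e5, Finset.prod_insert (by simp)]
  rw [e1, Finset.prod_union d1, p1, p2, e2, Finset.prod_union d2, q3]
  rw [q1] at q2
  linear_combination (-(n ℓ * ∏ j ∈ Finset.Ioc ℓ 0, n j)) * q2

lemma vTree_len {S : Finset ℤ} {T : Finset (List ℤ)} (hT : vTree S T) (w : List ℤ) (hw : w ∈ T) :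
    w.length < T.card := by
  have htake : ∀ k, k ≤ w.length → w.take (w.length - k) ∈ T := by
    intro k
    induction k with
    | zero => intro _; simpa using hw
    | succ k ih =>
      intro hk
      have h1 := hT.2.2 _ (ih (by omega)) (by
        intro h
        have := congrArg List.length h
        rw [List.length_take] at this
        simp at this; omega)
      rw [List.dropLast_eq_take, List.length_take, List.take_take] at h1
      convert h1 using 2
      omega
  have := Finset.card_le_card_of_injOn (s := Finset.range (w.length + 1)) (t := T)
    (fun k => w.take k) (by
      intro k hk
      have hk : k < w.length + 1 := by simpa using hk
      have := htake (w.length - k) (by omega)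
      rw [show w.length - (w.length - k) = k by omega] at this
      exact this) (by
      intro a ha b hb hab
      have ha : a < w.length + 1 := by simpa using ha
      have hb : b < w.length + 1 := by simpa using hb
      have := congrArg List.length hab
      simp only [List.length_take] at this
      omega)
  simp at this; omega

noncomputable def vY (ℓ r : ℤ) (j : ℤ) : MvPolynomial (Finset.Icc ℓ r) ℤ :=
  if h : j ∈ Finset.Icc ℓ r then MvPolynomial.X ⟨j, h⟩ else 0

open Classical in
lemma vY_coeff (ℓ r : ℤ) (hl : ℓ ≤ 0) (hr : 0 ≤ r)
    (n : ℤ → ℕ) (hzero : ∀ i : ℤ, i < ℓ ∨ r < i → n i = 0) (nf : Finset.Icc ℓ r →₀ ℕ)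
    (hnf : ∀ i, nf i = n i) (T : Finset (List ℤ)) :
    MvPolynomial.coeff nf (vwt (vY ℓ r) 0 T) =
      if ∀ i : ℤ, (T.filter fun w => w.sum = i).card = n i then 1 else 0 := by
  by_cases hT : ∀ w ∈ T, w.sum ∈ Finset.Icc ℓ r
  · let e : List ℤ → Finset.Icc ℓ r := fun w => 
      if h : w.sum ∈ Finset.Icc ℓ r then ⟨w.sum, h⟩ else ⟨0, Finset.mem_Icc.mpr ⟨hl, hr⟩⟩
    have he : ∀ w ∈ T, (e w : ℤ) = w.sum := by
      intro w hw; simp only [e]; rw [dif_pos (hT w hw)]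
    have h1 : vwt (vY ℓ r) 0 T = MvPolynomial.monomial (∑ w ∈ T, Finsupp.single (e w) 1) 1 := by
      rw [MvPolynomial.monomial_sum_one]
      unfold vwt
      refine Finset.prod_congr rfl fun w hw => ?_
      simp only [vY, e, zero_add]
      rw [dif_pos (hT w hw), dif_pos (hT w hw)]
      rfl
    rw [h1, MvPolynomial.coeff_monomial]
    have h2 : ∀ i : Finset.Icc ℓ r, (∑ w ∈ T, Finsupp.single (e w) 1) i =
        (T.filter fun w : List ℤ => w.sum = (i : ℤ)).card := by
      intro i
      rw [Finsupp.finsetSum_apply, Finset.card_filter]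
      refine Finset.sum_congr rfl fun w hw => ?_
      rw [Finsupp.single_apply]
      simp only [← he w hw, Subtype.coe_inj]
    congr 1
    apply propext
    constructor
    · intro h i
      by_cases hi : i ∈ Finset.Icc ℓ r
      · rw [← h2 ⟨i, hi⟩, h, hnf]
      · rw [hzero i (by rw [Finset.mem_Icc] at hi; omega), Finset.card_eq_zero, 
          Finset.filter_eq_empty_iff]
        rintro w hw rfl
        exact hi (hT w hw)
    · intro h
      ext i
      rw [h2, h, hnf]
  · push Not at hT
    obtain ⟨w, hw, hws⟩ := hT
    rw [if_neg, vwt, Finset.prod_eq_zero hw, MvPolynomial.coeff_zero]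
    · rw [vY, dif_neg (by simpa using hws)]
    · intro h
      have := h w.sum
      rw [hzero _ (by rw [Finset.mem_Icc] at hws; omega), Finset.card_eq_zero, 
          Finset.filter_eq_empty_iff] at this
      exact this hw rfl

/-- Let `S ⊆ ℤ` with `max S = 1` and either `min S = -1` or `ℓ = 0`.
The number of `S`-ary trees with vertical profile `(n ℓ, …, n r)` equals
`(n 0 / (n ℓ * n r)) * C(∑_{s∈S} n (-s), n 0 - 1) *
∏_{ℓ ≤ i ≤ r, i ≠ 0} C(∑_{s∈S} n (i - s) - 1, n i - 1)`, stated here with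
denominators cleared.  An `S`-ary tree (a plane tree in which every vertex has at
most one child at abscissa `a(v) + s` for each `s ∈ S`) is encoded by the set of the
words of steps leading from the root to its vertices: a finite, prefix-closed set of
lists with entries in `S`, containing the empty word (the root); the abscissa of a
vertex is the sum of its word. -/
theorem S_ary_vertical_profile
    (S : Finset ℤ) (h1S : 1 ∈ S) (hSle : ∀ s ∈ S, s ≤ 1)
    (ℓ r : ℤ) (hl : ℓ ≤ 0) (hr : 0 ≤ r)
    (hmin : ((-1 : ℤ) ∈ S ∧ ∀ s ∈ S, -1 ≤ s) ∨ ℓ = 0)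
    (n : ℤ → ℕ) (hpos : ∀ i ∈ Finset.Icc ℓ r, 0 < n i)
    (hzero : ∀ i : ℤ, i < ℓ ∨ r < i → n i = 0) :
    {T : Finset (List ℤ) |
        ([] : List ℤ) ∈ T ∧
        (∀ w ∈ T, ∀ x ∈ w, x ∈ S) ∧
        (∀ w ∈ T, w ≠ [] → w.dropLast ∈ T) ∧
        (∀ i : ℤ, (T.filter fun w => w.sum = i).card = n i)}.ncard
      * (n ℓ * n r) =
    n 0 * Nat.choose (∑ s ∈ S, n (-s)) (n 0 - 1) *
      ∏ i ∈ (Finset.Icc ℓ r).erase 0,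
        Nat.choose ((∑ s ∈ S, n (i - s)) - 1) (n i - 1) := by
  classical
  have h0m : (0 : ℤ) ∈ Finset.Icc ℓ r := Finset.mem_Icc.mpr ⟨hl, hr⟩
  set d := ∑ i : Finset.Icc ℓ r, n i with hd
  have hset : {T : Finset (List ℤ) |
        ([] : List ℤ) ∈ T ∧
        (∀ w ∈ T, ∀ x ∈ w, x ∈ S) ∧
        (∀ w ∈ T, w ≠ [] → w.dropLast ∈ T) ∧
        (∀ i : ℤ, (T.filter fun w => w.sum = i).card = n i)} =
      (((vT S d).filter fun T => ∀ i : ℤ, (T.filter fun w => w.sum = i).card = n i :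
        Finset (Finset (List ℤ))) : Set (Finset (List ℤ))) := by
    ext T
    rw [Finset.mem_coe, Finset.mem_filter, mem_vT, Set.mem_ofPred_eq]
    constructor
    · rintro ⟨a, b, c, e⟩
      refine ⟨⟨⟨a, b, c⟩, ?_⟩, e⟩
      have hc : T.card = d := by
        rw [hd, Finset.sum_coe_sort (Finset.Icc ℓ r) n, Finset.card_eq_sum_card_fiberwise 
          (f := List.sum) (t := Finset.Icc ℓ r)]
        · exact Finset.sum_congr rfl fun i _ => e i
        · intro w hw
          by_contra hws
          have := e w.sum
          rw [hzero _ (by rw [Finset.mem_coe, Finset.mem_Icc] at hws; omega),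
            Finset.card_eq_zero, Finset.filter_eq_empty_iff] at this
          exact this hw rfl
      intro w hw
      rw [← hc]
      exact vTree_len ⟨a, b, c⟩ w hw
    · rintro ⟨⟨⟨a, b, c⟩, _⟩, e⟩
      exact ⟨a, b, c, e⟩
  rw [hset, Set.ncard_coe_finset]
  set K := ((vT S d).filter fun T => ∀ i : ℤ, (T.filter fun w => w.sum = i).card = n i).card
    with hK
  let A : Finset.Icc ℓ r → Finset (Finset.Icc ℓ r) := fun i => 
    Finset.univ.filter fun j => (j : ℤ) - i ∈ S
  have hA : ∀ i j, j ∈ A i ↔ (j : ℤ) - i ∈ S := by intro i j; simp [A]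
  let nf : Finset.Icc ℓ r →₀ ℕ := Finsupp.equivFunOnFinite.symm fun i => n i
  have hnf : ∀ i, nf i = n i := fun i => rfl
  have hout : ∀ h i, i ∉ Finset.Icc ℓ r → vg S (vY ℓ r) h i = 0 := by
    intro h i hi
    rcases h with _ | h
    · simp [vg, vT]
    · rw [vg_succ, vY, dif_neg hi, zero_mul]
  have hmain := vD_main A (fun h i => vg S (vY ℓ r) h i) (by intro i; simp [vg, vT]) (by
    intro h i
    rw [vg_succ, vY, dif_pos i.2]
    congr 1
    symm
    refine Finset.prod_of_injOn (fun j => (j : ℤ) - i) ?_ ?_ ?_ ?_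
    · intro a _ b _ hab
      exact Subtype.ext (by simpa using hab)
    · intro j hj
      exact (hA i j).mp hj
    · intro s hs hn
      rw [hout, add_zero]
      intro hm
      exact hn ⟨⟨i + s, hm⟩, by simp [hA, hs], by simp⟩
    · intro j _
      simp) d nf rfl {(d, ⟨0, h0m⟩)} (by simp)
  have hcoef : MvPolynomial.coeff nf (vg S (vY ℓ r) d 0) = (K : ℤ) := by
    unfold vg
    rw [MvPolynomial.coeff_sum, Finset.sum_congr rfl fun T _ => 
      vY_coeff ℓ r hl hr n hzero nf hnf T, hK, Finset.card_filter]
    push_cast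
    rfl
  have hcount : ∀ j : Finset.Icc ℓ r, Multiset.count j ({⟨0, h0m⟩} : Multiset (Finset.Icc ℓ r)) = 
      if (j : ℤ) = 0 then 1 else 0 := by
    intro j
    rw [Multiset.count_singleton]
    simp [Subtype.ext_iff]
  simp only [Multiset.map_singleton, Multiset.prod_singleton, hcoef, hcount] at hmain
  have hev := vD_eval S h1S hSle ℓ r hl hr hmin n A hA
  have hK2 : (K : ℤ) = vD A (fun j => (vN A (fun i => n i) j : ℤ)) 
      (fun j => (n j : ℤ) - if (j : ℤ) = 0 then 1 else 0) := by
    rw [hmain]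
    congr 1
    funext j
    rw [hnf]; push_cast; rfl
  rw [← hK2] at hev
  have hN : ∀ j, vN A (fun i => n i) j = ∑ s ∈ S, n (j - s) := by
    intro j
    unfold vN
    rw [← Finset.sum_filter]
    refine Finset.sum_of_injOn (fun i => (j : ℤ) - i) ?_ ?_ ?_ ?_
    · intro a _ b _ hab
      exact Subtype.ext (by simpa using hab)
    · intro i hi
      have hi : j ∈ A i := by simpa using hi
      exact (hA i j).mp hi
    · intro s hs hn
      by_contra hne
      have hm : (j : ℤ) - s ∈ Finset.Icc ℓ r := by
        by_contra hm
        exact hne (hzero _ (by rw [Finset.mem_Icc] at hm; omega))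
      exact hn ⟨⟨j - s, hm⟩, by simp [hA, hs], by simp⟩
    · intro i _
      simp
  simp only [hN] at hev
  rw [Finset.prod_coe_sort (Finset.Icc ℓ r) (fun i => (n i : ℤ)), 
    Finset.prod_coe_sort (Finset.Icc ℓ r) (fun j => if j = 0 then 
      vch ((∑ s ∈ S, n (j - s) : ℕ) : ℤ) ((n j : ℤ) - 1) else
      vch (((∑ s ∈ S, n (j - s) : ℕ) : ℤ) - 1) ((n j : ℤ) - 1) * 
        ((if 0 < j then n (j - 1) else n (j + 1) : ℕ) : ℤ))] at hev
  conv_rhs at hev => rw [← Finset.mul_prod_erase _ _ h0m, if_pos rfl]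
  have hrest : ∀ j ∈ (Finset.Icc ℓ r).erase 0, (if j = 0 then 
      vch ((∑ s ∈ S, n (j - s) : ℕ) : ℤ) ((n j : ℤ) - 1) else
      vch (((∑ s ∈ S, n (j - s) : ℕ) : ℤ) - 1) ((n j : ℤ) - 1) * 
        ((if 0 < j then n (j - 1) else n (j + 1) : ℕ) : ℤ)) = 
      (Nat.choose ((∑ s ∈ S, n (j - s)) - 1) (n j - 1) : ℤ) * 
        (if 0 < j then (n (j - 1) : ℤ) else (n (j + 1) : ℤ)) := by
    intro j hj
    rw [Finset.mem_erase] at hj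
    rw [if_neg hj.1]
    have hp := hpos j hj.2
    have hj2 := Finset.mem_Icc.mp hj.2
    have hS : 0 < ∑ s ∈ S, n (j - s) := by
      have : ∃ s ∈ S, 0 < n (j - s) := by
        rcases lt_or_gt_of_ne hj.1 with hneg | hpos'
        · refine ⟨-1, ?_, hpos _ (Finset.mem_Icc.mpr (by omega))⟩
          rcases hmin with h | h
          · exact h.1
          · omega
        · exact ⟨1, h1S, hpos _ (Finset.mem_Icc.mpr (by omega))⟩
      obtain ⟨s, hs, h⟩ := this
      exact lt_of_lt_of_le h (Finset.single_le_sum (f := fun s => n (j - s)) (fun _ _ => Nat.zero_le _) hs)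
    rw [← vch_nat, Nat.cast_sub (by omega), Nat.cast_sub (by omega)]
    push_cast
    rfl
  rw [Finset.prod_congr rfl hrest, Finset.prod_mul_distrib] at hev
  have hnb := vprod_nb ℓ r hl hr (fun i => (n i : ℤ))
  have hfirst : vch ((∑ s ∈ S, n (0 - s) : ℕ) : ℤ) ((n 0 : ℤ) - 1) = 
      (Nat.choose (∑ s ∈ S, n (-s)) (n 0 - 1) : ℤ) := by
    have := hpos 0 h0m
    rw [← vch_nat, Nat.cast_sub (by omega)]
    simp
  rw [hfirst] at hev
  have hne : ∏ i ∈ Finset.Icc ℓ r, (n i : ℤ) ≠ 0 := 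
    Finset.prod_ne_zero_iff.mpr fun i hi => by have := hpos i hi; omega
  zify
  apply mul_right_cancel₀ hne
  linear_combination ((n ℓ : ℤ) * n r) * hev + 
    ((Nat.choose (∑ s ∈ S, n (-s)) (n 0 - 1) : ℤ) * ∏ i ∈ (Finset.Icc ℓ r).erase 0,
        (Nat.choose ((∑ s ∈ S, n (i - s)) - 1) (n i - 1) : ℤ)) * hnb
end
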